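/- arXiv:1502.07290 — 4 statements merged into one kernel-verified Lean document; each statement's English description precedes it below -/
import Mathlib

section
/- The map t ↦ λ(t) is strictly decreasing on (a,b]: if a < s < t ≤ b then λ(t) < λ(s). -/
open MeasureTheory Set

/-- Membership in the Sobolev space `H¹₀((a,t))`: `u` is continuous on `[a,t]`,
has derivative `u'` on `(a,t)` with `u'` square-integrable, and vanishes at both
endpoints. -/
def MemH10 (a t : ℝ) (u u' : ℝ → ℝ) : Prop :=
  ContinuousOn u (Set.Icc a t) ∧
  (∀ x ∈ Set.Ioo a t, HasDerivAt u (u' x) x) ∧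
  IntervalIntegrable (fun x => (u' x) ^ 2) volume a t ∧
  u a = 0 ∧ u t = 0

/-- The ground state energy
`λ(t) = inf { ∫_a^t ((u')² + V u²) : u ∈ H¹₀((a,t)), ∫_a^t u² = 1 }`. -/
noncomputable def groundStateEnergy (a : ℝ) (V : ℝ → ℝ) (t : ℝ) : ℝ :=
  sInf { E : ℝ | ∃ u u' : ℝ → ℝ, MemH10 a t u u' ∧
    (∫ x in a..t, (u x) ^ 2) = 1 ∧
    E = ∫ x in a..t, ((u' x) ^ 2 + V x * (u x) ^ 2) }

lemma memLp_of_piecewise {a t : ℝ} (hat : a ≤ t) {S : Set ℝ} (hS : S.Countable) {φ p : ℝ → ℝ}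
    (hd : ∀ x ∈ Ioo a t \ S, HasDerivAt φ (p x) x)
    (hi : IntervalIntegrable (fun x => (p x) ^ 2) volume a t) :
    MemLp p 2 (volume.restrict (Ioc a t)) := by
  have hm : AEStronglyMeasurable p (volume.restrict (Ioc a t)) := by
    refine (aestronglyMeasurable_deriv φ (volume.restrict (Ioc a t))).congr ?_
    have h1 : ∀ᵐ x ∂(volume : Measure ℝ), x ∉ S ∪ {t} := by
      have : (volume : Measure ℝ) (S ∪ {t}) = 0 :=
        (hS.union (countable_singleton t)).measure_zero _
      exact measure_eq_zero_iff_ae_notMem.mp this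
    rw [Filter.EventuallyEq, ae_restrict_iff' measurableSet_Ioc]
    filter_upwards [h1] with x hx hx2
    simp only [mem_union, mem_singleton_iff, not_or] at hx
    exact (hd x ⟨⟨hx2.1, lt_of_le_of_ne hx2.2 hx.2⟩, hx.1⟩).deriv
  rw [memLp_two_iff_integrable_sq hm]
  exact (intervalIntegrable_iff_integrableOn_Ioc_of_le hat).mp hi

lemma intervalIntegrable_of_piecewise {a t : ℝ} (hat : a ≤ t) {S : Set ℝ} (hS : S.Countable)
    {φ p : ℝ → ℝ}
    (hd : ∀ x ∈ Ioo a t \ S, HasDerivAt φ (p x) x)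
    (hi : IntervalIntegrable (fun x => (p x) ^ 2) volume a t) :
    IntervalIntegrable p volume a t := by
  rw [intervalIntegrable_iff_integrableOn_Ioc_of_le hat]
  exact (memLp_of_piecewise hat hS hd hi).integrable (by norm_num)

set_option maxHeartbeats 1000000 in
lemma quad_nonneg_of_piecewise {a t : ℝ} (hat : a < t) {W : ℝ → ℝ}
    (hW : ContinuousOn W (Icc a t))
    (H : ∀ v v' : ℝ → ℝ, MemH10 a t v v' → 0 ≤ ∫ x in a..t, ((v' x) ^ 2 + W x * (v x) ^ 2))
    {S : Set ℝ} (hS : S.Countable) {φ p : ℝ → ℝ}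
    (hc : ContinuousOn φ (Icc a t))
    (hd : ∀ x ∈ Ioo a t \ S, HasDerivAt φ (p x) x)
    (hi : IntervalIntegrable (fun x => (p x) ^ 2) volume a t)
    (h0 : φ a = 0) (h1 : φ t = 0) :
    0 ≤ ∫ x in a..t, ((p x) ^ 2 + W x * (φ x) ^ 2) := by
  have hle := hat.le
  have hLp := memLp_of_piecewise hle hS hd hi
  have hpi := intervalIntegrable_of_piecewise hle hS hd hi
  obtain ⟨M, hM⟩ := isCompact_Icc.exists_bound_of_continuousOn hW
  obtain ⟨K, hK⟩ := isCompact_Icc.exists_bound_of_continuousOn hc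
  have hM0 : 0 ≤ M := (norm_nonneg _).trans (hM a ⟨le_rfl, hle⟩)
  have hK0 : 0 ≤ K := (norm_nonneg _).trans (hK a ⟨le_rfl, hle⟩)
  set F := ∫ x in a..t, ((p x) ^ 2 + W x * (φ x) ^ 2) with hF
  set P := ∫ x in a..t, (p x) ^ 2 with hP
  set L := t - a with hL
  have hL0 : 0 < L := sub_pos.mpr hat
  have hWφ : IntervalIntegrable (fun x => W x * (φ x) ^ 2) volume a t := by
    apply ContinuousOn.intervalIntegrable
    rw [uIcc_of_le hle]
    exact hW.mul (hc.pow 2)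
  have key : ∀ η : ℝ, 0 < η → η ≤ 1 →
      0 ≤ F + η * (P + 2 + L * (M * ((1 + L) * (2 * K + (1 + L))))) := by
    intro η hη hη1
    obtain ⟨q, hq, hqLp⟩ := MemLp.exists_boundedContinuous_integral_rpow_sub_le
      (p := 2) (by norm_num) (f := p) (μ := volume.restrict (Ioc a t))
      (by simpa using hLp) (ε := η ^ 2) (by positivity)
    have hqc : Continuous (fun x => q x) := q.continuous
    have hqi : IntervalIntegrable (fun x => q x) volume a t := hqc.intervalIntegrable _ _
    set e : ℝ → ℝ := fun x => p x - q x with he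
    have hei : IntervalIntegrable e volume a t := hpi.sub hqi
    have heLp : MemLp e 2 (volume.restrict (Ioc a t)) := hLp.sub (by simpa using hqLp)
    have he2 : IntervalIntegrable (fun x => e x ^ 2) volume a t := by
      rw [intervalIntegrable_iff_integrableOn_Ioc_of_le hle]
      exact heLp.integrable_sq
    have hA : ∫ x in a..t, e x ^ 2 ≤ η ^ 2 := by
      rw [intervalIntegral.integral_of_le hle]
      refine le_trans (le_of_eq ?_) hq
      congr 1; ext x
      simp [he]
    have hp0 : ∫ x in a..t, p x = 0 := by
      rw [integral_eq_of_hasDerivAt_off_countable_of_le φ p hle hS hc hd hpi, h0, h1, sub_zero]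
    set c := (∫ x in a..t, q x) / L with hcdef
    have hcL : ∫ x in a..t, q x = c * L := by rw [hcdef]; field_simp
    have hInte : ∫ x in a..t, e x = - (c * L) := by
      rw [he, intervalIntegral.integral_sub hpi hqi, hp0, hcL, zero_sub]
    set r : ℝ → ℝ := fun x => q x - c with hr
    have hrc : Continuous r := hqc.sub continuous_const
    set d : ℝ → ℝ := fun x => p x - r x with hdd
    have hde : ∀ x, d x = e x + c := fun x => by simp only [hdd, hr, he]; ring
    have hdi : IntervalIntegrable d volume a t := hpi.sub (hrc.intervalIntegrable _ _)
    have hd2eq : (fun x => d x ^ 2) = fun x => (e x ^ 2 + (2 * c) * e x) + c ^ 2 := by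
      ext x; rw [hde]; ring
    have hd2 : IntervalIntegrable (fun x => d x ^ 2) volume a t := by
      rw [hd2eq]
      exact (he2.add (hei.const_mul _)).add intervalIntegrable_const
    have hD : ∫ x in a..t, d x ^ 2 ≤ η ^ 2 := by
      rw [hd2eq, intervalIntegral.integral_add (he2.add (hei.const_mul _)) intervalIntegrable_const,
        intervalIntegral.integral_add he2 (hei.const_mul _), intervalIntegral.integral_const_mul,
        hInte, intervalIntegral.integral_const, smul_eq_mul]
      nlinarith [mul_nonneg (sq_nonneg c) hL0.le]
    have hdabs : ∫ x in a..t, |d x| ≤ η * (1 + L) := by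
      have h2 : ∫ x in a..t, |d x| ≤ ∫ x in a..t, (η⁻¹ * d x ^ 2 + η) := by
        apply intervalIntegral.integral_mono_on hle hdi.abs
          ((hd2.const_mul _).add intervalIntegrable_const)
        intro x _
        have : η * |d x| ≤ η * (η⁻¹ * d x ^ 2 + η) := by
          rw [mul_add, ← mul_assoc, mul_inv_cancel₀ hη.ne', one_mul, ← sq_abs (d x)]
          nlinarith [sq_nonneg (|d x| - η), sq_nonneg (|d x|), sq_nonneg η]
        exact le_of_mul_le_mul_left this hη
      rw [intervalIntegral.integral_add (hd2.const_mul _) intervalIntegrable_const,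
        intervalIntegral.integral_const_mul, intervalIntegral.integral_const, smul_eq_mul] at h2
      have h3 : η⁻¹ * ∫ x in a..t, d x ^ 2 ≤ η⁻¹ * η ^ 2 :=
        mul_le_mul_of_nonneg_left hD (by positivity)
      have h4 : η⁻¹ * η ^ 2 = η := by field_simp
      nlinarith
    set ψ : ℝ → ℝ := fun x => ∫ y in a..x, r y with hψ
    have hψd : ∀ x, HasDerivAt ψ (r x) x := fun x =>
      intervalIntegral.integral_hasDerivAt_right (hrc.intervalIntegrable _ _)
        (hrc.stronglyMeasurableAtFilter _ _) hrc.continuousAt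
    have hψc : Continuous ψ := continuous_iff_continuousAt.mpr fun x => (hψd x).continuousAt
    have hψt : ψ t = 0 := by
      simp only [hψ, hr]
      rw [intervalIntegral.integral_sub hqi intervalIntegrable_const, hcL,
        intervalIntegral.integral_const, smul_eq_mul]
      ring
    have hr2 : IntervalIntegrable (fun x => r x ^ 2) volume a t :=
      (hrc.pow 2).intervalIntegrable _ _
    have hpos := H ψ r ⟨hψc.continuousOn, fun x _ => hψd x, hr2, by simp [hψ], hψt⟩
    have hdiff : ∀ x ∈ Icc a t, |φ x - ψ x| ≤ η * (1 + L) := by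
      intro x hx
      have hsub : uIcc a x ⊆ uIcc a t := by
        rw [uIcc_of_le hx.1, uIcc_of_le hle]; exact Icc_subset_Icc le_rfl hx.2
      have e1 : φ x = ∫ y in a..x, p y := by
        rw [integral_eq_of_hasDerivAt_off_countable_of_le φ p hx.1 hS
          (hc.mono (Icc_subset_Icc le_rfl hx.2))
          (fun y hy => hd y ⟨⟨hy.1.1, hy.1.2.trans_le hx.2⟩, hy.2⟩) (hpi.mono_set hsub), h0, sub_zero]
      have e2 : φ x - ψ x = ∫ y in a..x, d y := by
        rw [e1, hψ, hdd, intervalIntegral.integral_sub (hpi.mono_set hsub)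
          (hrc.intervalIntegrable _ _)]
      rw [e2]
      refine (intervalIntegral.abs_integral_le_integral_abs hx.1).trans (le_trans ?_ hdabs)
      exact intervalIntegral.integral_mono_interval le_rfl hx.1 hx.2
        (Filter.Eventually.of_forall fun _ => abs_nonneg _) hdi.abs
    set δ := η * (1 + L) with hδ
    have hδ0 : 0 ≤ δ := by positivity
    have hδ1 : δ ≤ 1 + L := by nlinarith
    have hmono : ∫ x in a..t, ((r x) ^ 2 + W x * (ψ x) ^ 2) ≤
        ∫ x in a..t, (((p x ^ 2 + W x * φ x ^ 2) + (η * p x ^ 2 + (1 + η⁻¹) * d x ^ 2)) +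
          M * (δ * (2 * K + δ))) := by
      apply intervalIntegral.integral_mono_on hle
      · apply hr2.add
        apply ContinuousOn.intervalIntegrable
        rw [uIcc_of_le hle]
        exact hW.mul (hψc.continuousOn.pow 2)
      · exact ((hi.add hWφ).add ((hi.const_mul _).add (hd2.const_mul _))).add
          intervalIntegrable_const
      · intro x hx
        have i1 : r x ^ 2 ≤ p x ^ 2 + (η * p x ^ 2 + (1 + η⁻¹) * d x ^ 2) := by
          have : r x = p x - d x := by simp [hdd]
          rw [this]
          have h5 : 0 ≤ η * (p x + η⁻¹ * d x) ^ 2 := by positivity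
          have h6 : η * (p x + η⁻¹ * d x) ^ 2 = η * p x ^ 2 + 2 * p x * d x + η⁻¹ * d x ^ 2 := by
            field_simp
            ring
          have h7 : (p x - d x) ^ 2 = p x ^ 2 - 2 * p x * d x + d x ^ 2 := by ring
          linarith
        have i2 : W x * ψ x ^ 2 ≤ W x * φ x ^ 2 + M * (δ * (2 * K + δ)) := by
          have h7 := hdiff x hx
          have h8 := hK x hx
          have h9 := hM x hx
          rw [Real.norm_eq_abs] at h8 h9
          have h10 : |ψ x + φ x| ≤ 2 * K + δ := by
            have : ψ x + φ x = 2 * φ x - (φ x - ψ x) := by ring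
            rw [this]
            refine (abs_sub _ _).trans ?_
            rw [abs_mul, abs_two]; linarith
          have h11 : |W x * ((ψ x + φ x) * (φ x - ψ x))| ≤ M * (δ * (2 * K + δ)) := by
            rw [abs_mul, abs_mul]
            rw [mul_comm δ]
            gcongr
          have h12 := (abs_le.mp h11).1
          have h13 : W x * ((ψ x + φ x) * (φ x - ψ x)) = W x * φ x ^ 2 - W x * ψ x ^ 2 := by ring
          linarith
        linarith
    rw [intervalIntegral.integral_add
        ((hi.add hWφ).add ((hi.const_mul _).add (hd2.const_mul _))) intervalIntegrable_const,
      intervalIntegral.integral_add (hi.add hWφ) ((hi.const_mul _).add (hd2.const_mul _)),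
      intervalIntegral.integral_add (hi.const_mul _) (hd2.const_mul _),
      intervalIntegral.integral_const_mul, intervalIntegral.integral_const_mul,
      intervalIntegral.integral_const, smul_eq_mul] at hmono
    have j1 : (1 + η⁻¹) * ∫ x in a..t, d x ^ 2 ≤ (1 + η⁻¹) * η ^ 2 :=
      mul_le_mul_of_nonneg_left hD (by positivity)
    have j2 : (1 + η⁻¹) * η ^ 2 = η ^ 2 + η := by field_simp
    have j3 : L * (M * (δ * (2 * K + δ))) ≤ L * (M * (δ * (2 * K + (1 + L)))) := by gcongr
    have j4 : L * (M * (δ * (2 * K + (1 + L)))) =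
      η * (L * (M * ((1 + L) * (2 * K + (1 + L))))) := by rw [hδ]; ring
    have j5 : η ^ 2 ≤ η := by nlinarith
    rw [← hL, ← hF, ← hP] at hmono
    have j6 : η * (P + 2 + L * (M * ((1 + L) * (2 * K + (1 + L))))) =
      η * P + 2 * η + η * (L * (M * ((1 + L) * (2 * K + (1 + L))))) := by ring
    linarith
  by_contra hneg
  push Not at hneg
  set C := P + 2 + L * (M * ((1 + L) * (2 * K + (1 + L)))) with hC
  have hP0 : 0 ≤ P := intervalIntegral.integral_nonneg hle fun x _ => sq_nonneg _
  have hC0 : 0 < C := by positivity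
  have hη : 0 < min 1 (-F / (2 * C)) := lt_min one_pos (div_pos (by linarith) (by positivity))
  have := key _ hη (min_le_left _ _)
  have h2 : min 1 (-F / (2 * C)) * C ≤ -F / (2 * C) * C :=
    mul_le_mul_of_nonneg_right (min_le_right _ _) hC0.le
  have h3 : -F / (2 * C) * C = -F / 2 := by field_simp
  linarith

lemma gronwall_backward {a s K δ : ℝ} (has : a ≤ s) (hK : 0 < K) {u : ℝ → ℝ}
    (hu : ContinuousOn u (Icc a s))
    (hb : ∀ x ∈ Icc a s, |u x| ≤ δ + K * ∫ y in x..s, |u y|) :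
    ∀ x ∈ Icc a s, |u x| ≤ δ * Real.exp (K * (s - x)) := by
  set w : ℝ → ℝ := fun y => |u (max a (min s y))| with hw
  have hwc : Continuous w := by
    apply Continuous.abs
    apply hu.comp_continuous (by fun_prop)
    intro x
    exact ⟨le_max_left _ _, max_le has (min_le_left _ _)⟩
  have hwu : ∀ y ∈ Icc a s, w y = |u y| := by
    intro y hy
    simp only [hw]
    rw [min_eq_right hy.2, max_eq_right hy.1]
  set f : ℝ → ℝ := fun z => - ∫ y in s..(s - z), w y with hf
  have hfd : ∀ z, HasDerivAt f (w (s - z)) z := by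
    intro z
    have h1 : HasDerivAt (fun x => ∫ y in s..x, w y) (w (s - z)) (s - z) :=
      intervalIntegral.integral_hasDerivAt_right (hwc.intervalIntegrable _ _)
        (hwc.stronglyMeasurableAtFilter _ _) hwc.continuousAt
    have h2 : HasDerivAt (fun z : ℝ => s - z) (-1) z := by
      simpa using (hasDerivAt_id z).const_sub s
    have h3 : HasDerivAt f (-(w (s - z) * -1)) z := (h1.comp z h2).neg
    rwa [mul_neg_one, neg_neg] at h3
  have hfz : ∀ z ∈ Icc 0 (s - a), f z = ∫ y in (s - z)..s, |u y| := by
    intro z hz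
    simp only [hf]
    rw [← intervalIntegral.integral_symm]
    apply intervalIntegral.integral_congr
    intro y hy
    rw [uIcc_of_le (by linarith [hz.1])] at hy
    exact hwu y ⟨by linarith [hz.2, hy.1], hy.2⟩
  have hf0 : ∀ z ∈ Icc 0 (s - a), 0 ≤ f z := by
    intro z hz
    rw [hfz z hz]
    exact intervalIntegral.integral_nonneg (by linarith [hz.1]) fun _ _ => abs_nonneg _
  have hbd : ∀ z ∈ Icc 0 (s - a), ‖w (s - z)‖ ≤ K * ‖f z‖ + δ := by
    intro z hz
    have hm : s - z ∈ Icc a s := ⟨by linarith [hz.2], by linarith [hz.1]⟩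
    rw [Real.norm_of_nonneg (hf0 z hz), hwu _ hm, Real.norm_eq_abs, abs_abs, hfz z hz]
    linarith [hb _ hm]
  have hg := norm_le_gronwallBound_of_norm_deriv_right_le (f := f) (f' := fun z => w (s - z))
    (δ := 0) (K := K) (ε := δ) (a := 0) (b := s - a)
    (fun z _ => (hfd z).continuousAt.continuousWithinAt)
    (fun z _ => (hfd z).hasDerivWithinAt) (by simp [hf])
    (fun z hz => hbd z ⟨hz.1, hz.2.le⟩)
  intro x hx
  have hz : s - x ∈ Icc 0 (s - a) := ⟨by linarith [hx.2], by linarith [hx.1]⟩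
  have h1 := hg _ hz
  have h2 := hbd _ hz
  rw [gronwallBound_of_K_ne_0 hK.ne'] at h1
  simp only [zero_mul, zero_add, sub_zero] at h1
  rw [sub_sub_cancel, hwu x hx, Real.norm_eq_abs, abs_abs] at h2
  have h3 : K * ‖f (s - x)‖ ≤ K * (δ / K * (Real.exp (K * (s - x)) - 1)) :=
    mul_le_mul_of_nonneg_left h1 hK.le
  have h4 : K * (δ / K * (Real.exp (K * (s - x)) - 1)) = δ * Real.exp (K * (s - x)) - δ := by
    field_simp
  linarith

lemma scaled_mem {a t : ℝ} {V v v' : ℝ → ℝ} (hv : MemH10 a t v v')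
    (hN : 0 < ∫ x in a..t, v x ^ 2) :
    (∫ x in a..t, ((v' x) ^ 2 + V x * (v x) ^ 2)) / (∫ x in a..t, v x ^ 2) ∈
    { E : ℝ | ∃ u u' : ℝ → ℝ, MemH10 a t u u' ∧
    (∫ x in a..t, (u x) ^ 2) = 1 ∧
    E = ∫ x in a..t, ((u' x) ^ 2 + V x * (u x) ^ 2) } := by
  set N := ∫ x in a..t, v x ^ 2 with hNd
  obtain ⟨h1, h2, h3, h4, h5⟩ := hv
  have hsq : (Real.sqrt N)⁻¹ ^ 2 = N⁻¹ := by rw [inv_pow, Real.sq_sqrt hN.le]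
  refine ⟨fun x => (Real.sqrt N)⁻¹ * v x, fun x => (Real.sqrt N)⁻¹ * v' x,
    ⟨continuousOn_const.mul h1, fun x hx => (h2 x hx).const_mul _, ?_, by simp [h4], by simp [h5]⟩,
    ?_, ?_⟩
  · simp only [mul_pow]
    exact h3.const_mul _
  · simp only [mul_pow]
    rw [intervalIntegral.integral_const_mul, hsq, ← hNd, inv_mul_cancel₀ hN.ne']
  · rw [div_eq_inv_mul, ← intervalIntegral.integral_const_mul]
    congr 1; ext x
    simp only [mul_pow, hsq]; ring

lemma energy_lower {a t M : ℝ} (hat : a ≤ t) {V v v' : ℝ → ℝ} (hV : ContinuousOn V (Icc a t))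
    (hM : ∀ x ∈ Icc a t, |V x| ≤ M) (hv : MemH10 a t v v') :
    -M * (∫ x in a..t, v x ^ 2) ≤ ∫ x in a..t, ((v' x) ^ 2 + V x * (v x) ^ 2) := by
  obtain ⟨h1, h2, h3, h4, h5⟩ := hv
  rw [← intervalIntegral.integral_const_mul]
  apply intervalIntegral.integral_mono_on hat
  · apply ContinuousOn.intervalIntegrable
    rw [uIcc_of_le hat]
    exact continuousOn_const.mul (h1.pow 2)
  · apply h3.add
    apply ContinuousOn.intervalIntegrable
    rw [uIcc_of_le hat]
    exact hV.mul (h1.pow 2)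
  · intro x hx
    have := (abs_le.mp (hM x hx)).1
    nlinarith [sq_nonneg (v' x), mul_le_mul_of_nonneg_right this (sq_nonneg (v x))]

lemma set_nonempty {a s : ℝ} (has : a < s) (V : ℝ → ℝ) :
    { E : ℝ | ∃ u u' : ℝ → ℝ, MemH10 a s u u' ∧
    (∫ x in a..s, (u x) ^ 2) = 1 ∧
    E = ∫ x in a..s, ((u' x) ^ 2 + V x * (u x) ^ 2) }.Nonempty := by
  refine ⟨_, scaled_mem (V := V) (v := fun x => (x - a) * (s - x))
    (v' := fun x => 1 * (s - x) + (x - a) * (-1)) ⟨?_, ?_, ?_, by simp, by simp⟩ ?_⟩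
  · exact Continuous.continuousOn (by fun_prop)
  · intro x _
    exact ((hasDerivAt_id x).sub_const a).mul ((hasDerivAt_id x).const_sub s)
  · exact Continuous.intervalIntegrable (by fun_prop) _ _
  · apply intervalIntegral.intervalIntegral_pos_of_pos_on
    · exact Continuous.intervalIntegrable (by fun_prop) _ _
    · intro x hx
      have h1 : 0 < x - a := by linarith [hx.1]
      have h2 : 0 < s - x := by linarith [hx.2]
      positivity
    · exact has

set_option maxHeartbeats 1000000 in
lemma test_ineq {a s t M : ℝ} (has : a < s) (hst : s < t) {W : ℝ → ℝ}
    (hW : ContinuousOn W (Icc a t)) (hM : ∀ x ∈ Icc a t, |W x| ≤ M)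
    (H : ∀ v v' : ℝ → ℝ, MemH10 a t v v' → 0 ≤ ∫ x in a..t, ((v' x) ^ 2 + W x * (v x) ^ 2))
    {u u' : ℝ → ℝ} (hu : MemH10 a s u u') {x : ℝ} (hx : x ∈ Icc a s) (τ : ℝ) :
    0 ≤ (∫ y in a..s, ((u' y) ^ 2 + W y * (u y) ^ 2)) +
      2 * τ * (-u x + ∫ y in x..s, W y * ((y - x) * u y)) +
      τ ^ 2 * ((t - a) * ((1 + M * (t - a) ^ 2) * (1 + ((t - a) / (t - s)) ^ 2))) := by
  obtain ⟨huc, hud, hui, hua, hus⟩ := hu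
  have hax := hx.1
  have hxs := hx.2
  have hat : a < t := has.trans hst
  set k := (s - x) / (t - s) with hk
  have hts : 0 < t - s := by linarith
  have hkts : k * (t - s) = s - x := by rw [hk]; field_simp
  set φ : ℝ → ℝ := fun y => if y ≤ s then u y + τ * max (y - x) 0 else τ * (k * (t - y)) with hφ
  set p : ℝ → ℝ := fun y => if y ≤ s then (if y ≤ x then u' y else u' y + τ) else -(τ * k) with hp
  have hM0 : 0 ≤ M := (abs_nonneg _).trans (hM a ⟨le_rfl, hat.le⟩)
  have hui' : IntervalIntegrable u' volume a s :=
    intervalIntegrable_of_piecewise has.le countable_empty (fun y hy => hud y hy.1) hui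
  have sub1 : uIcc a x ⊆ uIcc a s := by
    rw [uIcc_of_le hax, uIcc_of_le has.le]; exact Icc_subset_Icc le_rfl hxs
  have sub2 : uIcc x s ⊆ uIcc a s := by
    rw [uIcc_of_le hxs, uIcc_of_le has.le]; exact Icc_subset_Icc hax le_rfl
  have cont1 : ContinuousOn φ (Icc a s) := by
    have : ContinuousOn (fun y => u y + τ * max (y - x) 0) (Icc a s) :=
      huc.add (Continuous.continuousOn (by fun_prop))
    refine this.congr fun y hy => ?_
    simp only [hφ, if_pos hy.2]
  have cont2 : ContinuousOn φ (Icc s t) := by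
    have : ContinuousOn (fun y => τ * (k * (t - y))) (Icc s t) :=
      Continuous.continuousOn (by fun_prop)
    refine this.congr fun y hy => ?_
    simp only [hφ]
    split_ifs with h
    · have : y = s := le_antisymm h hy.1
      subst this
      rw [hus, max_eq_left (by linarith), hkts, zero_add]
    · rfl
  have cont : ContinuousOn φ (Icc a t) := by
    rw [← Icc_union_Icc_eq_Icc has.le hst.le]
    exact cont1.union_of_isClosed cont2 isClosed_Icc isClosed_Icc
  have hder : ∀ y ∈ Ioo a t \ {x, s}, HasDerivAt φ (p y) y := by
    rintro y ⟨⟨hy1, hy2⟩, hy3⟩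
    simp only [mem_insert_iff, mem_singleton_iff, not_or] at hy3
    rcases lt_or_gt_of_ne hy3.2 with hys | hys
    · have hd1 := hud y ⟨hy1, hys⟩
      rcases lt_or_gt_of_ne hy3.1 with hyx | hyx
      · have e1 : p y = u' y := by simp only [hp, if_pos hys.le, if_pos hyx.le]
        rw [e1]
        refine hd1.congr_of_eventuallyEq ?_
        filter_upwards [Iio_mem_nhds hys, Iio_mem_nhds hyx] with z hz1 hz2
        simp only [hφ, if_pos (mem_Iio.mp hz1).le]
        rw [max_eq_right (by linarith [mem_Iio.mp hz2])]; ring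
      · have e1 : p y = u' y + τ := by simp only [hp, if_pos hys.le, if_neg (not_le.mpr hyx)]
        rw [e1]
        have hd2 : HasDerivAt (fun z => u z + τ * (z - x)) (u' y + τ) y := by
          have := hd1.add (((hasDerivAt_id y).sub_const x).const_mul τ)
          rw [mul_one] at this
          exact this
        refine hd2.congr_of_eventuallyEq ?_
        filter_upwards [Iio_mem_nhds hys, Ioi_mem_nhds hyx] with z hz1 hz2
        simp only [hφ, if_pos (mem_Iio.mp hz1).le]
        rw [max_eq_left (by linarith [mem_Ioi.mp hz2])]
    · have e1 : p y = -(τ * k) := by simp only [hp, if_neg (not_le.mpr hys)]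
      rw [e1]
      have hd2 : HasDerivAt (fun z => τ * (k * (t - z))) (-(τ * k)) y := by
        have := (((hasDerivAt_id y).const_sub t).const_mul k).const_mul τ
        have e : τ * (k * -1) = -(τ * k) := by ring
        rw [e] at this
        exact this
      refine hd2.congr_of_eventuallyEq ?_
      filter_upwards [Ioi_mem_nhds hys] with z hz1
      simp only [hφ, if_neg (not_le.mpr (mem_Ioi.mp hz1))]
  have hWu : IntervalIntegrable (fun y => W y * u y ^ 2) volume a s := by
    apply ContinuousOn.intervalIntegrable
    rw [uIcc_of_le has.le]
    exact (hW.mono (Icc_subset_Icc le_rfl hst.le)).mul (huc.pow 2)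
  have hQ : IntervalIntegrable (fun y => u' y ^ 2 + W y * u y ^ 2) volume a s := hui.add hWu
  have hWx : ContinuousOn W (uIcc x s) := by
    rw [uIcc_of_le hxs]; exact hW.mono (Icc_subset_Icc hax hst.le)
  have hux : ContinuousOn u (uIcc x s) := by
    rw [uIcc_of_le hxs]; exact huc.mono (Icc_subset_Icc hax le_rfl)
  have hWt : ContinuousOn W (uIcc s t) := by
    rw [uIcc_of_le hst.le]; exact hW.mono (Icc_subset_Icc has.le le_rfl)
  have hB : IntervalIntegrable (fun y => W y * ((y - x) * u y)) volume x s :=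
    (hWx.mul ((Continuous.continuousOn (by fun_prop)).mul hux)).intervalIntegrable
  have hC1 : IntervalIntegrable (fun y => 1 + W y * (y - x) ^ 2) volume x s :=
    (continuousOn_const.add (hWx.mul
      (Continuous.continuousOn (by fun_prop)))).intervalIntegrable
  have hC2 : IntervalIntegrable (fun y => k ^ 2 * (1 + W y * (t - y) ^ 2)) volume s t :=
    (continuousOn_const.mul (continuousOn_const.add (hWt.mul
      (Continuous.continuousOn (by fun_prop))))).intervalIntegrable
  -- p² integrable
  have q1 : IntervalIntegrable (fun y => p y ^ 2) volume a x := by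
    refine (hui.mono_set sub1).congr_uIoo ?_
    intro y hy
    rw [uIoo_of_le hax] at hy
    simp only [hp, if_pos (hy.2.le.trans hxs), if_pos hy.2.le]
  have q2 : IntervalIntegrable (fun y => p y ^ 2) volume x s := by
    have : IntervalIntegrable (fun y => (u' y ^ 2 + (2 * τ) * u' y) + τ ^ 2) volume x s :=
      ((hui.mono_set sub2).add ((hui'.mono_set sub2).const_mul _)).add intervalIntegrable_const
    refine this.congr_uIoo ?_
    intro y hy
    rw [uIoo_of_le hxs] at hy
    simp only [hp, if_pos hy.2.le, if_neg (not_le.mpr hy.1)]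
    ring
  have q3 : IntervalIntegrable (fun y => p y ^ 2) volume s t := by
    have : IntervalIntegrable (fun y : ℝ => (τ * k) ^ 2) volume s t := intervalIntegrable_const
    refine this.congr_uIoo ?_
    intro y hy
    rw [uIoo_of_le hst.le] at hy
    simp only [hp, if_neg (not_le.mpr hy.1)]
    ring
  have hpi : IntervalIntegrable (fun y => p y ^ 2) volume a t := (q1.trans q2).trans q3
  have hφa : φ a = 0 := by
    simp only [hφ, if_pos has.le]
    rw [max_eq_right (by linarith), hua]; ring
  have hφt : φ t = 0 := by
    simp only [hφ, if_neg (not_le.mpr hst)]; ring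
  have main := quad_nonneg_of_piecewise hat hW H (S := {x, s})
    ((countable_singleton s).insert x) cont hder hpi hφa hφt
  have hWφ : IntervalIntegrable (fun y => W y * φ y ^ 2) volume a t := by
    apply ContinuousOn.intervalIntegrable
    rw [uIcc_of_le hat.le]
    exact hW.mul (cont.pow 2)
  have hint := hpi.add hWφ
  have m1 : IntervalIntegrable (fun y => p y ^ 2 + W y * φ y ^ 2) volume a x :=
    hint.mono_set (by
      rw [uIcc_of_le hax, uIcc_of_le hat.le]; exact Icc_subset_Icc le_rfl (hxs.trans hst.le))
  have m2 : IntervalIntegrable (fun y => p y ^ 2 + W y * φ y ^ 2) volume x s :=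
    hint.mono_set (by
      rw [uIcc_of_le hxs, uIcc_of_le hat.le]; exact Icc_subset_Icc hax hst.le)
  have m3 : IntervalIntegrable (fun y => p y ^ 2 + W y * φ y ^ 2) volume s t :=
    hint.mono_set (by
      rw [uIcc_of_le hst.le, uIcc_of_le hat.le]; exact Icc_subset_Icc has.le le_rfl)
  rw [← intervalIntegral.integral_add_adjacent_intervals (m1.trans m2) m3,
    ← intervalIntegral.integral_add_adjacent_intervals m1 m2] at main
  have r1 : ∫ y in a..x, (p y ^ 2 + W y * φ y ^ 2) = ∫ y in a..x, (u' y ^ 2 + W y * u y ^ 2) := by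
    apply intervalIntegral.integral_congr_Ioo_of_le hax
    intro y hy
    simp only [hp, hφ, if_pos (hy.2.le.trans hxs), if_pos hy.2.le]
    rw [max_eq_right (by linarith [hy.2])]; ring
  have r2 : ∫ y in x..s, (p y ^ 2 + W y * φ y ^ 2) =
      (∫ y in x..s, (u' y ^ 2 + W y * u y ^ 2)) +
      2 * τ * (-u x + ∫ y in x..s, W y * ((y - x) * u y)) +
      τ ^ 2 * ∫ y in x..s, (1 + W y * (y - x) ^ 2) := by
    have ftc : ∫ y in x..s, u' y = - u x := by
      rw [integral_eq_of_hasDerivAt_off_countable_of_le u u' hxs countable_empty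
        (huc.mono (Icc_subset_Icc hax le_rfl))
        (fun y hy => hud y ⟨hax.trans_lt hy.1.1, hy.1.2⟩) (hui'.mono_set sub2), hus, zero_sub]
    rw [← ftc, ← intervalIntegral.integral_add (hui'.mono_set sub2) hB,
      ← intervalIntegral.integral_const_mul, ← intervalIntegral.integral_const_mul,
      ← intervalIntegral.integral_add (hQ.mono_set sub2)
        (((hui'.mono_set sub2).add hB).const_mul _),
      ← intervalIntegral.integral_add ((hQ.mono_set sub2).add
        (((hui'.mono_set sub2).add hB).const_mul _)) (hC1.const_mul _)]
    apply intervalIntegral.integral_congr_Ioo_of_le hxs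
    intro y hy
    simp only [hp, hφ, if_pos hy.2.le, if_neg (not_le.mpr hy.1)]
    rw [max_eq_left (by linarith [hy.1])]; ring
  have r3 : ∫ y in s..t, (p y ^ 2 + W y * φ y ^ 2) =
      τ ^ 2 * ∫ y in s..t, k ^ 2 * (1 + W y * (t - y) ^ 2) := by
    rw [← intervalIntegral.integral_const_mul]
    apply intervalIntegral.integral_congr_Ioo_of_le hst.le
    intro y hy
    simp only [hp, hφ, if_neg (not_le.mpr hy.1)]
    ring
  have r4 := intervalIntegral.integral_add_adjacent_intervals
    (hQ.mono_set sub1) (hQ.mono_set sub2)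
  have wb : ∀ y ∈ Icc a t, ∀ z : ℝ, 0 ≤ z → z ≤ t - a →
      1 + W y * z ^ 2 ≤ 1 + M * (t - a) ^ 2 := by
    intro y hy z hz hz2
    have h1 := (abs_le.mp (hM y hy)).2
    have h2 : z ^ 2 ≤ (t - a) ^ 2 := pow_le_pow_left₀ hz hz2 2
    have h3 : W y * z ^ 2 ≤ M * z ^ 2 := mul_le_mul_of_nonneg_right h1 (sq_nonneg z)
    have h4 : M * z ^ 2 ≤ M * (t - a) ^ 2 := mul_le_mul_of_nonneg_left h2 hM0
    linarith
  set D := 1 + M * (t - a) ^ 2 with hD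
  have hD0 : 0 ≤ D := by positivity
  have b1 : ∫ y in x..s, (1 + W y * (y - x) ^ 2) ≤ (t - a) * D := by
    have : ∫ y in x..s, (1 + W y * (y - x) ^ 2) ≤ ∫ y in x..s, D := by
      apply intervalIntegral.integral_mono_on hxs hC1 intervalIntegrable_const
      intro y hy
      exact wb y ⟨hax.trans hy.1, hy.2.trans hst.le⟩ _ (by linarith [hy.1]) (by linarith [hy.2])
    rw [intervalIntegral.integral_const, smul_eq_mul] at this
    exact this.trans (mul_le_mul_of_nonneg_right (by linarith) hD0)
  set κ := (t - a) / (t - s) with hκ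
  have hk0 : 0 ≤ k := div_nonneg (by linarith) hts.le
  have hkκ : k ^ 2 ≤ κ ^ 2 := by
    apply pow_le_pow_left₀ hk0
    rw [hk, hκ]
    gcongr
  have b2 : ∫ y in s..t, k ^ 2 * (1 + W y * (t - y) ^ 2) ≤ (t - a) * (κ ^ 2 * D) := by
    have : ∫ y in s..t, k ^ 2 * (1 + W y * (t - y) ^ 2) ≤ ∫ y in s..t, κ ^ 2 * D := by
      apply intervalIntegral.integral_mono_on hst.le hC2 intervalIntegrable_const
      intro y hy
      have h1 := wb y ⟨has.le.trans hy.1, hy.2⟩ (t - y) (by linarith [hy.2]) (by linarith [hy.1])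
      exact (mul_le_mul_of_nonneg_left h1 (sq_nonneg k)).trans
        (mul_le_mul_of_nonneg_right hkκ hD0)
    rw [intervalIntegral.integral_const, smul_eq_mul] at this
    exact this.trans (mul_le_mul_of_nonneg_right (by linarith) (by positivity))
  have b3 := mul_le_mul_of_nonneg_left (add_le_add b1 b2) (sq_nonneg τ)
  have b4 : τ ^ 2 * ((t - a) * D + (t - a) * (κ ^ 2 * D)) =
    τ ^ 2 * ((t - a) * (D * (1 + κ ^ 2))) := by ring
  rw [r1, r2, r3] at main
  rw [b4, mul_add] at b3
  linarith

set_option maxHeartbeats 1000000 in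
lemma ground_state_aux (a b : ℝ) (hab : a < b)
    (V : ℝ → ℝ) (hV : ContinuousOn V (Set.Icc a b))
    (s t : ℝ) (has : a < s) (hst : s < t) (htb : t ≤ b) :
    groundStateEnergy a V t < groundStateEnergy a V s := by
  by_contra hcon
  push Not at hcon
  have hat : a < t := has.trans hst
  have hVt : ContinuousOn V (Icc a t) := hV.mono (Icc_subset_Icc le_rfl htb)
  set l := groundStateEnergy a V s with hl
  set W : ℝ → ℝ := fun x => V x - l with hWdef
  have hW : ContinuousOn W (Icc a t) := hVt.sub continuousOn_const
  obtain ⟨M, hM⟩ := isCompact_Icc.exists_bound_of_continuousOn hW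
  simp only [Real.norm_eq_abs] at hM
  obtain ⟨MV, hMV⟩ := isCompact_Icc.exists_bound_of_continuousOn hVt
  simp only [Real.norm_eq_abs] at hMV
  have hM0 : 0 ≤ M := (abs_nonneg _).trans (hM a ⟨le_rfl, hat.le⟩)
  have shift : ∀ r, a ≤ r → r ≤ t → ∀ v v' : ℝ → ℝ, MemH10 a r v v' →
      ∫ x in a..r, ((v' x) ^ 2 + W x * (v x) ^ 2) =
      (∫ x in a..r, ((v' x) ^ 2 + V x * (v x) ^ 2)) - l * ∫ x in a..r, v x ^ 2 := by
    rintro r har hrt v v' ⟨h1, h2, h3, h4, h5⟩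
    have hv2 : IntervalIntegrable (fun x => v x ^ 2) volume a r := by
      apply ContinuousOn.intervalIntegrable
      rw [uIcc_of_le har]; exact h1.pow 2
    have hVv : IntervalIntegrable (fun x => V x * v x ^ 2) volume a r := by
      apply ContinuousOn.intervalIntegrable
      rw [uIcc_of_le har]; exact (hVt.mono (Icc_subset_Icc le_rfl hrt)).mul (h1.pow 2)
    rw [← intervalIntegral.integral_const_mul,
      ← intervalIntegral.integral_sub (h3.add hVv) (hv2.const_mul _)]
    congr 1; ext x
    simp only [hWdef]; ring
  have H : ∀ v v' : ℝ → ℝ, MemH10 a t v v' →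
      0 ≤ ∫ x in a..t, ((v' x) ^ 2 + W x * (v x) ^ 2) := by
    intro v v' hv
    have hN : 0 ≤ ∫ x in a..t, v x ^ 2 :=
      intervalIntegral.integral_nonneg hat.le fun _ _ => sq_nonneg _
    rcases hN.eq_or_lt with hN | hN
    · have := energy_lower hat.le hW hM hv
      rw [← hN, mul_zero] at this
      exact this
    · rw [shift t hat.le le_rfl v v' hv]
      have h1 : groundStateEnergy a V t ≤
          (∫ x in a..t, ((v' x) ^ 2 + V x * (v x) ^ 2)) / (∫ x in a..t, v x ^ 2) := by
        refine csInf_le ⟨-MV, ?_⟩ (scaled_mem hv hN)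
        rintro E ⟨u, u', hu, hu1, rfl⟩
        have := energy_lower hat.le hVt hMV hu
        rw [hu1, mul_one] at this
        exact this
      have h2 := hcon.trans h1
      rw [le_div_iff₀ hN] at h2
      linarith
  set L := t - a with hL
  have hL0 : 0 < L := sub_pos.mpr hat
  set C := L * ((1 + M * L ^ 2) * (1 + (L / (t - s)) ^ 2)) with hC
  have hC0 : 0 ≤ C := by positivity
  set K := M * L + 1 with hK
  have hK0 : 0 < K := by positivity
  set G := (1 + C) * Real.exp (K * L) with hG
  have hG0 : 0 < G := by positivity
  set θ := ((G + 1) * (L + 1))⁻¹ with hθ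
  have hθ0 : 0 < θ := by positivity
  obtain ⟨E, ⟨u, u', hu, hu1, hE⟩, hEl⟩ := exists_lt_of_csInf_lt (set_nonempty has V)
    (show groundStateEnergy a V s < l + θ ^ 2 by rw [← hl]; linarith [sq_pos_of_pos hθ0])
  have hQ : ∫ x in a..s, ((u' x) ^ 2 + W x * (u x) ^ 2) < θ ^ 2 := by
    rw [shift s has.le hst.le u u' hu, hu1, ← hE]; linarith
  have hbound : ∀ x ∈ Icc a s, |u x| ≤ θ * (1 + C) + K * ∫ y in x..s, |u y| := by
    intro x hx
    set B := -u x + ∫ y in x..s, W y * ((y - x) * u y) with hB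
    have t1 := test_ineq has hst hW hM H hu hx θ
    have t2 := test_ineq has hst hW hM H hu hx (-θ)
    rw [← hB, ← hL, ← hC] at t1 t2
    have hBabs : |B| ≤ θ * (1 + C) := by
      rw [abs_le]
      constructor
      · refine le_of_mul_le_mul_left ?_ hθ0
        nlinarith [mul_nonneg (sq_nonneg θ) hC0]
      · refine le_of_mul_le_mul_left ?_ hθ0
        nlinarith [mul_nonneg (sq_nonneg θ) hC0]
    have huI : ContinuousOn u (uIcc x s) := by
      rw [uIcc_of_le hx.2]; exact hu.1.mono (Icc_subset_Icc hx.1 le_rfl)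
    have hint : |∫ y in x..s, W y * ((y - x) * u y)| ≤ K * ∫ y in x..s, |u y| := by
      refine (intervalIntegral.abs_integral_le_integral_abs hx.2).trans ?_
      rw [← intervalIntegral.integral_const_mul]
      apply intervalIntegral.integral_mono_on hx.2
      · apply ContinuousOn.intervalIntegrable
        have hWx : ContinuousOn W (uIcc x s) := by
          rw [uIcc_of_le hx.2]; exact hW.mono (Icc_subset_Icc hx.1 hst.le)
        exact (hWx.mul ((Continuous.continuousOn (by fun_prop)).mul huI)).abs
      · exact (continuousOn_const.mul huI.abs).intervalIntegrable
      · intro y hy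
        rw [abs_mul, abs_mul, ← mul_assoc]
        apply mul_le_mul_of_nonneg_right _ (abs_nonneg _)
        have h1 := hM y ⟨hx.1.trans hy.1, hy.2.trans hst.le⟩
        have h2 : |y - x| ≤ L := by
          rw [abs_of_nonneg (by linarith [hy.1])]
          linarith [hy.2, hx.1]
        have h3 : |W y| * |y - x| ≤ M * L := mul_le_mul h1 h2 (abs_nonneg _) hM0
        linarith
    have e : u x = (∫ y in x..s, W y * ((y - x) * u y)) - B := by rw [hB]; ring
    rw [e]
    refine (abs_sub _ _).trans ?_
    linarith
  have hfin := gronwall_backward has.le hK0 hu.1 hbound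
  have hsmall : ∀ x ∈ Icc a s, u x ^ 2 ≤ (θ * G) ^ 2 := by
    intro x hx
    rw [← sq_abs]
    apply pow_le_pow_left₀ (abs_nonneg _)
    refine (hfin x hx).trans ?_
    rw [hG, ← mul_assoc]
    gcongr
    linarith [hx.1]
  have hle : ∫ x in a..s, u x ^ 2 ≤ ∫ x in a..s, (θ * G) ^ 2 := by
    apply intervalIntegral.integral_mono_on has.le _ intervalIntegrable_const hsmall
    apply ContinuousOn.intervalIntegrable
    rw [uIcc_of_le has.le]; exact hu.1.pow 2
  rw [hu1, intervalIntegral.integral_const, smul_eq_mul] at hle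
  have hθG : θ * G ≤ (L + 1)⁻¹ := by
    have e : θ * G = G / (G + 1) * (L + 1)⁻¹ := by rw [hθ]; field_simp
    rw [e]
    have : G / (G + 1) ≤ 1 := by rw [div_le_one (by positivity)]; linarith
    exact mul_le_of_le_one_left (by positivity) this
  have h2 : (θ * G) ^ 2 ≤ (L + 1)⁻¹ ^ 2 := pow_le_pow_left₀ (by positivity) hθG 2
  have h3 : (s - a) * (θ * G) ^ 2 ≤ L * (L + 1)⁻¹ ^ 2 :=
    mul_le_mul (by linarith) h2 (by positivity) hL0.le
  have h4 : L * (L + 1)⁻¹ ^ 2 < 1 := by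
    rw [inv_pow, ← div_eq_mul_inv, div_lt_one (by positivity)]
    have h5 : (L + 1) ^ 2 = L * L + L + L + 1 := by ring
    rw [h5]
    have h6 : 0 < L * L := mul_pos hL0 hL0
    linarith
  linarith

/-- the ground state energy `λ` is strictly decreasing on `(a,b]`. -/
theorem ground_state_strictAnti (a b : ℝ) (hab : a < b)
    (V : ℝ → ℝ) (hV : ContinuousOn V (Set.Icc a b))
    (s t : ℝ) (has : a < s) (hst : s < t) (htb : t ≤ b) :
    groundStateEnergy a V t < groundStateEnergy a V s := by
  exact ground_state_aux a b hab V hV s t has hst htb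
end

section
/- If V is convex on [a,b], then the map t ↦ λ(t) is convex on (a,b]: for all s, t ∈ (a,b] and θ ∈ [0,1], λ(θ s + (1−θ) t) ≤ θ λ(s) + (1−θ) λ(t). -/
open MeasureTheory Set

noncomputable def prf (W : ℝ → ℝ) (μ x y : ℝ) : ℝ :=
  Real.cos y ^ 2 + (μ - W x) * Real.sin y ^ 2

/-- strict comparison -/
lemma cmp_strict_Ico {d d' : ℝ → ℝ} {x0 x1 K : ℝ} (hK : 0 ≤ K)
    (hc : ContinuousOn d (Icc x0 x1)) (hd : ∀ x ∈ Ico x0 x1, HasDerivAt d (d' x) x)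
    (hb : ∀ x ∈ Ico x0 x1, -(K * |d x|) ≤ d' x) (h0 : 0 < d x0) :
    ∀ x ∈ Icc x0 x1, 0 < d x := by
  have key := image_le_of_deriv_right_lt_deriv_boundary (f := fun x => - d x)
    (f' := fun x => - d' x) (a := x0) (b := x1) hc.neg
    (fun x hx => (hd x hx).neg.hasDerivWithinAt)
    (B := fun x => -(d x0 * Real.exp (-(K+1) * (x - x0))))
    (B' := fun x => -(d x0 * (Real.exp (-(K+1) * (x - x0)) * (-(K+1) * 1)))) (by simp)
    (fun x => ((((((hasDerivAt_id x).sub_const x0).const_mul (-(K+1))).exp).const_mul (d x0)).neg))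
    (by
      intro x hx h
      have hE := Real.exp_pos (-(K+1) * (x - x0))
      have h1 : d x = d x0 * Real.exp (-(K+1) * (x - x0)) := by simpa using h
      have hp : 0 < d x := by rw [h1]; positivity
      have h2 := hb x hx
      rw [abs_of_pos hp] at h2
      have : -(d x0 * (Real.exp (-(K+1) * (x - x0)) * (-(K+1) * 1))) = (K+1) * d x := by
        rw [h1]; ring
      rw [this]; linarith)
  intro x hx
  have h := key hx
  have hE := Real.exp_pos (-(K+1) * (x - x0))
  have : 0 < d x0 * Real.exp (-(K+1) * (x - x0)) := by positivity
  linarith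

lemma cmp_strict {d d' : ℝ → ℝ} {x0 x1 K : ℝ} (hK : 0 ≤ K)
    (hc : ContinuousOn d (Icc x0 x1)) (hd : ∀ x ∈ Ioo x0 x1, HasDerivAt d (d' x) x)
    (hb : ∀ x ∈ Ioo x0 x1, -(K * |d x|) ≤ d' x) (h0 : 0 < d x0) :
    ∀ x ∈ Icc x0 x1, 0 < d x := by
  intro x hx
  rcases hx.1.eq_or_lt with h | h
  · rwa [← h]
  have hcw : ContinuousWithinAt d (Icc x0 x1) x0 := hc x0 ⟨le_rfl, hx.1.trans hx.2⟩
  have h1 : ∀ᶠ y in nhdsWithin x0 (Ioo x0 x), 0 < d y :=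
    (hcw.mono (fun y hy => ⟨hy.1.le, hy.2.le.trans hx.2⟩)).eventually_const_lt h0
  have : (nhdsWithin x0 (Ioo x0 x)).NeBot := left_nhdsWithin_Ioo_neBot h
  obtain ⟨y, hy, hyI⟩ := (h1.and self_mem_nhdsWithin).exists
  exact cmp_strict_Ico hK (hc.mono (Icc_subset_Icc hyI.1.le le_rfl))
    (fun z hz => hd z ⟨hyI.1.trans_le hz.1, hz.2⟩)
    (fun z hz => hb z ⟨hyI.1.trans_le hz.1, hz.2⟩) hy x ⟨hyI.2.le, hx.2⟩

lemma cmp_le {d d' : ℝ → ℝ} {x0 x1 K : ℝ} (hK : 0 ≤ K)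
    (hc : ContinuousOn d (Icc x0 x1)) (hd : ∀ x ∈ Ioo x0 x1, HasDerivAt d (d' x) x)
    (hb : ∀ x ∈ Ioo x0 x1, -(K * |d x|) ≤ d' x) (h0 : 0 ≤ d x0) :
    ∀ x ∈ Icc x0 x1, 0 ≤ d x := by
  intro x hx
  refine le_of_forall_pos_le_add fun ε hε => ?_
  set η := ε * Real.exp (-((K+1) * (x - x0))) with hη
  have hηp : 0 < η := by positivity
  have := cmp_strict (d := fun y => d y + η * Real.exp ((K+1) * (y - x0)))
    (d' := fun y => d' y + η * (Real.exp ((K+1) * (y - x0)) * ((K+1) * 1))) (x0 := x0) (x1 := x1)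
    hK (hc.add (by fun_prop))
    (fun y hy => (hd y hy).add (((((hasDerivAt_id y).sub_const x0).const_mul (K+1)).exp).const_mul η))
    (by
      intro y hy
      have h2 := hb y hy
      have hE : 0 < η * Real.exp ((K+1) * (y - x0)) := by positivity
      set e := η * Real.exp ((K+1) * (y - x0))
      have h3 : |d y| ≤ |d y + e| + e := by
        have := abs_sub (d y + e) e
        rw [add_sub_cancel_right, abs_of_pos hE] at this
        exact this
      have h4 : K * |d y| ≤ K * (|d y + e| + e) := mul_le_mul_of_nonneg_left h3 hK
      have h5 : η * (Real.exp ((K+1) * (y - x0)) * ((K+1) * 1)) = (K+1) * e := by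
        simp only [e]; ring
      simp only [h5]
      nlinarith)
    (by simp; linarith) x hx
  have h6 : η * Real.exp ((K+1) * (x - x0)) = ε := by
    rw [hη, mul_assoc, ← Real.exp_add]; simp
  linarith

lemma prf_lip {W : ℝ → ℝ} {C : ℝ} (hC : ∀ x, |W x| ≤ C) (μ x y z : ℝ) :
    |prf W μ x y - prf W μ x z| ≤ (2 * (1 + |μ| + C)) * |y - z| := by
  have h1 : prf W μ x y - prf W μ x z =
      (μ - W x - 1) * (Real.sin y + Real.sin z) * (Real.sin y - Real.sin z) := by
    unfold prf
    rw [Real.cos_sq', Real.cos_sq']; ring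
  have h2 : |Real.sin y - Real.sin z| ≤ |y - z| := by
    have := Real.lipschitzWith_sin.dist_le_mul y z
    simpa [Real.dist_eq] using this
  have h3 : |Real.sin y + Real.sin z| ≤ 2 := by
    have := abs_add_le (Real.sin y) (Real.sin z)
    have := Real.abs_sin_le_one y
    have := Real.abs_sin_le_one z
    linarith
  have h4 : |μ - W x - 1| ≤ 1 + |μ| + C := by
    have a1 := abs_sub (μ - W x) 1
    have a2 := abs_sub μ (W x)
    have := hC x
    simp at a1
    linarith
  rw [h1, abs_mul, abs_mul]
  have h5 : |μ - W x - 1| * |Real.sin y + Real.sin z| ≤ (1 + |μ| + C) * 2 := by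
    gcongr
    exact (abs_nonneg _).trans h4
  calc _ ≤ ((1 + |μ| + C) * 2) * |y - z| := by
        gcongr
        exact (by positivity : (0:ℝ) ≤ |μ - W x - 1| * |Real.sin y + Real.sin z|).trans h5
    _ = _ := by ring

lemma prf_bound {W : ℝ → ℝ} {C : ℝ} (hC : ∀ x, |W x| ≤ C) (μ x y : ℝ) :
    |prf W μ x y| ≤ 1 + |μ| + C := by
  unfold prf
  have h1 := abs_add_le (Real.cos y ^ 2) ((μ - W x) * Real.sin y ^ 2)
  have h2 : |Real.cos y ^ 2| ≤ 1 := by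
    rw [abs_of_nonneg (sq_nonneg _)]; exact Real.cos_sq_le_one y
  have h3 : |(μ - W x) * Real.sin y ^ 2| ≤ |μ| + C := by
    rw [abs_mul, abs_of_nonneg (sq_nonneg (Real.sin y))]
    have a2 := abs_sub μ (W x)
    have := hC x
    have h4 := Real.sin_sq_le_one y
    have : |μ - W x| * Real.sin y ^ 2 ≤ |μ - W x| * 1 := by gcongr
    linarith
  linarith

lemma prf_sol {W : ℝ → ℝ} {C : ℝ} (hW : Continuous W) (hC : ∀ x, |W x| ≤ C) (a b : ℝ)
    (hab : a < b) (μ δ : ℝ) :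
    ∃ φ : ℝ → ℝ, Continuous φ ∧ φ a = δ ∧ ∀ x ∈ Icc a b, HasDerivAt φ (prf W μ x (φ x)) x := by
  have hC0 : 0 ≤ C := (abs_nonneg _).trans (hC 0)
  have hL : 0 ≤ 1 + |μ| + C := by positivity
  have ha : a ∈ Icc (a-1) (b+1) := ⟨by linarith, by linarith⟩
  have hle : a - 1 ≤ b + 1 := by linarith
  have hm : 0 ≤ (1 + |μ| + C) * max (b + 1 - a) (a - (a-1)) :=
    mul_nonneg hL (le_max_of_le_right (by linarith))
  have hPL : IsPicardLindelof (prf W μ) (⟨a, ha⟩ : Icc (a-1) (b+1)) δ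
      ⟨(1 + |μ| + C) * max (b + 1 - a) (a - (a-1)), hm⟩ 0 ⟨1 + |μ| + C, hL⟩
      ⟨2 * (1 + |μ| + C), by positivity⟩ := by
    refine ⟨fun t _ => ?_, fun y _ => ?_, fun t _ y _ => ?_, ?_⟩
    · refine LipschitzOnWith.of_dist_le_mul fun y _ z _ => ?_
      rw [Real.dist_eq, Real.dist_eq]
      exact prf_lip hC μ t y z
    · unfold prf
      fun_prop
    · rw [Real.norm_eq_abs]
      exact prf_bound hC μ t y
    · simp only [NNReal.coe_mk, NNReal.coe_zero, sub_zero]; exact le_rfl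
  obtain ⟨α, h1, h2⟩ := hPL.exists_eq_forall_mem_Icc_hasDerivWithinAt₀
  have hcont : ContinuousOn α (Icc (a-1) (b+1)) := fun x hx => (h2 x hx).continuousWithinAt
  refine ⟨IccExtend hle ((Icc (a-1) (b+1)).domRestrict α), ?_, ?_, ?_⟩
  · exact (continuousOn_iff_continuous_domRestrict.mp hcont).Icc_extend'
  · rw [IccExtend_of_mem hle _ ha]; exact h1
  · intro x hx
    have hxm : x ∈ Icc (a-1) (b+1) := ⟨by linarith [hx.1], by linarith [hx.2]⟩
    rw [IccExtend_of_mem hle _ hxm]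
    have hn : Icc (a-1) (b+1) ∈ nhds x := Icc_mem_nhds (by linarith [hx.1]) (by linarith [hx.2])
    refine ((h2 x hxm).hasDerivAt hn).congr_of_eventuallyEq ?_
    filter_upwards [hn] with y hy
    rw [IccExtend_of_mem hle _ hy]; rfl

structure IsSol (W : ℝ → ℝ) (a b μ δ : ℝ) (φ : ℝ → ℝ) : Prop where
  cont : Continuous φ
  start : φ a = δ
  der : ∀ x ∈ Icc a b, HasDerivAt φ (prf W μ x (φ x)) x

section
variable {W : ℝ → ℝ} {C a b μ δ : ℝ} {φ : ℝ → ℝ}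

lemma prf_const_nonneg (hC : ∀ x, |W x| ≤ C) (μ : ℝ) : 0 ≤ 2 * (1 + |μ| + C) := by
  have hC0 : 0 ≤ C := (abs_nonneg _).trans (hC 0)
  positivity

lemma low_bound (hC : ∀ x, |W x| ≤ C) {x y c : ℝ} (h : 0 ≤ prf W μ x c) :
    -((2 * (1 + |μ| + C)) * |y - c|) ≤ prf W μ x y := by
  have := prf_lip hC μ x y c
  have := neg_abs_le (prf W μ x y - prf W μ x c)
  linarith

lemma up_bound (hC : ∀ x, |W x| ≤ C) {x y c : ℝ} (h : prf W μ x c ≤ 0) :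
    -((2 * (1 + |μ| + C)) * |c - y|) ≤ - prf W μ x y := by
  have := prf_lip hC μ x y c
  have := le_abs_self (prf W μ x y - prf W μ x c)
  rw [abs_sub_comm c y]
  linarith

lemma sol_gt (hC : ∀ x, |W x| ≤ C) (hs : IsSol W a b μ δ φ) {x0 x1 c : ℝ} (h0 : a ≤ x0)
    (h1 : x1 ≤ b) (hc : ∀ x ∈ Icc x0 x1, 0 ≤ prf W μ x c) (hi : c < φ x0) :
    ∀ x ∈ Icc x0 x1, c < φ x := by
  intro x hx
  have := cmp_strict (d := fun x => φ x - c) (d' := fun x => prf W μ x (φ x))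
    (prf_const_nonneg hC μ) (hs.cont.sub continuous_const).continuousOn
    (fun x hx => (hs.der x ⟨h0.trans hx.1.le, hx.2.le.trans h1⟩).sub_const c)
    (fun x hx => low_bound hC (hc x (Ioo_subset_Icc_self hx))) (sub_pos.2 hi) x hx
  exact sub_pos.1 this

lemma sol_ge (hC : ∀ x, |W x| ≤ C) (hs : IsSol W a b μ δ φ) {x0 x1 c : ℝ} (h0 : a ≤ x0)
    (h1 : x1 ≤ b) (hc : ∀ x ∈ Icc x0 x1, 0 ≤ prf W μ x c) (hi : c ≤ φ x0) :
    ∀ x ∈ Icc x0 x1, c ≤ φ x := by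
  intro x hx
  have := cmp_le (d := fun x => φ x - c) (d' := fun x => prf W μ x (φ x))
    (prf_const_nonneg hC μ) (hs.cont.sub continuous_const).continuousOn
    (fun x hx => (hs.der x ⟨h0.trans hx.1.le, hx.2.le.trans h1⟩).sub_const c)
    (fun x hx => low_bound hC (hc x (Ioo_subset_Icc_self hx))) (sub_nonneg.2 hi) x hx
  exact sub_nonneg.1 this

lemma sol_lt (hC : ∀ x, |W x| ≤ C) (hs : IsSol W a b μ δ φ) {x0 x1 c : ℝ} (h0 : a ≤ x0)
    (h1 : x1 ≤ b) (hc : ∀ x ∈ Icc x0 x1, prf W μ x c ≤ 0) (hi : φ x0 < c) :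
    ∀ x ∈ Icc x0 x1, φ x < c := by
  intro x hx
  have := cmp_strict (d := fun x => c - φ x) (d' := fun x => - prf W μ x (φ x))
    (prf_const_nonneg hC μ) (continuous_const.sub hs.cont).continuousOn
    (fun x hx => (hs.der x ⟨h0.trans hx.1.le, hx.2.le.trans h1⟩).const_sub c)
    (fun x hx => up_bound hC (hc x (Ioo_subset_Icc_self hx))) (sub_pos.2 hi) x hx
  exact sub_pos.1 this

lemma sol_le (hC : ∀ x, |W x| ≤ C) (hs : IsSol W a b μ δ φ) {x0 x1 c : ℝ} (h0 : a ≤ x0)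
    (h1 : x1 ≤ b) (hc : ∀ x ∈ Icc x0 x1, prf W μ x c ≤ 0) (hi : φ x0 ≤ c) :
    ∀ x ∈ Icc x0 x1, φ x ≤ c := by
  intro x hx
  have := cmp_le (d := fun x => c - φ x) (d' := fun x => - prf W μ x (φ x))
    (prf_const_nonneg hC μ) (continuous_const.sub hs.cont).continuousOn
    (fun x hx => (hs.der x ⟨h0.trans hx.1.le, hx.2.le.trans h1⟩).const_sub c)
    (fun x hx => up_bound hC (hc x (Ioo_subset_Icc_self hx))) (sub_nonneg.2 hi) x hx
  exact sub_nonneg.1 this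

lemma prf_zero (x : ℝ) : prf W μ x 0 = 1 := by simp [prf]
lemma prf_pi (x : ℝ) : prf W μ x Real.pi = 1 := by simp [prf]
lemma prf_half (x : ℝ) : prf W μ x (Real.pi / 2) = μ - W x := by simp [prf]

lemma sol_gronwall (hC : ∀ x, |W x| ≤ C) (μ : ℝ) {s : ℝ} (hs : s ∈ Ioc a b) :
    ∃ M : ℝ, 0 ≤ M ∧ ∀ φ ψ δ μ' δ', IsSol W a b μ δ φ → IsSol W a b μ' δ' ψ →
      |φ s - ψ s| ≤ M * (|δ - δ'| + |μ - μ'|) := by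
  have hC0 : 0 ≤ C := (abs_nonneg _).trans (hC 0)
  have hK : 0 < 2 * (1 + |μ| + C) := by positivity
  set K := 2 * (1 + |μ| + C) with hKd
  have hE1 : 1 ≤ Real.exp (K * (s - a)) :=
    Real.one_le_exp (mul_nonneg hK.le (by linarith [hs.1]))
  have hE2 : 0 ≤ (Real.exp (K * (s - a)) - 1) / K := div_nonneg (by linarith) hK.le
  refine ⟨Real.exp (K * (s - a)) + (Real.exp (K * (s - a)) - 1) / K, by positivity, ?_⟩
  intro φ ψ δ μ' δ' hφ hψ
  have := dist_le_of_approx_trajectories_ODE (v := prf W μ) (K := ⟨K, hK.le⟩)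
    (f := φ) (g := ψ) (f' := fun x => prf W μ x (φ x)) (g' := fun x => prf W μ' x (ψ x))
    (a := a) (b := b) (εf := 0) (εg := |μ - μ'|) (δ := |δ - δ'|)
    (fun t => LipschitzWith.of_dist_le_mul fun y z => by
      rw [Real.dist_eq, Real.dist_eq]; exact prf_lip hC μ t y z)
    hφ.cont.continuousOn (fun t ht => (hφ.der t (Ico_subset_Icc_self ht)).hasDerivWithinAt)
    (fun t _ => by simp)
    hψ.cont.continuousOn (fun t ht => (hψ.der t (Ico_subset_Icc_self ht)).hasDerivWithinAt)
    (fun t _ => by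
      rw [Real.dist_eq]
      have : prf W μ' t (ψ t) - prf W μ t (ψ t) = (μ' - μ) * Real.sin (ψ t) ^ 2 := by
        unfold prf; ring
      rw [this, abs_mul, abs_of_nonneg (sq_nonneg (Real.sin (ψ t))), abs_sub_comm]
      exact mul_le_of_le_one_right (abs_nonneg _) (Real.sin_sq_le_one _))
    (by rw [hφ.start, hψ.start, Real.dist_eq]) s ⟨hs.1.le, hs.2⟩
  rw [Real.dist_eq, gronwallBound_of_K_ne_0 (by exact hK.ne')] at this
  refine this.trans ?_
  simp only [NNReal.coe_mk, zero_add]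
  have h1 := abs_nonneg (δ - δ')
  have h2 := abs_nonneg (μ - μ')
  have h3 : |μ - μ'| / K * (Real.exp (K * (s - a)) - 1)
    = |μ - μ'| * ((Real.exp (K * (s - a)) - 1) / K) := by ring
  have h4 : 0 ≤ |δ - δ'| * ((Real.exp (K * (s - a)) - 1) / K) := by positivity
  have h5 : 0 ≤ |μ - μ'| * Real.exp (K * (s - a)) := by positivity
  change |δ - δ'| * Real.exp (K * (s - a)) + |μ - μ'| / K * (Real.exp (K * (s - a)) - 1) ≤ _
  rw [h3]
  nlinarith

/-- Hardy-type lower bound with a solution staying in `(0,π)` -/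
lemma hardy_core (hW : Continuous W) (hs : IsSol W a b μ δ φ) {s : ℝ} (hsb : s ∈ Ioc a b)
    (hpos : ∀ x ∈ Icc a s, 0 < φ x ∧ φ x < Real.pi) {V : ℝ → ℝ} (hVW : ∀ x ∈ Icc a b, W x = V x)
    {v v' : ℝ → ℝ} (hv : MemH10 a s v v') (hn : (∫ x in a..s, (v x) ^ 2) = 1) :
    μ ≤ ∫ x in a..s, ((v' x) ^ 2 + V x * (v x) ^ 2) := by
  obtain ⟨hvc, hvd, hvi, hva, hvs⟩ := hv
  have has : a ≤ s := hsb.1.le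
  have hsin : ∀ x ∈ Icc a s, 0 < Real.sin (φ x) := fun x hx =>
    Real.sin_pos_of_pos_of_lt_pi (hpos x hx).1 (hpos x hx).2
  have huI : uIcc a s = Icc a s := uIcc_of_le has
  have i1 : IntervalIntegrable (fun x => W x * (v x)^2) volume a s := by
    apply ContinuousOn.intervalIntegrable
    rw [huI]; exact hW.continuousOn.mul (hvc.pow 2)
  have i2 : IntervalIntegrable (fun x => (v x)^2) volume a s := by
    apply ContinuousOn.intervalIntegrable
    rw [huI]; exact (hvc.pow 2)
  have i3 : IntervalIntegrable (fun x => ((v' x)^2 + W x * (v x)^2) - μ * (v x)^2) volume a s :=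
    (hvi.add i1).sub (i2.const_mul μ)
  have hfin := intervalIntegral.sub_le_integral_of_hasDeriv_right_of_le (a := a) (b := s)
    (g := fun x => Real.cos (φ x) / Real.sin (φ x) * (v x)^2)
    (g' := fun x => ((-Real.sin (φ x) * prf W μ x (φ x)) * Real.sin (φ x)
        - Real.cos (φ x) * (Real.cos (φ x) * prf W μ x (φ x))) / Real.sin (φ x)^2 * (v x)^2
        + Real.cos (φ x) / Real.sin (φ x) * (2 * v x ^ 1 * v' x))
    (φ := fun x => ((v' x)^2 + W x * (v x)^2) - μ * (v x)^2) has
    (by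
      refine ContinuousOn.mul (ContinuousOn.div ?_ ?_ fun x hx => (hsin x hx).ne') (hvc.pow 2)
      · exact (Real.continuous_cos.comp hs.cont).continuousOn
      · exact (Real.continuous_sin.comp hs.cont).continuousOn)
    (fun x hx => by
      have hx' := Ioo_subset_Icc_self hx
      have hd := hs.der x ⟨hx.1.le, hx.2.le.trans hsb.2⟩
      have := ((hd.cos.div hd.sin (hsin x hx').ne').mul ((hvd x hx).pow 2))
      exact this.hasDerivWithinAt)
    ((intervalIntegrable_iff_integrableOn_Icc_of_le has).1 i3)
    (fun x hx => by
      have hS := hsin x (Ioo_subset_Icc_self hx)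
      have hcs := Real.sin_sq_add_cos_sq (φ x)
      unfold prf
      set S := Real.sin (φ x)
      set c := Real.cos (φ x)
      have e1 : (-S * (c^2 + (μ - W x) * S^2)) * S - c * (c * (c^2 + (μ - W x) * S^2))
          = -(c^2 + (μ - W x) * S^2) := by
        have : (-S * (c^2 + (μ - W x) * S^2)) * S - c * (c * (c^2 + (μ - W x) * S^2))
          = -((c^2 + (μ - W x) * S^2) * (S^2+c^2)) := by ring
        rw [this, hcs, mul_one]
      rw [e1]
      have e2 : -(c^2 + (μ - W x) * S^2) / S^2 = -((c/S)^2 + (μ - W x)) := by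
        field_simp
      rw [e2]
      nlinarith [sq_nonneg (v' x - c / S * v x)])
  simp only [hva, hvs] at hfin
  rw [intervalIntegral.integral_sub (hvi.add i1) (i2.const_mul μ),
    intervalIntegral.integral_const_mul, hn] at hfin
  have hcongr : ∫ x in a..s, ((v' x) ^ 2 + V x * (v x) ^ 2)
      = ∫ x in a..s, ((v' x) ^ 2 + W x * (v x) ^ 2) := by
    apply intervalIntegral.integral_congr
    intro x hx
    rw [huI] at hx
    simp only
    rw [hVW x ⟨hx.1, hx.2.trans hsb.2⟩]
  rw [hcongr]
  simp at hfin
  linarith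

lemma hardy (hW : Continuous W) (hC : ∀ x, |W x| ≤ C) (hab : a < b)
    (hs : IsSol W a b μ 0 φ) {s : ℝ} (hsb : s ∈ Ioc a b)
    (hlt : φ s < Real.pi) {V : ℝ → ℝ} (hVW : ∀ x ∈ Icc a b, W x = V x)
    {v v' : ℝ → ℝ} (hv : MemH10 a s v v') (hn : (∫ x in a..s, (v x) ^ 2) = 1) :
    μ ≤ ∫ x in a..s, ((v' x) ^ 2 + V x * (v x) ^ 2) := by
  obtain ⟨M, hM, hg⟩ := sol_gronwall (W := W) hC μ hsb
  set δ := (Real.pi - φ s) / (M + 1) / 2 with hδ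
  have hδ0 : 0 < δ := by
    have : 0 < Real.pi - φ s := by linarith
    positivity
  have hMδ : M * δ < Real.pi - φ s := by
    have h1 : (M + 1) * δ = (Real.pi - φ s) / 2 := by
      rw [hδ]; field_simp
    nlinarith
  obtain ⟨ψ, c1, c2, c3⟩ := prf_sol hW hC a b hab μ δ
  have hψ : IsSol W a b μ δ ψ := ⟨c1, c2, c3⟩
  have h1 := hg φ ψ 0 μ δ hs hψ
  simp [abs_of_pos hδ0] at h1
  have hψs : ψ s < Real.pi := by
    have := neg_abs_le (φ s - ψ s)
    linarith
  refine hardy_core hW hψ hsb (fun x hx => ⟨?_, ?_⟩) hVW hv hn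
  · exact sol_gt hC hψ le_rfl hsb.2 (fun y _ => by rw [prf_zero]; norm_num) (by rw [c2]; exact hδ0)
      x hx
  · by_contra hge
    push Not at hge
    have := sol_ge hC hψ hx.1 hsb.2 (fun y _ => by rw [prf_pi]; norm_num) hge s ⟨hx.2, le_rfl⟩
    linarith

/-- test functions can be normalised -/
lemma normalise {V : ℝ → ℝ} {s : ℝ} {v v' : ℝ → ℝ} (hv : MemH10 a s v v')
    (hn : 0 < (∫ x in a..s, (v x) ^ 2)) :
    (∫ x in a..s, ((v' x) ^ 2 + V x * (v x) ^ 2)) / (∫ x in a..s, (v x) ^ 2) ∈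
    { E : ℝ | ∃ u u' : ℝ → ℝ, MemH10 a s u u' ∧
    (∫ x in a..s, (u x) ^ 2) = 1 ∧
    E = ∫ x in a..s, ((u' x) ^ 2 + V x * (u x) ^ 2) } := by
  set N := (∫ x in a..s, (v x) ^ 2) with hN
  obtain ⟨hvc, hvd, hvi, hva, hvs⟩ := hv
  have hsq : ((Real.sqrt N)⁻¹)^2 = N⁻¹ := by rw [inv_pow, Real.sq_sqrt hn.le]
  refine ⟨fun x => (Real.sqrt N)⁻¹ * v x, fun x => (Real.sqrt N)⁻¹ * v' x,
    ⟨continuousOn_const.mul hvc, fun x hx => (hvd x hx).const_mul _, ?_, by simp [hva],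
      by simp [hvs]⟩, ?_, ?_⟩
  · simp only [mul_pow]
    exact hvi.const_mul _
  · simp only [mul_pow]
    rw [intervalIntegral.integral_const_mul, ← hN, hsq, inv_mul_cancel₀ hn.ne']
  · rw [div_eq_inv_mul, ← hsq, ← intervalIntegral.integral_const_mul]
    congr 1
    ext x
    ring

lemma nonempty_test (V : ℝ → ℝ) {s : ℝ} (h : a < s) : ∃ v v' : ℝ → ℝ, MemH10 a s v v' ∧
    (∫ x in a..s, (v x) ^ 2) = 1 := by
  have hm : MemH10 a s (fun x => (x - a) * (s - x)) (fun x => 1 * (s - x) + (x - a) * (-1)) := by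
    refine ⟨by fun_prop, fun x _ => ?_, ?_, by simp, by simp⟩
    · exact ((hasDerivAt_id x).sub_const a).mul ((hasDerivAt_id x).const_sub s)
    · apply Continuous.intervalIntegrable; fun_prop
  obtain ⟨u, u', h1, h2, -⟩ := normalise (V := V) hm (by
    apply intervalIntegral.integral_pos h (by fun_prop) (fun x _ => sq_nonneg _)
    refine ⟨(a+s)/2, ⟨by linarith, by linarith⟩, ?_⟩
    have : 0 < ((a+s)/2 - a) * (s - (a+s)/2) := mul_pos (by linarith) (by linarith)
    positivity)
  exact ⟨u, u', h1, h2⟩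


lemma upper_mem (hW : Continuous W) (hs : IsSol W a b μ 0 φ) {s : ℝ} (hsb : s ∈ Ioc a b)
    (hpi : φ s = Real.pi) {V : ℝ → ℝ} (hVW : ∀ x ∈ Icc a b, W x = V x) :
    μ ∈ { E : ℝ | ∃ u u' : ℝ → ℝ, MemH10 a s u u' ∧
    (∫ x in a..s, (u x) ^ 2) = 1 ∧
    E = ∫ x in a..s, ((u' x) ^ 2 + V x * (u x) ^ 2) } := by
  have hφc := hs.cont
  set q : ℝ → ℝ := fun x => (1 + W x - μ) * (Real.sin (φ x) * Real.cos (φ x)) with hq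
  have hqc : Continuous q := by fun_prop
  set r : ℝ → ℝ := fun x => Real.exp (∫ y in a..x, q y) with hr
  have hrd : ∀ x, HasDerivAt r (r x * q x) x := fun x =>
    (intervalIntegral.integral_hasDerivAt_right (hqc.intervalIntegrable _ _)
      (hqc.stronglyMeasurableAtFilter _ _) hqc.continuousAt).exp
  have hrc : Continuous r := continuous_iff_continuousAt.2 fun x => (hrd x).continuousAt
  have hrp : ∀ x, 0 < r x := fun x => Real.exp_pos _
  have hsd : ∀ x ∈ Icc a b, HasDerivAt (fun x => r x * Real.sin (φ x)) (r x * Real.cos (φ x)) x := by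
    intro x hx
    have := (hrd x).mul (hs.der x hx).sin
    convert! this using 1
    simp only [hq, prf]
    have hcs := Real.sin_sq_add_cos_sq (φ x)
    linear_combination (-(r x * Real.cos (φ x))) * hcs
  have hcd : ∀ x ∈ Icc a b, HasDerivAt (fun x => r x * Real.cos (φ x))
      ((W x - μ) * (r x * Real.sin (φ x))) x := by
    intro x hx
    have := (hrd x).mul (hs.der x hx).cos
    convert! this using 1
    simp only [hq, prf]
    have hcs := Real.sin_sq_add_cos_sq (φ x)
    linear_combination (-((W x - μ) * r x * Real.sin (φ x))) * hcs
  have hm : MemH10 a s (fun x => r x * Real.sin (φ x)) (fun x => r x * Real.cos (φ x)) := by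
    refine ⟨by fun_prop, fun x hx => hsd x ⟨hx.1.le, hx.2.le.trans hsb.2⟩, ?_, ?_, ?_⟩
    · apply Continuous.intervalIntegrable; fun_prop
    · simp [hs.start]
    · simp [hpi]
  have hpos : 0 < ∫ x in a..s, (r x * Real.sin (φ x))^2 := by
    apply intervalIntegral.integral_pos hsb.1 (by fun_prop) (fun x _ => sq_nonneg _)
    have : Real.pi / 2 ∈ φ '' Icc a s := by
      apply intermediate_value_Icc hsb.1.le hφc.continuousOn
      rw [hs.start, hpi]
      constructor <;> linarith [Real.pi_pos]
    obtain ⟨c, hc, hc2⟩ := this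
    refine ⟨c, hc, ?_⟩
    rw [hc2, Real.sin_pi_div_two]
    have := hrp c
    positivity
  have hmem := normalise (V := V) hm hpos
  convert! hmem using 1
  rw [eq_div_iff hpos.ne']
  have hft := intervalIntegral.integral_eq_sub_of_hasDerivAt_of_le (a := a) (b := s)
    (f := fun x => (r x * Real.sin (φ x)) * (r x * Real.cos (φ x)))
    (f' := fun x => (r x * Real.cos (φ x)) * (r x * Real.cos (φ x)) +
      (r x * Real.sin (φ x)) * ((W x - μ) * (r x * Real.sin (φ x)))) hsb.1.le (by fun_prop)
    (fun x hx => (hsd x ⟨hx.1.le, hx.2.le.trans hsb.2⟩).mul (hcd x ⟨hx.1.le, hx.2.le.trans hsb.2⟩))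
    (by apply Continuous.intervalIntegrable; fun_prop)
  simp only [hs.start, hpi, Real.sin_zero, Real.sin_pi, mul_zero, zero_mul, sub_zero] at hft
  have hcongr : ∫ x in a..s, ((r x * Real.cos (φ x)) ^ 2 + V x * (r x * Real.sin (φ x)) ^ 2)
      = ∫ x in a..s, (((r x * Real.cos (φ x)) * (r x * Real.cos (φ x)) +
      (r x * Real.sin (φ x)) * ((W x - μ) * (r x * Real.sin (φ x))))
        + μ * (r x * Real.sin (φ x)) ^ 2) := by
    apply intervalIntegral.integral_congr
    intro x hx
    rw [uIcc_of_le hsb.1.le] at hx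
    simp only
    rw [← hVW x ⟨hx.1, hx.2.trans hsb.2⟩]
    ring
  rw [hcongr, intervalIntegral.integral_add, hft, intervalIntegral.integral_const_mul, zero_add]
  · apply Continuous.intervalIntegrable; fun_prop
  · apply Continuous.intervalIntegrable; fun_prop

end

section
variable {W : ℝ → ℝ} {C a b : ℝ}

lemma sol_continuous (hC : ∀ x, |W x| ≤ C) {Φ : ℝ → ℝ → ℝ} (hΦ : ∀ μ, IsSol W a b μ 0 (Φ μ))
    {s : ℝ} (hs : s ∈ Ioc a b) : Continuous (fun μ => Φ μ s) := by
  rw [continuous_iff_continuousAt]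
  intro μ
  obtain ⟨M, hM, hg⟩ := sol_gronwall (W := W) hC μ hs
  unfold ContinuousAt
  rw [tendsto_iff_dist_tendsto_zero]
  refine squeeze_zero (g := fun μ' => M * |μ - μ'|) (fun _ => dist_nonneg) (fun μ' => ?_) ?_
  · have := hg (Φ μ) (Φ μ') 0 μ' 0 (hΦ μ) (hΦ μ')
    rw [dist_comm, Real.dist_eq]
    simpa using this
  · have : Continuous (fun μ' => M * |μ - μ'|) := by fun_prop
    have h := this.tendsto μ
    simpa using h

lemma key (hW : Continuous W) (hC : ∀ x, |W x| ≤ C) (hab : a < b) {Φ : ℝ → ℝ → ℝ}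
    (hΦ : ∀ μ, IsSol W a b μ 0 (Φ μ)) {s : ℝ} (hs : s ∈ Ioc a b)
    {V : ℝ → ℝ} (hVW : ∀ x ∈ Icc a b, W x = V x) :
    ∃ μ, Φ μ s = Real.pi ∧ groundStateEnergy a V s = μ ∧ ∀ μ', Real.pi ≤ Φ μ' s → μ ≤ μ' := by
  have hcont := sol_continuous hC hΦ hs
  set S : Set ℝ := {μ | Real.pi ≤ Φ μ s} with hS
  obtain ⟨v, v', hv, hn⟩ := nonempty_test V hs.1
  have hne : S.Nonempty := by
    by_contra hem
    rw [Set.not_nonempty_iff_eq_empty] at hem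
    set E := ∫ x in a..s, ((v' x) ^ 2 + V x * (v x) ^ 2)
    have hlt : Φ (E+1) s < Real.pi := by
      by_contra h
      push Not at h
      have : (E + 1) ∈ S := h
      rw [hem] at this
      exact this
    have := hardy hW hC hab (hΦ (E+1)) hs hlt hVW hv hn
    linarith
  have hbdd : BddBelow S := by
    refine ⟨-C, fun μ hμ => ?_⟩
    by_contra h
    push Not at h
    have := sol_le hC (hΦ μ) (c := Real.pi / 2) le_rfl hs.2 (fun x _ => by
      rw [prf_half]
      have := neg_abs_le (W x)
      have := hC x
      linarith) (by rw [(hΦ μ).start]; positivity) s ⟨hs.1.le, le_rfl⟩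
    have h2 : Real.pi ≤ Φ μ s := hμ
    linarith [Real.pi_pos]
  have hcl : IsClosed S := isClosed_le continuous_const hcont
  have hmem : sInf S ∈ S := hcl.csInf_mem hne hbdd
  have hlow : ∀ μ' < sInf S, Φ μ' s < Real.pi := by
    intro μ' h
    by_contra h2
    push Not at h2
    exact absurd (csInf_le hbdd (show μ' ∈ S from h2)) (not_le.2 h)
  have hpi : Φ (sInf S) s = Real.pi := by
    refine le_antisymm ?_ hmem
    refine le_of_tendsto (hcont.continuousAt.mono_left (nhdsWithin_le_nhds (s := Iio (sInf S)))) ?_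
    filter_upwards [self_mem_nhdsWithin] with μ' h
    exact (hlow μ' h).le
  have hlb : ∀ E ∈ { E : ℝ | ∃ u u' : ℝ → ℝ, MemH10 a s u u' ∧
    (∫ x in a..s, (u x) ^ 2) = 1 ∧
    E = ∫ x in a..s, ((u' x) ^ 2 + V x * (u x) ^ 2) }, sInf S ≤ E := by
    rintro E ⟨u, u', hu, hun, rfl⟩
    refine le_of_forall_lt fun μ' h => ?_
    obtain ⟨ν, h1, h2⟩ := exists_between h
    exact h1.trans_le (hardy hW hC hab (hΦ ν) hs (hlow ν h2) hVW hu hun)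
  have hup := upper_mem hW (hΦ (sInf S)) hs hpi hVW
  refine ⟨sInf S, hpi, ?_, fun μ' h => csInf_le hbdd h⟩
  exact (IsLeast.csInf_eq ⟨hup, hlb⟩)

lemma sol_pos (hC : ∀ x, |W x| ≤ C) (hconv : ConvexOn ℝ (Icc a b) W) {μ s : ℝ} {φ : ℝ → ℝ}
    (hφ : IsSol W a b μ 0 φ) (hs : s ∈ Ioc a b) (hpi : φ s = Real.pi) :
    ∀ x ∈ Icc a s, (0 ≤ φ x ∧ φ x ≤ Real.pi) ∧ 0 < prf W μ x (φ x) := by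
  intro x hx
  have h0 : 0 ≤ φ x := sol_ge hC hφ le_rfl hs.2 (fun y _ => by rw [prf_zero]; norm_num)
    (by rw [hφ.start]) x hx
  have h1 : φ x ≤ Real.pi := by
    by_contra h
    push Not at h
    have := sol_gt hC hφ hx.1 hs.2 (fun y _ => by rw [prf_pi]; norm_num) h s ⟨hx.2, le_rfl⟩
    linarith
  refine ⟨⟨h0, h1⟩, ?_⟩
  by_contra hneg
  push Not at hneg
  have h0' : 0 < φ x := by
    refine lt_of_le_of_ne h0 fun h => ?_
    rw [← h, prf_zero] at hneg; linarith
  have h1' : φ x < Real.pi := by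
    refine lt_of_le_of_ne h1 fun h => ?_
    rw [h, prf_pi] at hneg; linarith
  have hmono : ∀ y, W x ≤ W y → prf W μ y (φ x) ≤ 0 := by
    intro y hy
    refine le_trans ?_ hneg
    unfold prf
    have : (μ - W y) * Real.sin (φ x)^2 ≤ (μ - W x) * Real.sin (φ x)^2 := by gcongr
    linarith
  by_cases hcase : ∀ y ∈ Icc a x, W x ≤ W y
  · have := sol_lt hC hφ le_rfl (hx.2.trans hs.2) (fun y hy => hmono y (hcase y hy))
      (by rw [hφ.start]; exact h0') x ⟨hx.1, le_rfl⟩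
    linarith
  · push Not at hcase
    obtain ⟨y, hy, hWy⟩ := hcase
    have := sol_le hC hφ hx.1 hs.2 (fun z hz => hmono z (by
      by_contra hlt
      push Not at hlt
      have := hconv.le_max_of_mem_Icc (x := y) (y := z) (z := x)
        ⟨hy.1, hy.2.trans (hx.2.trans hs.2)⟩ ⟨hx.1.trans hz.1, hz.2.trans hs.2⟩ ⟨hy.2, hz.1⟩
      exact absurd this (not_le.2 (max_lt hWy hlt)))) le_rfl s ⟨hx.2, le_rfl⟩
    linarith

lemma sol_inv (hC : ∀ x, |W x| ≤ C) (hconv : ConvexOn ℝ (Icc a b) W) {μ s : ℝ} {φ : ℝ → ℝ}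
    (hφ : IsSol W a b μ 0 φ) (hs : s ∈ Ioc a b) (hpi : φ s = Real.pi) :
    ∃ X : ℝ → ℝ, Continuous X ∧ X 0 = a ∧ X Real.pi = s ∧
      (∀ α ∈ Icc 0 Real.pi, X α ∈ Icc a s ∧ φ (X α) = α) ∧
      ∀ α ∈ Ioo 0 Real.pi, HasDerivAt X (prf W μ (X α) α)⁻¹ α := by
  have hp := sol_pos hC hconv hφ hs hpi
  have has := hs.1
  have hsm : StrictMonoOn φ (Icc a s) := by
    apply strictMonoOn_of_deriv_pos (convex_Icc a s) hφ.cont.continuousOn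
    intro x hx
    rw [interior_Icc] at hx
    have hx' := Ioo_subset_Icc_self hx
    rw [(hφ.der x ⟨hx'.1, hx'.2.trans hs.2⟩).deriv]
    exact (hp x hx').2
  set g : ℝ → ℝ := fun x => max a (min s x) with hg
  have hgc : Continuous g := by fun_prop
  have hgm : ∀ x, g x ∈ Icc a s := fun x => ⟨le_max_left _ _, max_le has.le (min_le_left _ _)⟩
  have hgid : ∀ x ∈ Icc a s, g x = x := fun x hx => by
    simp only [hg]; rw [min_eq_right hx.2, max_eq_right hx.1]
  have hgmono : Monotone g := fun x y h => max_le_max le_rfl (min_le_min le_rfl h)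
  have hkmono : ∀ x y, x ≤ y → x - g x ≤ y - g y := by
    intro x y h
    simp only [hg]
    grind
  set F : ℝ → ℝ := fun x => φ (g x) + (x - g x) with hF
  have hFc : Continuous F := (hφ.cont.comp hgc).add (continuous_id.sub hgc)
  have hFm : StrictMono F := by
    intro x y h
    simp only [hF]
    rcases (hgmono h.le).eq_or_lt with h1 | h1
    · rw [h1]; linarith
    · have := hsm (hgm x) (hgm y) h1
      have := hkmono x y h.le
      linarith
  have hFs : Function.Surjective F := by
    apply hFc.surjective
    · refine Filter.tendsto_atTop_mono (f := fun x => x + (-s)) (fun x => ?_)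
        (Filter.tendsto_atTop_add_const_right _ _ Filter.tendsto_id)
      have h1 := (hp _ (hgm x)).1.1
      have h2 := (hgm x).2
      simp only [hF]; linarith
    · refine Filter.tendsto_atBot_mono (f := fun x => x + (Real.pi - a)) (fun x => ?_)
        (Filter.tendsto_atBot_add_const_right _ _ Filter.tendsto_id)
      have h1 := (hp _ (hgm x)).1.2
      have h2 := (hgm x).1
      simp only [hF]; linarith
  set e := StrictMono.orderIsoOfSurjective F hFm hFs with he
  have heF : ∀ x, e x = F x := fun x => rfl
  have hFe : ∀ α, F (e.symm α) = α := fun α => e.apply_symm_apply α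
  have hF0 : F a = 0 := by
    simp only [hF]; rw [hgid a ⟨le_rfl, has.le⟩, hφ.start]; ring
  have hF1 : F s = Real.pi := by
    simp only [hF]; rw [hgid s ⟨has.le, le_rfl⟩, hpi]; ring
  have hX0 : e.symm 0 = a := by rw [← hF0, ← heF]; simp
  have hX1 : e.symm Real.pi = s := by rw [← hF1, ← heF]; simp
  have hmain : ∀ α ∈ Icc 0 Real.pi, e.symm α ∈ Icc a s ∧ φ (e.symm α) = α := by
    intro α hα
    have hm : e.symm α ∈ Icc a s := by
      rw [← hX0, ← hX1]
      exact ⟨e.symm.monotone hα.1, e.symm.monotone hα.2⟩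
    refine ⟨hm, ?_⟩
    have := hFe α
    simp only [hF] at this
    rw [hgid _ hm] at this
    linarith
  refine ⟨e.symm, e.symm.continuous, hX0, hX1, hmain, ?_⟩
  intro α hα
  obtain ⟨h1, h2⟩ := hmain α (Ioo_subset_Icc_self hα)
  have hd := hφ.der _ ⟨h1.1, h1.2.trans hs.2⟩
  have hpp := (hp _ h1).2
  rw [h2] at hd hpp
  refine HasDerivAt.of_local_left_inverse e.symm.continuous.continuousAt hd hpp.ne' ?_
  filter_upwards [Ioo_mem_nhds hα.1 hα.2] with y hy
  exact (hmain y (Ioo_subset_Icc_self hy)).2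

lemma harm {p q θ : ℝ} (hp : 0 < p) (hq : 0 < q) (h0 : 0 ≤ θ) (h1 : θ ≤ 1) :
    1 ≤ (θ * p + (1 - θ) * q) * (θ * p⁻¹ + (1 - θ) * q⁻¹) := by
  have h : (θ * p + (1 - θ) * q) * (θ * p⁻¹ + (1 - θ) * q⁻¹)
      = 1 + θ * (1 - θ) * ((p - q)^2 / (p * q)) := by
    field_simp
    ring
  rw [h]
  have : 0 ≤ 1 - θ := by linarith
  have : 0 ≤ θ * (1 - θ) * ((p - q)^2 / (p * q)) := by positivity
  linarith

lemma inv_bdd (hW : Continuous W) {μ : ℝ} {X : ℝ → ℝ} (hX : Continuous X)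
    (hpos : ∀ α ∈ Icc 0 Real.pi, 0 < prf W μ (X α) α) :
    ∃ B, ∀ α ∈ Icc 0 Real.pi, (prf W μ (X α) α)⁻¹ ≤ B := by
  have hc : Continuous fun α => prf W μ (X α) α := by unfold prf; fun_prop
  obtain ⟨B, hB⟩ := isCompact_Icc.exists_bound_of_continuousOn
    (hc.continuousOn.inv₀ (fun α hα => (hpos α hα).ne'))
  exact ⟨B, fun α hα => (le_abs_self _).trans (hB α hα)⟩

lemma combine (hW : Continuous W) (hC : ∀ x, |W x| ≤ C) (hconv : ConvexOn ℝ (Icc a b) W)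
    {Φ : ℝ → ℝ → ℝ} (hΦ : ∀ μ, IsSol W a b μ 0 (Φ μ)) {s t μ ν θ : ℝ} (hs : s ∈ Ioc a b)
    (ht : t ∈ Ioc a b) (hμ : Φ μ s = Real.pi) (hν : Φ ν t = Real.pi) (hθ : θ ∈ Icc (0:ℝ) 1) :
    Real.pi ≤ Φ (θ * μ + (1 - θ) * ν) (θ * s + (1 - θ) * t) := by
  obtain ⟨X, hXc, hX0, hX1, hXm, hXd⟩ := sol_inv hC hconv (hΦ μ) hs hμ
  obtain ⟨Y, hYc, hY0, hY1, hYm, hYd⟩ := sol_inv hC hconv (hΦ ν) ht hν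
  have hXp : ∀ α ∈ Icc 0 Real.pi, 0 < prf W μ (X α) α := fun α hα => by
    have h := (sol_pos hC hconv (hΦ μ) hs hμ _ (hXm α hα).1).2
    rwa [(hXm α hα).2] at h
  have hYp : ∀ α ∈ Icc 0 Real.pi, 0 < prf W ν (Y α) α := fun α hα => by
    have h := (sol_pos hC hconv (hΦ ν) ht hν _ (hYm α hα).1).2
    rwa [(hYm α hα).2] at h
  obtain ⟨B0, hB0⟩ := inv_bdd hW hXc hXp
  obtain ⟨B1, hB1⟩ := inv_bdd hW hYc hYp
  have hpi := Real.pi_pos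
  have h0θ : 0 ≤ θ := hθ.1
  have h1θ : 0 ≤ 1 - θ := by linarith [hθ.2]
  have hB0n : 0 ≤ B0 := (inv_pos.2 (hXp 0 ⟨le_rfl, hpi.le⟩)).le.trans (hB0 0 ⟨le_rfl, hpi.le⟩)
  have hB1n : 0 ≤ B1 := (inv_pos.2 (hYp 0 ⟨le_rfl, hpi.le⟩)).le.trans (hB1 0 ⟨le_rfl, hpi.le⟩)
  set L := θ * μ + (1 - θ) * ν with hL
  set Z : ℝ → ℝ := fun α => θ * X α + (1 - θ) * Y α with hZ
  set Z' : ℝ → ℝ := fun α => θ * (prf W μ (X α) α)⁻¹ + (1 - θ) * (prf W ν (Y α) α)⁻¹ with hZ'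
  have hψ := hΦ L
  set K := 2 * (1 + |L| + C) with hK
  have hK0 : 0 ≤ K := prf_const_nonneg hC L
  have hXab : ∀ α ∈ Icc 0 Real.pi, X α ∈ Icc a b := fun α hα =>
    ⟨(hXm α hα).1.1, (hXm α hα).1.2.trans hs.2⟩
  have hYab : ∀ α ∈ Icc 0 Real.pi, Y α ∈ Icc a b := fun α hα =>
    ⟨(hYm α hα).1.1, (hYm α hα).1.2.trans ht.2⟩
  have hZab : ∀ α ∈ Icc 0 Real.pi, Z α ∈ Icc a b := fun α hα =>
    (convex_Icc a b) (hXab α hα) (hYab α hα) hθ.1 h1θ (by ring)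
  have hfin := cmp_le (d := fun α => Φ L (Z α) - α)
    (d' := fun α => prf W L (Z α) (Φ L (Z α)) * Z' α - 1) (x0 := 0) (x1 := Real.pi)
    (K := K * (B0 + B1)) (by positivity)
    ((hψ.cont.comp (by fun_prop)).sub continuous_id).continuousOn
    (fun α hα => by
      have hZd : HasDerivAt Z (Z' α) α :=
        ((hXd α hα).const_mul θ).add ((hYd α hα).const_mul (1 - θ))
      exact ((hψ.der (Z α) (hZab α (Ioo_subset_Icc_self hα))).comp α hZd).sub (hasDerivAt_id α))
    (fun α hα => by
      have hα' := Ioo_subset_Icc_self hα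
      have p0 := hXp α hα'
      have p1 := hYp α hα'
      have hh := harm p0 p1 hθ.1 hθ.2
      have hlip := prf_lip hC L (Z α) (Φ L (Z α)) α
      have hlip2 := neg_abs_le (prf W L (Z α) (Φ L (Z α)) - prf W L (Z α) α)
      have hcv : W (Z α) ≤ θ * W (X α) + (1 - θ) * W (Y α) :=
        hconv.2 (hXab α hα') (hYab α hα') hθ.1 h1θ (by ring)
      have hFF : θ * prf W μ (X α) α + (1 - θ) * prf W ν (Y α) α ≤ prf W L (Z α) α := by
        unfold prf
        have : θ * (Real.cos α ^ 2 + (μ - W (X α)) * Real.sin α ^ 2) +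
          (1 - θ) * (Real.cos α ^ 2 + (ν - W (Y α)) * Real.sin α ^ 2)
          = Real.cos α ^ 2 + (L - (θ * W (X α) + (1 - θ) * W (Y α))) * Real.sin α ^ 2 := by
          rw [hL]; ring
        rw [this]
        gcongr
      have i0 := inv_pos.2 p0
      have i1 := inv_pos.2 p1
      have hZ0 : 0 ≤ Z' α := by simp only [hZ']; positivity
      have hZB : Z' α ≤ B0 + B1 := by
        have e0 := hB0 α hα'
        have e1 := hB1 α hα'
        have : θ * (prf W μ (X α) α)⁻¹ ≤ 1 * B0 := by gcongr; exact hθ.2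
        have : (1 - θ) * (prf W ν (Y α) α)⁻¹ ≤ 1 * B1 := by gcongr; linarith [hθ.1]
        simp only [hZ']
        linarith
      have hD : 0 ≤ K * |Φ L (Z α) - α| := by positivity
      have s1 : (θ * prf W μ (X α) α + (1 - θ) * prf W ν (Y α) α - K * |Φ L (Z α) - α|) * Z' α
          ≤ prf W L (Z α) (Φ L (Z α)) * Z' α := by
        apply mul_le_mul_of_nonneg_right _ hZ0
        linarith
      have s2 : K * |Φ L (Z α) - α| * Z' α ≤ K * |Φ L (Z α) - α| * (B0 + B1) :=
        mul_le_mul_of_nonneg_left hZB hD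
      have s3 : 1 ≤ (θ * prf W μ (X α) α + (1 - θ) * prf W ν (Y α) α) * Z' α := hh
      linarith)
    (by
      have : Z 0 = a := by simp only [hZ, hX0, hY0]; ring
      simp only [this, hψ.start]; simp) Real.pi ⟨hpi.le, le_rfl⟩
  simp only [hZ, hX1, hY1] at hfin
  linarith

end

/-- if `V` is convex on `[a,b]` then `λ` is convex on `(a,b]`. -/
theorem ground_state_convex (a b : ℝ) (hab : a < b)
    (V : ℝ → ℝ) (hV : ContinuousOn V (Set.Icc a b))
    (hconv : ConvexOn ℝ (Set.Icc a b) V) :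
    ∀ s ∈ Set.Ioc a b, ∀ t ∈ Set.Ioc a b, ∀ θ ∈ Set.Icc (0 : ℝ) 1,
      groundStateEnergy a V (θ * s + (1 - θ) * t) ≤
        θ * groundStateEnergy a V s + (1 - θ) * groundStateEnergy a V t := by
  intro s hs t ht θ hθ
  set W : ℝ → ℝ := IccExtend hab.le ((Icc a b).domRestrict V) with hWdef
  have hW : Continuous W := (continuousOn_iff_continuous_domRestrict.mp hV).Icc_extend'
  have hVW : ∀ x ∈ Icc a b, W x = V x := fun x hx => by
    rw [hWdef, IccExtend_of_mem hab.le _ hx]; rfl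
  obtain ⟨C, hC'⟩ := isCompact_Icc.exists_bound_of_continuousOn hV
  have hC : ∀ x, |W x| ≤ C := fun x => hC' _ (projIcc a b hab.le x).2
  have hWconv : ConvexOn ℝ (Icc a b) W := hconv.congr fun x hx => (hVW x hx).symm
  have hex : ∀ μ, ∃ φ, IsSol W a b μ 0 φ := fun μ => by
    obtain ⟨φ, h1, h2, h3⟩ := prf_sol hW hC a b hab μ 0
    exact ⟨φ, h1, h2, h3⟩
  choose Φ hΦ using hex
  have hz : θ * s + (1 - θ) * t ∈ Ioc a b :=
    (convex_Ioc a b) hs ht hθ.1 (by linarith [hθ.2]) (by ring)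
  obtain ⟨μ, h1, h2, -⟩ := key hW hC hab hΦ hs hVW
  obtain ⟨ν, h3, h4, -⟩ := key hW hC hab hΦ ht hVW
  obtain ⟨κ, -, h5, h6⟩ := key hW hC hab hΦ hz hVW
  rw [h2, h4, h5]
  exact h6 _ (combine hW hC hWconv hΦ hs ht h1 h3 hθ)
end

section
/- If V is convex on [a,b] and V is not affine on [a,b] (i.e. there is no pair of constants c, d with V(x) = c·x + d for all x ∈ [a,b]), then the map t ↦ λ(t) is strictly convex on (a,b]: for all s ≠ t in (a,b] and θ ∈ (0,1), λ(θ s + (1−θ) t) < θ λ(s) + (1−θ) λ(t). -/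
open MeasureTheory Set

section GroundStateHelpers

open Filter Topology

lemma gs_hasDerivAt_minsq (y : ℝ) :
    HasDerivAt (fun y : ℝ => (min y 0) ^ 2) (2 * min y 0) y := by
  rcases lt_trichotomy y 0 with h | h | h
  · have h1 : HasDerivAt (fun y : ℝ => y ^ 2) (2 * min y 0) y := by
      rw [min_eq_left h.le]
      simpa using hasDerivAt_pow 2 y
    refine h1.congr_of_eventuallyEq ?_
    filter_upwards [Iio_mem_nhds h] with z hz
    rw [min_eq_left (le_of_lt hz)]
  · subst h
    rw [hasDerivAt_iff_isLittleO_nhds_zero]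
    have h2 : (fun h : ℝ => h ^ 2) =o[𝓝 0] fun h : ℝ => h := by
      simpa using (Asymptotics.isLittleO_pow_id (𝕜 := ℝ) (n := 2) (by norm_num))
    refine Asymptotics.IsBigO.trans_isLittleO ?_ h2
    refine Asymptotics.IsBigO.of_bound 1 (Eventually.of_forall fun h => ?_)
    simp only [zero_add, min_self, mul_zero, smul_zero, sub_zero, Real.norm_eq_abs, one_mul]
    rw [zero_pow two_ne_zero, sub_zero, abs_pow, abs_pow]
    refine pow_le_pow_left₀ (abs_nonneg _) ?_ 2
    rcases le_total h 0 with h0 | h0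
    · rw [min_eq_left h0]
    · rw [min_eq_right h0]; simp
  · have h1 : HasDerivAt (fun _ : ℝ => (0 : ℝ)) (2 * min y 0) y := by
      rw [min_eq_right h.le]
      simpa using hasDerivAt_const y (0 : ℝ)
    refine h1.congr_of_eventuallyEq ?_
    filter_upwards [Ioi_mem_nhds h] with z hz
    rw [min_eq_right (le_of_lt hz)]; simp

/-- One-sided comparison principle. -/
lemma gs_compare {p q K : ℝ} {Q Q' : ℝ → ℝ}
    (hc : ContinuousOn Q (Icc p q)) (hd : ∀ x ∈ Ioo p q, HasDerivAt Q (Q' x) x)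
    (hQ : ∀ x ∈ Ioo p q, -K * |Q x| ≤ Q' x) (hp : 0 ≤ Q p) :
    ∀ x ∈ Icc p q, 0 ≤ Q x := by
  have hanti : AntitoneOn (fun x => Real.exp (-(2 * K) * x) * (min (Q x) 0) ^ 2) (Icc p q) := by
    have hder : ∀ x ∈ Ioo p q, HasDerivAt (fun x => Real.exp (-(2 * K) * x) * (min (Q x) 0) ^ 2)
        (Real.exp (-(2 * K) * x) * (-(2 * K)) * (min (Q x) 0) ^ 2
          + Real.exp (-(2 * K) * x) * (2 * min (Q x) 0 * Q' x)) x := by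
      intro x hx
      have h1 : HasDerivAt (fun x => Real.exp (-(2 * K) * x))
          (Real.exp (-(2 * K) * x) * (-(2 * K))) x := by
        simpa using ((hasDerivAt_id x).const_mul (-(2 * K))).exp
      have h2 := (gs_hasDerivAt_minsq (Q x)).comp x (hd x hx)
      exact h1.mul h2
    refine antitoneOn_of_deriv_nonpos (convex_Icc p q) ?_ ?_ ?_
    · refine ContinuousOn.mul (by fun_prop) ?_
      fun_prop
    · rw [interior_Icc]
      exact fun x hx => (hder x hx).differentiableAt.differentiableWithinAt
    · rw [interior_Icc]
      intro x hx
      rw [(hder x hx).deriv]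
      have he := Real.exp_pos (-(2 * K) * x)
      have hb := hQ x hx
      have : -(2 * K) * (min (Q x) 0) ^ 2 + 2 * min (Q x) 0 * Q' x ≤ 0 := by
        rcases le_total (Q x) 0 with h0 | h0
        · rw [min_eq_left h0]
          rw [abs_of_nonpos h0] at hb
          nlinarith
        · rw [min_eq_right h0]; simp
      nlinarith
  intro x hx
  have h1 := hanti (left_mem_Icc.2 (hx.1.trans hx.2)) hx hx.1
  simp only [min_eq_right hp] at h1
  have he := Real.exp_pos (-(2 * K) * x)
  by_contra hneg
  push Not at hneg
  rw [min_eq_left hneg.le] at h1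
  have : 0 < Real.exp (-(2 * K) * x) * Q x ^ 2 := by
    have := sq_pos_of_neg hneg
    positivity
  rw [zero_pow two_ne_zero, mul_zero] at h1
  linarith

lemma gs_compare_eq {p q K : ℝ} {Q Q' : ℝ → ℝ}
    (hc : ContinuousOn Q (Icc p q)) (hd : ∀ x ∈ Ioo p q, HasDerivAt Q (Q' x) x)
    (hQ : ∀ x ∈ Ioo p q, -K * |Q x| ≤ Q' x) (hp : 0 ≤ Q p) (hq : Q q = 0) :
    ∀ x ∈ Icc p q, Q x = 0 := by
  have hnn := gs_compare hc hd hQ hp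
  have hmono : MonotoneOn (fun x => Real.exp (K * x) * Q x) (Icc p q) := by
    have hder : ∀ x ∈ Ioo p q, HasDerivAt (fun x => Real.exp (K * x) * Q x)
        (Real.exp (K * x) * K * Q x + Real.exp (K * x) * Q' x) x := by
      intro x hx
      have h1 : HasDerivAt (fun x => Real.exp (K * x)) (Real.exp (K * x) * K) x := by
        simpa using ((hasDerivAt_id x).const_mul K).exp
      exact h1.mul (hd x hx)
    refine monotoneOn_of_deriv_nonneg (convex_Icc p q) ?_ ?_ ?_
    · exact ContinuousOn.mul (by fun_prop) hc
    · rw [interior_Icc]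
      exact fun x hx => (hder x hx).differentiableAt.differentiableWithinAt
    · rw [interior_Icc]
      intro x hx
      rw [(hder x hx).deriv]
      have he := Real.exp_pos (K * x)
      have hb := hQ x hx
      rw [abs_of_nonneg (hnn x (Ioo_subset_Icc_self hx))] at hb
      nlinarith
  intro x hx
  have h1 := hmono hx (right_mem_Icc.2 (hx.1.trans hx.2)) hx.2
  simp only [hq, mul_zero] at h1
  have he := Real.exp_pos (K * x)
  have := hnn x hx
  nlinarith

lemma gs_compare_pos {p q K : ℝ} {Q Q' : ℝ → ℝ} (hpq : p < q)
    (hc : ContinuousOn Q (Icc p q)) (hd : ∀ x ∈ Ioo p q, HasDerivAt Q (Q' x) x)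
    (hQ : ∀ x ∈ Ioo p q, 1 - K * |Q x| ≤ Q' x) (hp : 0 ≤ Q p) : 0 < Q q := by
  have hQ' : ∀ x ∈ Ioo p q, -K * |Q x| ≤ Q' x := fun x hx => by linarith [hQ x hx]
  have h0 := gs_compare hc hd hQ' hp q (right_mem_Icc.2 hpq.le)
  refine lt_of_le_of_ne h0 fun h => ?_
  have hz := gs_compare_eq hc hd hQ' hp h.symm
  have hm : (p + q) / 2 ∈ Ioo p q := ⟨by linarith, by linarith⟩
  have h1 := hQ _ hm
  have h2 : HasDerivAt Q 0 ((p + q) / 2) := by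
    refine (hasDerivAt_const _ (0 : ℝ)).congr_of_eventuallyEq ?_
    filter_upwards [Icc_mem_nhds hm.1 hm.2] with z hz'
    exact hz z hz'
  rw [hz _ (Ioo_subset_Icc_self hm), (hd _ hm).unique h2] at h1
  norm_num at h1

/-- Right-hand side of the Prüfer equation. -/
noncomputable def gsF (k θ : ℝ) : ℝ := 1 + (k - 1) * Real.sin θ ^ 2

lemma gs_sin_sq_lip (p q : ℝ) : |Real.sin p ^ 2 - Real.sin q ^ 2| ≤ |p - q| := by
  have : Real.sin p ^ 2 - Real.sin q ^ 2 = Real.sin (p + q) * Real.sin (p - q) := by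
    rw [Real.sin_add, Real.sin_sub]
    have h1 := Real.sin_sq_add_cos_sq p
    have h2 := Real.sin_sq_add_cos_sq q
    linear_combination (Real.sin q ^ 2) * h1 - Real.sin p ^ 2 * h2
  rw [this, abs_mul]
  calc _ ≤ 1 * |Real.sin (p - q)| := by gcongr; exact Real.abs_sin_le_one _
    _ ≤ _ := by rw [one_mul]; exact Real.abs_sin_le_abs

lemma gsF_lip {k K : ℝ} (hK : |k - 1| ≤ K) (p q : ℝ) : |gsF k p - gsF k q| ≤ K * |p - q| := by
  have : gsF k p - gsF k q = (k - 1) * (Real.sin p ^ 2 - Real.sin q ^ 2) := by unfold gsF; ring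
  rw [this, abs_mul]
  exact mul_le_mul hK (gs_sin_sq_lip p q) (abs_nonneg _) ((abs_nonneg _).trans hK)

lemma gsF_pi (k : ℝ) (n : ℤ) : gsF k (n * Real.pi) = 1 := by
  simp [gsF, Real.sin_int_mul_pi]

/-- Prüfer angle for the potential `W` on `[a,b]`. -/
def IsPr (a b : ℝ) (W : ℝ → ℝ) (l : ℝ) (θ : ℝ → ℝ) : Prop :=
  θ a = 0 ∧ ∀ x ∈ Icc a b, HasDerivAt θ (gsF (l - W x) (θ x)) x

lemma gs_exists_pr {a b : ℝ} (hab : a < b) {W : ℝ → ℝ} (hW : Continuous W) {M : ℝ}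
    (hM : ∀ x, |W x| ≤ M) (l : ℝ) : ∃ θ, IsPr a b W l θ := by
  have hM0 : 0 ≤ M := (abs_nonneg _).trans (hM 0)
  have hk : ∀ x, |l - W x - 1| ≤ |l| + M + 1 := by
    intro x
    have h1 := abs_le.1 (hM x)
    have h2 := neg_abs_le l
    have h3 := le_abs_self l
    rw [abs_le]; constructor <;> linarith [h1.1, h1.2]
  have hK0 : 0 ≤ |l| + M + 1 := by positivity
  let K : NNReal := ⟨|l| + M + 1, hK0⟩
  let L : NNReal := ⟨|l| + M + 2, by positivity⟩
  let A : NNReal := ⟨(|l| + M + 2) * (b + 1 - (a - 1)), by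
    have : 0 ≤ b + 1 - (a - 1) := by linarith
    positivity⟩
  have hpl : IsPicardLindelof (fun x θ => gsF (l - W x) θ) (tmin := a - 1) (tmax := b + 1)
      ⟨a, by constructor <;> linarith⟩ (0 : ℝ) A 0 L K := by
    refine ⟨fun t _ => ?_, fun x _ => ?_, fun t _ x _ => ?_, ?_⟩
    · refine LipschitzOnWith.of_dist_le_mul fun x _ y _ => ?_
      rw [Real.dist_eq, Real.dist_eq]
      exact gsF_lip (hk t) x y
    · unfold gsF; fun_prop
    · change ‖gsF _ _‖ ≤ |l| + M + 2
      unfold gsF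
      have h1 : |(l - W t - 1) * Real.sin x ^ 2| ≤ (|l| + M + 1) * 1 := by
        rw [abs_mul]
        refine mul_le_mul (hk t) ?_ (abs_nonneg _) hK0
        rw [abs_of_nonneg (sq_nonneg _)]; exact Real.sin_sq_le_one x
      rw [Real.norm_eq_abs]
      have := abs_add_le 1 ((l - W t - 1) * Real.sin x ^ 2)
      rw [abs_one] at this
      linarith
    · change (|l| + M + 2) * max (b + 1 - a) (a - (a - 1)) ≤ (|l| + M + 2) * (b + 1 - (a - 1)) - 0
      rw [sub_zero]
      refine mul_le_mul_of_nonneg_left ?_ (by positivity)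
      refine max_le ?_ ?_ <;> linarith
  obtain ⟨θ, h0, hθ⟩ := hpl.exists_eq_forall_mem_Icc_hasDerivWithinAt₀
  refine ⟨θ, h0, fun x hx => ?_⟩
  exact (hθ x ⟨by linarith [hx.1], by linarith [hx.2]⟩).hasDerivAt
    (Icc_mem_nhds (by linarith [hx.1]) (by linarith [hx.2]))

section Pr
variable {a b : ℝ} {W : ℝ → ℝ} {M l : ℝ} {θ : ℝ → ℝ}

lemma gs_kbound (hM : ∀ x, |W x| ≤ M) (l x : ℝ) : |l - W x - 1| ≤ |l| + M + 1 := by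
  have h1 := abs_le.1 (hM x)
  have h2 := neg_abs_le l
  have h3 := le_abs_self l
  rw [abs_le]; constructor <;> linarith [h1.1, h1.2]

lemma IsPr.cont (h : IsPr a b W l θ) : ContinuousOn θ (Icc a b) :=
  fun x hx => (h.2 x hx).continuousAt.continuousWithinAt

/-- once the angle is at least `nπ`, it is strictly larger afterwards. -/
lemma IsPr.cross (hM : ∀ x, |W x| ≤ M) (h : IsPr a b W l θ) (n : ℤ) {x y : ℝ}
    (hx : a ≤ x) (hxy : x < y) (hy : y ≤ b) (hn : n * Real.pi ≤ θ x) : n * Real.pi < θ y := by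
  have := gs_compare_pos (K := |l| + M + 1) (Q := fun z => θ z - n * Real.pi)
    (Q' := fun z => gsF (l - W z) (θ z)) hxy ?_ ?_ ?_ (by linarith)
  · linarith
  · exact (h.cont.mono (Icc_subset_Icc hx hy)).sub continuousOn_const
  · intro z hz
    exact (h.2 z ⟨hx.trans hz.1.le, hz.2.le.trans hy⟩).sub_const _
  · intro z hz
    have := gsF_lip (gs_kbound hM l z) (θ z) (n * Real.pi)
    rw [gsF_pi] at this
    have := (abs_le.1 this).1
    linarith

lemma IsPr.pos (hM : ∀ x, |W x| ≤ M) (h : IsPr a b W l θ) {y : ℝ}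
    (hy : a < y) (hyb : y ≤ b) : 0 < θ y := by
  have := h.cross hM 0 le_rfl hy hyb (by simp [h.1])
  simpa using this

lemma IsPr.lt_pi (hM : ∀ x, |W x| ≤ M) (h : IsPr a b W l θ) {T y : ℝ} (hT : T ≤ b)
    (hTp : θ T ≤ Real.pi) (hy : a ≤ y) (hyb : y < T) : θ y < Real.pi := by
  by_contra hc
  push Not at hc
  have := h.cross hM 1 hy hyb hT (by simpa using hc)
  simp at this
  linarith

/-- low energies. -/
lemma IsPr.low (h : IsPr a b W l θ) (hl : ∀ x, l ≤ W x) {T : ℝ} (hT : T ∈ Icc a b) :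
    θ T < Real.pi := by
  have h1 := gs_compare (K := 1) (Q := fun z => Real.pi / 2 - θ z)
    (Q' := fun z => - gsF (l - W z) (θ z)) (p := a) (q := T) ?_ ?_ ?_ (by simp only [h.1]; linarith [Real.pi_pos]) T
      (right_mem_Icc.2 hT.1)
  · linarith [Real.pi_pos]
  · exact continuousOn_const.sub (h.cont.mono (Icc_subset_Icc_right hT.2))
  · intro z hz
    exact (h.2 z ⟨hz.1.le, hz.2.le.trans hT.2⟩).const_sub _
  · intro z hz
    have h2 : gsF (l - W z) (θ z) ≤ Real.cos (θ z) ^ 2 := by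
      unfold gsF
      have := Real.sin_sq_add_cos_sq (θ z)
      have := hl z
      nlinarith [sq_nonneg (Real.sin (θ z))]
    have h3 := gs_sin_sq_lip (Real.pi / 2 - θ z) 0
    rw [Real.sin_pi_div_two_sub] at h3
    simp at h3
    linarith

lemma gs_cont_l (hM : ∀ x, |W x| ≤ M) {Θ : ℝ → ℝ → ℝ} (hΘ : ∀ l, IsPr a b W l (Θ l)) {T : ℝ}
    (hT : T ∈ Icc a b) : Continuous fun l => Θ l T := by
  have hM0 : 0 ≤ M := (abs_nonneg _).trans (hM 0)
  rw [continuous_iff_continuousAt]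
  intro l
  have key : ∀ m, dist (Θ m T) (Θ l T) ≤ gronwallBound 0 (|l| + M + 1) (|m - l| + 0) (T - a) := by
    intro m
    let K : NNReal := ⟨|l| + M + 1, by positivity⟩
    refine dist_le_of_approx_trajectories_ODE (K := K) (a := a) (b := b)
      (v := fun x θ => gsF (l - W x) θ) (f' := fun x => gsF (m - W x) (Θ m x))
      (g' := fun x => gsF (l - W x) (Θ l x)) ?_ (hΘ m).cont ?_ ?_ (hΘ l).cont ?_ ?_ ?_ T hT
    · intro t
      refine LipschitzWith.of_dist_le_mul fun x y => ?_
      rw [Real.dist_eq, Real.dist_eq]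
      exact gsF_lip (gs_kbound hM l t) x y
    · exact fun t ht => ((hΘ m).2 t (Ico_subset_Icc_self ht)).hasDerivWithinAt
    · intro t ht
      rw [Real.dist_eq]
      have : gsF (m - W t) (Θ m t) - gsF (l - W t) (Θ m t) = (m - l) * Real.sin (Θ m t) ^ 2 := by
        unfold gsF; ring
      rw [this, abs_mul]
      refine mul_le_of_le_one_right (abs_nonneg _) ?_
      rw [abs_of_nonneg (sq_nonneg _)]; exact Real.sin_sq_le_one _
    · exact fun t ht => ((hΘ l).2 t (Ico_subset_Icc_self ht)).hasDerivWithinAt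
    · intro t ht; simp
    · simp [(hΘ m).1, (hΘ l).1]
  unfold ContinuousAt
  rw [tendsto_iff_dist_tendsto_zero]
  refine squeeze_zero (fun _ => dist_nonneg) key ?_
  have h1 := (gronwallBound_continuous_ε 0 (|l| + M + 1) (T - a)).comp
    (show Continuous fun m : ℝ => |m - l| + 0 by fun_prop)
  have h2 := h1.tendsto l
  simp only [Function.comp_def, sub_self, abs_zero, add_zero, gronwallBound_ε0_δ0] at h2
  simpa using h2

/-- positivity of the derivative of the Prüfer angle for convex potentials. -/
lemma IsPr.deriv_pos (hM : ∀ x, |W x| ≤ M) (hWc : Continuous W)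
    (hconv : ConvexOn ℝ (Icc a b) W) (h : IsPr a b W l θ) {T : ℝ} (hT : T ≤ b)
    (hTp : θ T = Real.pi) : ∀ x ∈ Icc a T, 0 < gsF (l - W x) (θ x) := by
  have hne : ∀ x ∈ Icc a T, gsF (l - W x) (θ x) ≠ 0 := by
    intro x hx h0
    have hsin0 : Real.sin (θ x) ≠ 0 := by
      intro h1; simp [gsF, h1] at h0
    have hxa : a < x := by
      refine lt_of_le_of_ne hx.1 fun h1 => hsin0 ?_
      rw [← h1, h.1, Real.sin_zero]
    have hxT : x < T := by
      refine lt_of_le_of_ne hx.2 fun h1 => hsin0 ?_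
      rw [h1, hTp, Real.sin_pi]
    have hbound : ∀ z, W x ≤ W z → -(|l| + M + 1) * |θ x - θ z| ≤ -gsF (l - W z) (θ z) := by
      intro z hz
      have h1 := gsF_lip (gs_kbound hM l x) (θ x) (θ z)
      rw [h0] at h1
      have h2 : gsF (l - W z) (θ z) ≤ gsF (l - W x) (θ z) := by
        unfold gsF
        nlinarith [sq_nonneg (Real.sin (θ z))]
      have := (abs_le.1 h1).1
      linarith
    have hcases : (∀ z ∈ Icc a x, W x ≤ W z) ∨ (∀ z ∈ Icc x T, W x ≤ W z) := by
      by_contra hc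
      push Not at hc
      obtain ⟨⟨z1, hz1, h1⟩, ⟨z2, hz2, h2⟩⟩ := hc
      have := hconv.le_max_of_mem_Icc (x := z1) (y := z2) (z := x)
        ⟨hz1.1, hz1.2.trans (hx.2.trans hT)⟩ ⟨hx.1.trans hz2.1, hz2.2.trans hT⟩ ⟨hz1.2, hz2.1⟩
      exact absurd this (not_le.2 (max_lt h1 h2))
    rcases hcases with hA | hB
    · have h1 := gs_compare_eq (K := |l| + M + 1) (Q := fun z => θ x - θ z)
        (Q' := fun z => - gsF (l - W z) (θ z)) (p := a) (q := x)
        (continuousOn_const.sub (h.cont.mono (Icc_subset_Icc_right (hx.2.trans hT))))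
        (fun z hz => (h.2 z ⟨hz.1.le, hz.2.le.trans (hx.2.trans hT)⟩).const_sub _)
        (fun z hz => hbound z (hA z (Ioo_subset_Icc_self hz)))
        (by simp only [h.1, sub_zero]; exact (h.pos hM hxa (hx.2.trans hT)).le)
        (by simp) a (left_mem_Icc.2 hx.1)
      have h2 := h.pos hM hxa (hx.2.trans hT)
      simp only [h.1] at h1
      linarith
    · have h1 := gs_compare (K := |l| + M + 1) (Q := fun z => θ x - θ z)
        (Q' := fun z => - gsF (l - W z) (θ z)) (p := x) (q := T)
        (continuousOn_const.sub (h.cont.mono (Icc_subset_Icc hx.1 hT)))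
        (fun z hz => (h.2 z ⟨hx.1.trans hz.1.le, hz.2.le.trans hT⟩).const_sub _)
        (fun z hz => hbound z (hB z (Ioo_subset_Icc_self hz)))
        (by simp) T (right_mem_Icc.2 hx.2)
      have h2 := h.lt_pi hM hT hTp.le hx.1 hxT
      simp only [hTp] at h1
      linarith
  intro x hx
  by_contra hneg
  push Not at hneg
  have hcont : ContinuousOn (fun x => gsF (l - W x) (θ x)) (Icc a x) := by
    have := h.cont.mono (Icc_subset_Icc_right (hx.2.trans hT))
    unfold gsF
    fun_prop
  have hiv := intermediate_value_Icc' hx.1 hcont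
  have h0 : (0 : ℝ) ∈ Icc (gsF (l - W x) (θ x)) (gsF (l - W a) (θ a)) :=
    ⟨hneg, by rw [h.1]; simp [gsF]⟩
  obtain ⟨z, hz, hz0⟩ := hiv h0
  exact hne z ⟨hz.1, hz.2.trans hx.2⟩ hz0

end Pr

section Energy
variable {a b : ℝ} {W : ℝ → ℝ} {M l : ℝ} {θ : ℝ → ℝ}

lemma gs_cauchy {a T : ℝ} {u u' : ℝ → ℝ} (hu : MemH10 a T u u') {p q : ℝ} (hp : a ≤ p)
    (hpq : p < q) (hq : q ≤ T) : (u q - u p) ^ 2 ≤ (q - p) * ∫ x in p..q, (u' x) ^ 2 := by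
  obtain ⟨hc, hd, hi, -, -⟩ := hu
  set c := (u q - u p) / (q - p) with hcdef
  have hIntg : IntegrableOn (fun x => (u' x) ^ 2) (Icc p q) := by
    rw [intervalIntegrable_iff_integrableOn_Icc_of_le (hp.trans (hpq.le.trans hq))] at hi
    exact hi.mono_set (Icc_subset_Icc hp hq)
  have h := intervalIntegral.sub_le_integral_of_hasDeriv_right_of_le hpq.le
    (g := fun x => 2 * c * u x - c ^ 2 * x) (g' := fun x => 2 * c * u' x - c ^ 2)
    (φ := fun x => (u' x) ^ 2) ?_ ?_ hIntg ?_
  · have hpos : 0 < q - p := by linarith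
    have h2 : c * (q - p) = u q - u p := by rw [hcdef]; field_simp
    have h3 : (q - p) * (2 * c * u q - c ^ 2 * q - (2 * c * u p - c ^ 2 * p))
        = (u q - u p) ^ 2 := by rw [← h2]; linear_combination (-2 * c * (q - p)) * h2
    rw [← h3]
    exact mul_le_mul_of_nonneg_left h hpos.le
  · have := hc.mono (Icc_subset_Icc hp hq)
    fun_prop
  · intro x hx
    have h1 := hd x ⟨hp.trans_lt hx.1, hx.2.trans_le hq⟩
    have h2 := (h1.const_mul (2 * c)).sub ((hasDerivAt_id x).const_mul (c ^ 2))
    simp only [mul_one] at h2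
    exact h2.hasDerivWithinAt
  · intro x _
    nlinarith [sq_nonneg (u' x - c)]

lemma gs_bdry {S : Set ℝ} {e d : ℝ} {u I θ : ℝ → ℝ} (hI : Tendsto I (𝓝[S] e) (𝓝 0))
    (hu : ∀ x ∈ S, (u x) ^ 2 ≤ |x - e| * |I x|)
    (hd : HasDerivAt (fun x => Real.sin (θ x)) d e) (h0 : Real.sin (θ e) = 0) (hd0 : d ≠ 0) :
    ContinuousWithinAt (fun x => (u x) ^ 2 * (Real.cos (θ x) / Real.sin (θ x))) S e := by
  rw [← continuousWithinAt_sdiff_self]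
  unfold ContinuousWithinAt
  simp only [h0, div_zero, mul_zero]
  have hle : 𝓝[S \ {e}] e ≤ 𝓝[≠] e := nhdsWithin_mono _ (fun x hx => hx.2)
  have hs : Tendsto (slope (fun x => Real.sin (θ x)) e) (𝓝[S \ {e}] e) (𝓝 d) :=
    hd.tendsto_slope.mono_left hle
  have hI' : Tendsto I (𝓝[S \ {e}] e) (𝓝 0) := hI.mono_left (nhdsWithin_mono _ sdiff_subset)
  have hprod : Tendsto (fun x => |I x| * |(slope (fun x => Real.sin (θ x)) e x)⁻¹|)
      (𝓝[S \ {e}] e) (𝓝 0) := by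
    have := hI'.abs.mul (hs.inv₀ hd0).abs
    simpa using this
  refine squeeze_zero_norm' ?_ hprod
  filter_upwards [self_mem_nhdsWithin] with x hx
  have hxe : x - e ≠ 0 := sub_ne_zero.2 hx.2
  rw [slope_def_field, h0, sub_zero, Real.norm_eq_abs, abs_mul, abs_div, inv_div, abs_div,
    abs_of_nonneg (sq_nonneg (u x))]
  have h1 := hu x hx.1
  have h2 := Real.abs_cos_le_one (θ x)
  calc _ ≤ (|x - e| * |I x|) * (1 / |Real.sin (θ x)|) := by gcongr
    _ = _ := by ring

lemma gs_jacobi (hM : ∀ x, |W x| ≤ M) (hW : Continuous W) (h : IsPr a b W l θ) {T : ℝ}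
    (haT : a < T) (hT : T ≤ b) (hTp : θ T ≤ Real.pi) {u u' : ℝ → ℝ} (hu : MemH10 a T u u') :
    l * ∫ x in a..T, (u x) ^ 2 ≤ ∫ x in a..T, ((u' x) ^ 2 + W x * (u x) ^ 2) := by
  have hu0 := hu
  obtain ⟨hc, hd, hi, hua, huT⟩ := hu
  have hi1 : IntervalIntegrable (fun x => (u x) ^ 2) volume a T := by
    apply ContinuousOn.intervalIntegrable
    rw [uIcc_of_le haT.le]; fun_prop
  have hi2 : IntervalIntegrable (fun x => W x * (u x) ^ 2) volume a T := by
    apply ContinuousOn.intervalIntegrable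
    rw [uIcc_of_le haT.le]; fun_prop
  have hi3 : IntervalIntegrable (fun x => (u' x) ^ 2 + W x * (u x) ^ 2 - l * (u x) ^ 2)
      volume a T := (hi.add hi2).sub (hi1.const_mul l)
  have hθc : ContinuousOn θ (Icc a T) := h.cont.mono (Icc_subset_Icc_right hT)
  have hsin : ∀ x ∈ Ioo a T, Real.sin (θ x) ≠ 0 := fun x hx =>
    (Real.sin_pos_of_pos_of_lt_pi (h.pos hM hx.1 (hx.2.le.trans hT))
      (h.lt_pi hM hT hTp hx.1.le hx.2)).ne'
  have hsd : ∀ x ∈ Icc a T, Real.sin (θ x) = 0 →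
      HasDerivAt (fun x => Real.sin (θ x)) (Real.cos (θ x)) x := by
    intro x hx h0
    have h1 := (h.2 x ⟨hx.1, hx.2.trans hT⟩).sin
    simpa [gsF, h0] using h1
  have hcne : ∀ x, Real.sin (θ x) = 0 → Real.cos (θ x) ≠ 0 := by
    intro x h0 h1
    have := Real.sin_sq_add_cos_sq (θ x)
    rw [h0, h1] at this
    norm_num at this
  have hG : ContinuousOn (fun x => (u x) ^ 2 * (Real.cos (θ x) / Real.sin (θ x))) (Icc a T) := by
    intro x hx
    by_cases h0 : Real.sin (θ x) = 0
    · have hx2 : x = a ∨ x = T := by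
        by_contra hne
        push Not at hne
        exact hsin x ⟨lt_of_le_of_ne hx.1 (Ne.symm hne.1), lt_of_le_of_ne hx.2 hne.2⟩ h0
      have hIntg : IntegrableOn (fun x => (u' x) ^ 2) (Icc a T) := by
        rwa [intervalIntegrable_iff_integrableOn_Icc_of_le haT.le] at hi
      rcases hx2 with rfl | rfl
      · refine gs_bdry (I := fun y => ∫ z in x..y, (u' z) ^ 2) ?_ ?_ (hsd x hx h0) h0 (hcne x h0)
        · have h1 := intervalIntegral.continuousOn_primitive_interval
            (f := fun z => (u' z) ^ 2) (μ := volume) (a := x) (b := T)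
            (by rwa [uIcc_of_le haT.le])
          rw [uIcc_of_le haT.le] at h1
          have h2 := h1 x hx
          unfold ContinuousWithinAt at h2
          simpa using h2
        · intro y hy
          rcases hy.1.eq_or_lt with rfl | hlt
          · simp [hua]
          · have h1 := gs_cauchy hu0 le_rfl hlt hy.2
            rw [hua, sub_zero] at h1
            rw [abs_of_pos (sub_pos.2 hlt)]
            exact h1.trans (mul_le_mul_of_nonneg_left (le_abs_self _) (sub_pos.2 hlt).le)
      · refine gs_bdry (I := fun y => ∫ z in y..x, (u' z) ^ 2) ?_ ?_ (hsd x hx h0) h0 (hcne x h0)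
        · have h1 := intervalIntegral.continuousOn_primitive_interval_left
            (f := fun z => (u' z) ^ 2) (μ := volume) (a := a) (b := x)
            (by rwa [uIcc_of_le haT.le])
          rw [uIcc_of_le haT.le] at h1
          have h2 := h1 x hx
          unfold ContinuousWithinAt at h2
          simpa using h2
        · intro y hy
          rcases hy.2.eq_or_lt with rfl | hlt
          · simp [huT]
          · have h1 := gs_cauchy hu0 hy.1 hlt le_rfl
            rw [huT, zero_sub, neg_sq] at h1
            rw [abs_sub_comm, abs_of_pos (sub_pos.2 hlt)]
            exact h1.trans (mul_le_mul_of_nonneg_left (le_abs_self _) (sub_pos.2 hlt).le)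
    · have h1 := hc x hx
      have h2 := hθc x hx
      have h3 : ContinuousWithinAt (fun x => Real.sin (θ x)) (Icc a T) x :=
        Real.continuous_sin.continuousAt.comp_continuousWithinAt h2
      have h4 : ContinuousWithinAt (fun x => Real.cos (θ x)) (Icc a T) x :=
        Real.continuous_cos.continuousAt.comp_continuousWithinAt h2
      exact (h1.pow 2).mul (h4.div h3 h0)
  have hmain := intervalIntegral.sub_le_integral_of_hasDeriv_right_of_le haT.le
    (g := fun x => (u x) ^ 2 * (Real.cos (θ x) / Real.sin (θ x)))
    (g' := fun x => 2 * u x * u' x * (Real.cos (θ x) / Real.sin (θ x))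
      + (u x) ^ 2 * (-gsF (l - W x) (θ x) / Real.sin (θ x) ^ 2))
    (φ := fun x => (u' x) ^ 2 + W x * (u x) ^ 2 - l * (u x) ^ 2) hG ?_
    (by rwa [intervalIntegrable_iff_integrableOn_Icc_of_le haT.le] at hi3) ?_
  · simp only [hua, huT] at hmain
    rw [intervalIntegral.integral_sub (hi.add hi2) (hi1.const_mul l),
      intervalIntegral.integral_const_mul] at hmain
    simp only [ne_eq, OfNat.ofNat_ne_zero, not_false_eq_true, zero_pow, zero_mul, sub_self] at hmain
    linarith
  · intro x hx
    have h1 := hd x hx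
    have h2 := h.2 x ⟨hx.1.le, hx.2.le.trans hT⟩
    have h3 := (h1.pow 2).mul (h2.cos.div h2.sin (hsin x hx))
    refine HasDerivAt.hasDerivWithinAt (h3.congr_deriv ?_)
    have h4 := Real.sin_sq_add_cos_sq (θ x)
    have h5 : -Real.sin (θ x) * gsF (l - W x) (θ x) * Real.sin (θ x)
        - Real.cos (θ x) * (Real.cos (θ x) * gsF (l - W x) (θ x)) = -gsF (l - W x) (θ x) := by
      linear_combination (-gsF (l - W x) (θ x)) * h4
    rw [h5]
    simp
  · intro x hx
    have hs := hsin x hx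
    have h4 := Real.sin_sq_add_cos_sq (θ x)
    have h5 : gsF (l - W x) (θ x) / Real.sin (θ x) ^ 2
        = (Real.cos (θ x) / Real.sin (θ x)) ^ 2 + (l - W x) := by
      unfold gsF
      field_simp
      linear_combination -h4
    rw [neg_div, h5]
    nlinarith [sq_nonneg (u' x - (Real.cos (θ x) / Real.sin (θ x)) * u x)]

lemma gs_trial (hM : ∀ x, |W x| ≤ M) (hW : Continuous W) (h : IsPr a b W l θ) {T : ℝ}
    (haT : a < T) (hT : T ≤ b) (hTp : θ T = Real.pi) :
    ∃ u u' : ℝ → ℝ, MemH10 a T u u' ∧ (∫ x in a..T, (u x) ^ 2) = 1 ∧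
      l = ∫ x in a..T, ((u' x) ^ 2 + W x * (u x) ^ 2) := by
  have hθc : ContinuousOn θ (Icc a T) := h.cont.mono (Icc_subset_Icc_right hT)
  -- a globally continuous version of the angle
  let η : ℝ → ℝ := fun x => θ (max a (min T x))
  have hη : Continuous η := hθc.comp_continuous (by fun_prop)
    (fun x => ⟨le_max_left _ _, max_le haT.le (min_le_left _ _)⟩)
  have hηθ : ∀ x ∈ Icc a T, η x = θ x := by
    intro x hx
    simp only [η]
    rw [min_eq_right hx.2, max_eq_right hx.1]
  let ρ : ℝ → ℝ := fun x => (1 + W x - l) * (Real.sin (η x) * Real.cos (η x))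
  have hρ : Continuous ρ := by fun_prop
  let r : ℝ → ℝ := fun x => Real.exp (∫ y in a..x, ρ y)
  have hr : ∀ x, HasDerivAt r (r x * ρ x) x := by
    intro x
    exact (intervalIntegral.integral_hasDerivAt_right (hρ.intervalIntegrable _ _)
      (hρ.stronglyMeasurableAtFilter _ _) hρ.continuousAt).exp
  have hrc : Continuous r := continuous_iff_continuousAt.2 fun x => (hr x).continuousAt
  have hrpos : ∀ x, 0 < r x := fun x => Real.exp_pos _
  have hηd : ∀ x ∈ Ioo a T, HasDerivAt η (gsF (l - W x) (η x)) x := by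
    intro x hx
    rw [hηθ x (Ioo_subset_Icc_self hx)]
    refine (h.2 x ⟨hx.1.le, hx.2.le.trans hT⟩).congr_of_eventuallyEq ?_
    filter_upwards [Icc_mem_nhds hx.1 hx.2] with z hz
    exact hηθ z hz
  let U : ℝ → ℝ := fun x => r x * Real.sin (η x)
  let U' : ℝ → ℝ := fun x => r x * Real.cos (η x)
  have hUc : Continuous U := by fun_prop
  have hU'c : Continuous U' := by fun_prop
  have hUd : ∀ x ∈ Ioo a T, HasDerivAt U (U' x) x := by
    intro x hx
    refine ((hr x).mul (hηd x hx).sin).congr_deriv ?_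
    have h4 := Real.sin_sq_add_cos_sq (η x)
    simp only [ρ, gsF, U']
    linear_combination r x * Real.cos (η x) * (-1 + 0) * h4 + r x * Real.cos (η x) * h4
  have hU'd : ∀ x ∈ Ioo a T, HasDerivAt U' ((W x - l) * U x) x := by
    intro x hx
    refine ((hr x).mul (hηd x hx).cos).congr_deriv ?_
    have h4 := Real.sin_sq_add_cos_sq (η x)
    simp only [ρ, gsF, U]
    linear_combination r x * Real.sin (η x) * (1 + W x - l) * h4
  have hUa : U a = 0 := by simp [U, hηθ a (left_mem_Icc.2 haT.le), h.1]
  have hUT : U T = 0 := by simp [U, hηθ T (right_mem_Icc.2 haT.le), hTp]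
  have hpos : 0 < ∫ x in a..T, (U x) ^ 2 := by
    refine intervalIntegral.intervalIntegral_pos_of_pos_on
      ((hUc.pow 2).intervalIntegrable _ _) ?_ haT
    intro x hx
    have h1 : 0 < Real.sin (η x) := by
      rw [hηθ x (Ioo_subset_Icc_self hx)]
      exact Real.sin_pos_of_pos_of_lt_pi (h.pos hM hx.1 (hx.2.le.trans hT))
        (h.lt_pi hM hT hTp.le hx.1.le hx.2)
    have h2 := hrpos x
    simp only [U]
    positivity
  have hE : ∫ x in a..T, ((U' x) ^ 2 + W x * (U x) ^ 2) = l * ∫ x in a..T, (U x) ^ 2 := by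
    have h1 := intervalIntegral.integral_eq_sub_of_hasDerivAt_of_le haT.le
      (f := fun x => U x * U' x)
      (f' := fun x => U' x * U' x + U x * ((W x - l) * U x))
      (by fun_prop) (fun x hx => (hUd x hx).mul (hU'd x hx))
      ((by fun_prop : Continuous _).intervalIntegrable _ _)
    rw [hUa, hUT, zero_mul, zero_mul, sub_zero] at h1
    rw [← intervalIntegral.integral_const_mul, ← sub_eq_zero,
      ← intervalIntegral.integral_sub ((by fun_prop : Continuous _).intervalIntegrable _ _)
        ((by fun_prop : Continuous _).intervalIntegrable _ _), ← h1]
    congr 1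
    ext x
    ring
  set N := ∫ x in a..T, (U x) ^ 2 with hN
  have hsq : (Real.sqrt N)⁻¹ ^ 2 = N⁻¹ := by rw [inv_pow, Real.sq_sqrt hpos.le]
  refine ⟨fun x => (Real.sqrt N)⁻¹ * U x, fun x => (Real.sqrt N)⁻¹ * U' x,
    ⟨by fun_prop, fun x hx => (hUd x hx).const_mul _,
      (by fun_prop : Continuous _).intervalIntegrable _ _, by simp [hUa], by simp [hUT]⟩, ?_, ?_⟩
  · simp only [mul_pow, hsq]
    rw [intervalIntegral.integral_const_mul, ← hN, inv_mul_cancel₀ hpos.ne']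
  · have : ∀ x, ((Real.sqrt N)⁻¹ * U' x) ^ 2 + W x * ((Real.sqrt N)⁻¹ * U x) ^ 2
        = N⁻¹ * ((U' x) ^ 2 + W x * (U x) ^ 2) := by
      intro x; linear_combination ((U' x) ^ 2 + W x * (U x) ^ 2) * hsq
    simp only [this]
    rw [intervalIntegral.integral_const_mul, hE]
    field_simp

lemma gs_energy_eq (hM : ∀ x, |W x| ≤ M) (hW : Continuous W) (h : IsPr a b W l θ) {T : ℝ}
    (haT : a < T) (hT : T ≤ b) (hTp : θ T = Real.pi) : groundStateEnergy a W T = l := by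
  unfold groundStateEnergy
  have hlow : ∀ E ∈ { E : ℝ | ∃ u u' : ℝ → ℝ, MemH10 a T u u' ∧
    (∫ x in a..T, (u x) ^ 2) = 1 ∧
    E = ∫ x in a..T, ((u' x) ^ 2 + W x * (u x) ^ 2) }, l ≤ E := by
    rintro E ⟨u, u', hu, h1, rfl⟩
    have := gs_jacobi hM hW h haT hT hTp.le hu
    rwa [h1, mul_one] at this
  have hmem := gs_trial hM hW h haT hT hTp
  exact le_antisymm (csInf_le ⟨l, hlow⟩ hmem) (le_csInf ⟨l, hmem⟩ hlow)

lemma gs_energy_congr {V : ℝ → ℝ} (hVW : ∀ x ∈ Icc a b, V x = W x) {T : ℝ} (haT : a < T)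
    (hT : T ≤ b) : groundStateEnergy a V T = groundStateEnergy a W T := by
  unfold groundStateEnergy
  have : ∀ u u' : ℝ → ℝ, ∫ x in a..T, ((u' x) ^ 2 + V x * (u x) ^ 2)
      = ∫ x in a..T, ((u' x) ^ 2 + W x * (u x) ^ 2) := by
    intro u u'
    refine intervalIntegral.integral_congr fun x hx => ?_
    rw [uIcc_of_le haT.le] at hx
    simp only [hVW x ⟨hx.1, hx.2.trans hT⟩]
  simp only [this]

/-- existence of an eigenvalue below `L` once the angle has reached `π`. -/
lemma gs_exists_le (hM : ∀ x, |W x| ≤ M) {Θ : ℝ → ℝ → ℝ} (hΘ : ∀ l, IsPr a b W l (Θ l)) {T : ℝ}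
    (hT : T ∈ Icc a b) {L : ℝ} (hL : Real.pi ≤ Θ L T) : ∃ l ≤ L, Θ l T = Real.pi := by
  have hc := gs_cont_l hM hΘ hT
  have hlow : Θ (min L (-M)) T < Real.pi :=
    (hΘ _).low (fun x => (min_le_right _ _).trans (neg_le_of_abs_le (hM x))) hT
  obtain ⟨l, hl, hl'⟩ := intermediate_value_Icc (min_le_left L (-M)) hc.continuousOn
    (show Real.pi ∈ Icc (Θ (min L (-M)) T) (Θ L T) from ⟨hlow.le, hL⟩)
  exact ⟨l, hl.2, hl'⟩

lemma gs_exists_eig (hM : ∀ x, |W x| ≤ M) (hW : Continuous W) {Θ : ℝ → ℝ → ℝ}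
    (hΘ : ∀ l, IsPr a b W l (Θ l)) {T : ℝ} (haT : a < T) (hT : T ≤ b) :
    ∃ l, Θ l T = Real.pi := by
  suffices hs : ∃ L, Real.pi ≤ Θ L T by
    obtain ⟨L, hL⟩ := hs
    obtain ⟨l, -, hl⟩ := gs_exists_le hM hΘ ⟨haT.le, hT⟩ hL
    exact ⟨l, hl⟩
  by_contra hcon
  push Not at hcon
  have hmem : MemH10 a T (fun x => (x - a) * (T - x)) (fun x => 1 * (T - x) + (x - a) * (-1)) := by
    refine ⟨by fun_prop, fun x _ => ?_, (by fun_prop : Continuous _).intervalIntegrable _ _,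
      by simp, by simp⟩
    exact ((hasDerivAt_id x).sub_const a).mul ((hasDerivAt_id x).const_sub T)
  have hpos : 0 < ∫ x in a..T, ((x - a) * (T - x)) ^ 2 := by
    refine intervalIntegral.intervalIntegral_pos_of_pos_on
      ((by fun_prop : Continuous _).intervalIntegrable _ _) ?_ haT
    intro x hx
    have h1 := sub_pos.2 hx.1
    have h2 := sub_pos.2 hx.2
    positivity
  set E := ∫ x in a..T, ((1 * (T - x) + (x - a) * (-1)) ^ 2 + W x * ((x - a) * (T - x)) ^ 2)
  set N := ∫ x in a..T, ((x - a) * (T - x)) ^ 2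
  have h1 := gs_jacobi hM hW (hΘ (E / N + 1)) haT hT (hcon _).le hmem
  change (E / N + 1) * N ≤ E at h1
  have : (E / N + 1) * N = E + N := by field_simp
  linarith

end Energy

section Main
variable {a b : ℝ} {W : ℝ → ℝ} {M l : ℝ} {θ : ℝ → ℝ}

lemma gs_inverse (hM : ∀ x, |W x| ≤ M) (hW : Continuous W)
    (hconv : ConvexOn ℝ (Icc a b) W) (h : IsPr a b W l θ) {T : ℝ} (haT : a < T) (hT : T ≤ b)
    (hTp : θ T = Real.pi) :
    ∃ (X : ℝ → ℝ) (m : ℝ), 0 < m ∧ X 0 = a ∧ X Real.pi = T ∧ ContinuousOn X (Icc 0 Real.pi) ∧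
      (∀ p ∈ Icc 0 Real.pi, X p ∈ Icc a T ∧ m ≤ gsF (l - W (X p)) p) ∧
      ∀ p ∈ Ioo 0 Real.pi, HasDerivAt X (gsF (l - W (X p)) p)⁻¹ p := by
  have hθc : ContinuousOn θ (Icc a T) := h.cont.mono (Icc_subset_Icc_right hT)
  have hpos := h.deriv_pos hM hW hconv hT hTp
  have hgc : ContinuousOn (fun x => gsF (l - W x) (θ x)) (Icc a T) := by
    unfold gsF; fun_prop
  obtain ⟨x0, hx0, hmin⟩ := isCompact_Icc.exists_isMinOn (nonempty_Icc.2 haT.le) hgc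
  set m := gsF (l - W x0) (θ x0) with hm
  have hm0 : 0 < m := hpos x0 hx0
  have hmle : ∀ x ∈ Icc a T, m ≤ gsF (l - W x) (θ x) := fun x hx => hmin hx
  have hgrow : ∀ x ∈ Icc a T, ∀ y ∈ Icc a T, x ≤ y → m * (y - x) ≤ θ y - θ x := by
    refine Convex.mul_sub_le_image_sub_of_le_deriv (convex_Icc a T) hθc ?_ ?_
    · rw [interior_Icc]
      exact fun x hx => (h.2 x ⟨hx.1.le, hx.2.le.trans hT⟩).differentiableAt.differentiableWithinAt
    · rw [interior_Icc]
      intro x hx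
      rw [(h.2 x ⟨hx.1.le, hx.2.le.trans hT⟩).deriv]
      exact hmle x (Ioo_subset_Icc_self hx)
  have hex : ∀ p, ∃ x, p ∈ Icc 0 Real.pi → (x ∈ Icc a T ∧ θ x = p) := by
    intro p
    by_cases hp : p ∈ Icc 0 Real.pi
    · have hiv := intermediate_value_Icc haT.le hθc
      rw [h.1, hTp] at hiv
      obtain ⟨x, hx, hxp⟩ := hiv hp
      exact ⟨x, fun _ => ⟨hx, hxp⟩⟩
    · exact ⟨0, fun h => absurd h hp⟩
  choose X hX using hex
  have hlip : ∀ p ∈ Icc 0 Real.pi, ∀ q ∈ Icc 0 Real.pi, m * |X p - X q| ≤ |p - q| := by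
    intro p hp q hq
    obtain ⟨h1, h2⟩ := hX p hp
    obtain ⟨h3, h4⟩ := hX q hq
    rcases le_total (X p) (X q) with hle | hle
    · have := hgrow _ h1 _ h3 hle
      rw [h2, h4] at this
      rw [abs_sub_comm, abs_of_nonneg (sub_nonneg.2 hle), abs_sub_comm]
      exact this.trans (le_abs_self _)
    · have := hgrow _ h3 _ h1 hle
      rw [h2, h4] at this
      rw [abs_of_nonneg (sub_nonneg.2 hle)]
      exact this.trans (le_abs_self _)
  have hinj : ∀ p ∈ Icc 0 Real.pi, ∀ x ∈ Icc a T, θ x = p → X p = x := by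
    intro p hp x hx hxp
    obtain ⟨h1, h2⟩ := hX p hp
    rcases le_total (X p) x with hle | hle
    · have := hgrow _ h1 _ hx hle
      rw [h2, hxp, sub_self] at this
      nlinarith
    · have := hgrow _ hx _ h1 hle
      rw [h2, hxp, sub_self] at this
      nlinarith
  have hXc : ContinuousOn X (Icc 0 Real.pi) := by
    refine (LipschitzOnWith.of_dist_le_mul (K := ⟨m⁻¹, inv_nonneg.2 hm0.le⟩) ?_).continuousOn
    intro p hp q hq
    rw [Real.dist_eq, Real.dist_eq]
    change |X p - X q| ≤ m⁻¹ * |p - q|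
    rw [← div_eq_inv_mul, le_div_iff₀' hm0]
    exact hlip p hp q hq
  refine ⟨X, m, hm0, hinj 0 (left_mem_Icc.2 Real.pi_pos.le) a (left_mem_Icc.2 haT.le) h.1,
    hinj _ (right_mem_Icc.2 Real.pi_pos.le) T (right_mem_Icc.2 haT.le) hTp, hXc, ?_, ?_⟩
  · intro p hp
    obtain ⟨h1, h2⟩ := hX p hp
    refine ⟨h1, ?_⟩
    have := hmle _ h1
    rwa [h2] at this
  · intro p hp
    obtain ⟨h1, h2⟩ := hX p (Ioo_subset_Icc_self hp)
    have h3 := hmle _ h1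
    have h4 := h.2 (X p) ⟨h1.1, h1.2.trans hT⟩
    rw [h2] at h3 h4
    refine HasDerivAt.of_local_left_inverse ((hXc p (Ioo_subset_Icc_self hp)).continuousAt
      (Icc_mem_nhds hp.1 hp.2)) h4 (by linarith) ?_
    filter_upwards [Icc_mem_nhds hp.1 hp.2] with q hq
    exact (hX q hq).2

lemma gs_hm_am {α β A B : ℝ} (hαβ : α + β = 1) (hA : 0 < A) (hB : 0 < B) :
    (α * A + β * B) * (α * A⁻¹ + β * B⁻¹) = 1 + α * β * ((A - B) ^ 2 / (A * B)) := by
  have : β = 1 - α := by linarith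
  subst this
  field_simp
  ring

lemma gs_key (hM : ∀ x, |W x| ≤ M) (hW : Continuous W) (hconv : ConvexOn ℝ (Icc a b) W)
    {Θ : ℝ → ℝ → ℝ} (hΘ : ∀ l, IsPr a b W l (Θ l)) {s t ls lt α β : ℝ}
    (has : a < s) (hs : s ≤ b) (hat : a < t) (ht : t ≤ b) (hst : s ≠ t)
    (hα : 0 < α) (hβ : 0 < β) (hαβ : α + β = 1)
    (hls : Θ ls s = Real.pi) (hlt : Θ lt t = Real.pi) :
    Real.pi < Θ (α * ls + β * lt) (α * s + β * t) := by
  obtain ⟨X, m1, hm1, hX0, hXpi, hXc, hX, hXd⟩ := gs_inverse hM hW hconv (hΘ ls) has hs hls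
  obtain ⟨Y, m2, hm2, hY0, hYpi, hYc, hY, hYd⟩ := gs_inverse hM hW hconv (hΘ lt) hat ht hlt
  set L := α * ls + β * lt with hL
  set P := Θ L with hP
  have hPpr : IsPr a b W L P := hΘ L
  set A : ℝ → ℝ := fun p => gsF (ls - W (X p)) p with hAdef
  set B : ℝ → ℝ := fun p => gsF (lt - W (Y p)) p with hBdef
  set Z : ℝ → ℝ := fun p => α * X p + β * Y p with hZdef
  have hpi := Real.pi_pos
  have hXb : ∀ p ∈ Icc 0 Real.pi, X p ∈ Icc a b := fun p hp =>
    ⟨(hX p hp).1.1, (hX p hp).1.2.trans hs⟩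
  have hYb : ∀ p ∈ Icc 0 Real.pi, Y p ∈ Icc a b := fun p hp =>
    ⟨(hY p hp).1.1, (hY p hp).1.2.trans ht⟩
  have hZb : ∀ p ∈ Icc 0 Real.pi, Z p ∈ Icc a b := fun p hp =>
    convex_Icc a b (hXb p hp) (hYb p hp) hα.le hβ.le hαβ
  have hApos : ∀ p ∈ Icc 0 Real.pi, 0 < A p := fun p hp => hm1.trans_le (hX p hp).2
  have hBpos : ∀ p ∈ Icc 0 Real.pi, 0 < B p := fun p hp => hm2.trans_le (hY p hp).2
  have hFge : ∀ p ∈ Icc 0 Real.pi, α * A p + β * B p ≤ gsF (L - W (Z p)) p := by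
    intro p hp
    have h1 := hconv.2 (hXb p hp) (hYb p hp) hα.le hβ.le hαβ
    simp only [smul_eq_mul] at h1
    have h2 : gsF (L - W (Z p)) p - (α * A p + β * B p)
        = (α * W (X p) + β * W (Y p) - W (Z p)) * Real.sin p ^ 2 := by
      have : β = 1 - α := by linarith
      simp only [hAdef, hBdef, gsF, hL]
      rw [this]
      ring
    have h3 : 0 ≤ (α * W (X p) + β * W (Y p) - W (Z p)) * Real.sin p ^ 2 :=
      mul_nonneg (sub_nonneg.2 h1) (sq_nonneg _)
    linarith
  set D : ℝ → ℝ := fun p => α * (A p)⁻¹ + β * (B p)⁻¹ with hDdef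
  have hDpos : ∀ p ∈ Icc 0 Real.pi, 0 ≤ D p := fun p hp => by
    have := hApos p hp
    have := hBpos p hp
    simp only [hDdef]; positivity
  have hDle : ∀ p ∈ Icc 0 Real.pi, D p ≤ α * m1⁻¹ + β * m2⁻¹ := fun p hp => by
    have h1 : (A p)⁻¹ ≤ m1⁻¹ := inv_anti₀ hm1 (hX p hp).2
    have h2 : (B p)⁻¹ ≤ m2⁻¹ := inv_anti₀ hm2 (hY p hp).2
    simp only [hDdef]
    gcongr
  have hZd : ∀ p ∈ Ioo 0 Real.pi, HasDerivAt Z (D p) p := fun p hp =>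
    ((hXd p hp).const_mul α).add ((hYd p hp).const_mul β)
  have hZc : ContinuousOn Z (Icc 0 Real.pi) := by fun_prop
  set K0 := |L| + M + 1 with hK0
  have hK0nn : 0 ≤ K0 := by
    have := (abs_nonneg _).trans (hM 0)
    have := abs_nonneg L
    linarith
  have hQc : ContinuousOn (fun p => P (Z p) - p) (Icc 0 Real.pi) :=
    (hPpr.cont.comp hZc hZb).sub continuousOn_id
  have hQd : ∀ p ∈ Ioo 0 Real.pi, HasDerivAt (fun p => P (Z p) - p)
      (gsF (L - W (Z p)) (P (Z p)) * D p - 1) p := fun p hp =>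
    ((hPpr.2 _ (hZb p (Ioo_subset_Icc_self hp))).comp p (hZd p hp)).sub (hasDerivAt_id p)
  have hQ : ∀ p ∈ Ioo 0 Real.pi, -(K0 * (α * m1⁻¹ + β * m2⁻¹)) * |P (Z p) - p|
      ≤ gsF (L - W (Z p)) (P (Z p)) * D p - 1 := by
    intro p hp'
    have hp := Ioo_subset_Icc_self hp'
    have h1 := (abs_le.1 (gsF_lip (gs_kbound hM L (Z p)) (P (Z p)) p)).1
    have h2 := hFge p hp
    have h3 := gs_hm_am hαβ (hApos p hp) (hBpos p hp)
    have h4 : 0 ≤ α * β * ((A p - B p) ^ 2 / (A p * B p)) := by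
      have := hApos p hp
      have := hBpos p hp
      positivity
    have h5 : (α * A p + β * B p - K0 * |P (Z p) - p|) * D p
        ≤ gsF (L - W (Z p)) (P (Z p)) * D p :=
      mul_le_mul_of_nonneg_right (by linarith) (hDpos p hp)
    have h6 : K0 * |P (Z p) - p| * D p ≤ K0 * |P (Z p) - p| * (α * m1⁻¹ + β * m2⁻¹) :=
      mul_le_mul_of_nonneg_left (hDle p hp) (by positivity)
    have h7 : (α * A p + β * B p) * D p = 1 + α * β * ((A p - B p) ^ 2 / (A p * B p)) := h3
    nlinarith
  have hQ0 : 0 ≤ P (Z 0) - 0 := by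
    have : Z 0 = a := by
      simp only [hZdef, hX0, hY0]; rw [← add_mul, hαβ, one_mul]
    rw [this, hPpr.1, sub_zero]
  have hZpi : Z Real.pi = α * s + β * t := by simp only [hZdef, hXpi, hYpi]
  have hnn := gs_compare hQc hQd hQ hQ0 Real.pi (right_mem_Icc.2 hpi.le)
  simp only [hZpi] at hnn
  refine lt_of_le_of_ne (by linarith) fun heq => hst ?_
  have hz := gs_compare_eq hQc hQd hQ hQ0 (by simp only [hZpi]; linarith)
  have hAB : ∀ p ∈ Ioo 0 Real.pi, A p = B p := by
    intro p hp'
    have hp := Ioo_subset_Icc_self hp'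
    have h2 : HasDerivAt (fun p => P (Z p) - p) 0 p := by
      refine (hasDerivAt_const _ (0 : ℝ)).congr_of_eventuallyEq ?_
      filter_upwards [Icc_mem_nhds hp'.1 hp'.2] with q hq
      exact hz q hq
    have h3 := (hQd p hp').unique h2
    have h4 : P (Z p) = p := by linarith [hz p hp]
    rw [h4] at h3
    have h5 := mul_le_mul_of_nonneg_right (hFge p hp) (hDpos p hp)
    have h7 : (α * A p + β * B p) * D p = 1 + α * β * ((A p - B p) ^ 2 / (A p * B p)) :=
      gs_hm_am hαβ (hApos p hp) (hBpos p hp)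
    by_contra hne
    have h8 : 0 < α * β * ((A p - B p) ^ 2 / (A p * B p)) := by
      have h9 := hApos p hp
      have h10 := hBpos p hp
      have h11 : 0 < (A p - B p) ^ 2 := by
        have := sub_ne_zero.2 hne
        positivity
      positivity
    linarith
  have hXYd : ∀ p ∈ Ioo 0 Real.pi, HasDerivAt (fun p => X p - Y p) 0 p := by
    intro p hp
    refine ((hXd p hp).sub (hYd p hp)).congr_deriv ?_
    change (A p)⁻¹ - (B p)⁻¹ = 0
    rw [hAB p hp, sub_self]
  have hge := gs_compare (K := 0) (hXc.sub hYc) hXYd (by simp) (by simp [hX0, hY0])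
    Real.pi (right_mem_Icc.2 hpi.le)
  have hle := gs_compare (K := 0) (hYc.sub hXc)
    (fun p hp => by
      have h1 := (hXYd p hp).neg
      rw [neg_zero] at h1
      refine h1.congr_of_eventuallyEq (Eventually.of_forall fun z => ?_)
      simp) (Q' := fun _ => 0) (by simp) (by simp [hX0, hY0])
    Real.pi (right_mem_Icc.2 hpi.le)
  simp only [Pi.sub_apply, hXpi, hYpi] at hge hle
  linarith

end Main

end GroundStateHelpers

/-- if `V` is convex and not affine on `[a,b]` then `λ` is strictly
convex on `(a,b]`. -/
theorem ground_state_strictConvex (a b : ℝ) (hab : a < b)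
    (V : ℝ → ℝ) (hV : ContinuousOn V (Set.Icc a b))
    (hconv : ConvexOn ℝ (Set.Icc a b) V)
    (hnotaffine : ¬ ∃ c d : ℝ, ∀ x ∈ Set.Icc a b, V x = c * x + d) :
    ∀ s ∈ Set.Ioc a b, ∀ t ∈ Set.Ioc a b, s ≠ t → ∀ θ ∈ Set.Ioo (0 : ℝ) 1,
      groundStateEnergy a V (θ * s + (1 - θ) * t) <
        θ * groundStateEnergy a V s + (1 - θ) * groundStateEnergy a V t := by
  intro s hs t ht hst θ hθ
  -- extend the potential continuously to the whole line
  let W : ℝ → ℝ := fun x => V (max a (min b x))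
  have hproj : ∀ x, max a (min b x) ∈ Set.Icc a b := fun x =>
    ⟨le_max_left _ _, max_le hab.le (min_le_left _ _)⟩
  have hW : Continuous W := hV.comp_continuous (by fun_prop) hproj
  have hVW : ∀ x ∈ Set.Icc a b, V x = W x := by
    intro x hx
    simp only [W]
    rw [min_eq_right hx.2, max_eq_right hx.1]
  obtain ⟨M, hM'⟩ := isCompact_Icc.exists_bound_of_continuousOn hV
  have hM : ∀ x, |W x| ≤ M := fun x => hM' _ (hproj x)
  have hWconv : ConvexOn ℝ (Set.Icc a b) W := hconv.congr hVW
  choose Θ hΘ using fun l => gs_exists_pr hab hW hM l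
  obtain ⟨ls, hls⟩ := gs_exists_eig hM hW hΘ hs.1 hs.2
  obtain ⟨lt, hlt⟩ := gs_exists_eig hM hW hΘ ht.1 ht.2
  have h1θ : 0 < 1 - θ := by linarith [hθ.2]
  have hr : θ * s + (1 - θ) * t ∈ Set.Ioc a b :=
    convex_Ioc a b hs ht hθ.1.le h1θ.le (by ring)
  have hkey := gs_key hM hW hWconv hΘ hs.1 hs.2 ht.1 ht.2 hst hθ.1 h1θ (by ring) hls hlt
  obtain ⟨l, hl, hlpi⟩ := gs_exists_le hM hΘ ⟨hr.1.le, hr.2⟩ hkey.le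
  rw [gs_energy_congr hVW hs.1 hs.2, gs_energy_congr hVW ht.1 ht.2,
    gs_energy_congr hVW hr.1 hr.2, gs_energy_eq hM hW (hΘ ls) hs.1 hs.2 hls,
    gs_energy_eq hM hW (hΘ lt) ht.1 ht.2 hlt, gs_energy_eq hM hW (hΘ l) hr.1 hr.2 hlpi]
  refine lt_of_le_of_ne hl fun heq => ?_
  rw [← heq, hlpi] at hkey
  exact lt_irrefl _ hkey
end

section
/- If V is convex or concave on [a,b], then the map t ↦ λ(t) is twice differentiable on the open interval (a,b). -/
open MeasureTheory Set

/-- Data of the solution of the initial value problem, with its parameter derivatives. -/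
structure SolData (a b : ℝ) (V : ℝ → ℝ) where
  Y : ℝ → ℝ → ℝ
  P : ℝ → ℝ → ℝ
  Yd : ℝ → ℝ → ℝ
  Pd : ℝ → ℝ → ℝ
  Ydd : ℝ → ℝ → ℝ
  cY : Continuous (fun z : ℝ × ℝ => Y z.1 z.2)
  cP : Continuous (fun z : ℝ × ℝ => P z.1 z.2)
  cYd : Continuous (fun z : ℝ × ℝ => Yd z.1 z.2)
  cPd : Continuous (fun z : ℝ × ℝ => Pd z.1 z.2)
  cYdd : Continuous (fun z : ℝ × ℝ => Ydd z.1 z.2)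
  Ya : ∀ μ, Y a μ = 0
  Pa : ∀ μ, P a μ = 1
  Yda : ∀ μ, Yd a μ = 0
  dY : ∀ μ, ∀ x ∈ Ioo a b, HasDerivAt (fun x => Y x μ) (P x μ) x
  dP : ∀ μ, ∀ x ∈ Ioo a b, HasDerivAt (fun x => P x μ) ((V x - μ) * Y x μ) x
  dYd : ∀ μ, ∀ x ∈ Ioo a b, HasDerivAt (fun x => Yd x μ) (Pd x μ) x
  dPd : ∀ μ, ∀ x ∈ Ioo a b, HasDerivAt (fun x => Pd x μ) ((V x - μ) * Yd x μ - Y x μ) x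
  mY : ∀ x μ, HasDerivAt (fun μ => Y x μ) (Yd x μ) μ
  mP : ∀ x μ, HasDerivAt (fun μ => P x μ) (Pd x μ) μ
  mYd : ∀ x μ, HasDerivAt (fun μ => Yd x μ) (Ydd x μ) μ

section Volterra

variable {a b : ℝ}

lemma gs_cont_ext (hab : a ≤ b) (f : C(Icc a b, ℝ)) :
    Continuous (fun s => f (projIcc a b hab s)) := f.continuous.comp continuous_projIcc

/-- The integration operator on `C([a,b])`. -/
noncomputable def gsJ (hab : a ≤ b) : C(Icc a b, ℝ) →L[ℝ] C(Icc a b, ℝ) :=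
  LinearMap.mkContinuous
    { toFun := fun f => ⟨fun x => ∫ s in a..(x : ℝ), f (projIcc a b hab s),
        (intervalIntegral.continuous_primitive
          (fun _ _ => (gs_cont_ext hab f).intervalIntegrable _ _) a).comp continuous_subtype_val⟩
      map_add' := by
        intro f g
        ext x
        simp only [ContinuousMap.coe_mk, ContinuousMap.add_apply]
        exact intervalIntegral.integral_add ((gs_cont_ext hab f).intervalIntegrable _ _)
          ((gs_cont_ext hab g).intervalIntegrable _ _)
      map_smul' := by
        intro c f
        ext x
        simp } (b - a) (by
      intro f
      rw [ContinuousMap.norm_le _ (mul_nonneg (sub_nonneg.2 hab) (norm_nonneg _))]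
      intro x
      have := intervalIntegral.norm_integral_le_of_norm_le_const
        (a := a) (b := (x : ℝ)) (C := ‖f‖) (f := fun s => f (projIcc a b hab s))
        (fun s _ => f.norm_coe_le_norm _)
      refine this.trans ?_
      rw [abs_of_nonneg (sub_nonneg.2 x.2.1), mul_comm]
      exact mul_le_mul_of_nonneg_right (by linarith [x.2.2]) (norm_nonneg _))

lemma gsJ_apply (hab : a ≤ b) (f : C(Icc a b, ℝ)) (x : Icc a b) :
    gsJ hab f x = ∫ s in a..(x : ℝ), f (projIcc a b hab s) := rfl

lemma gsJ_bound (hab : a ≤ b) (f : C(Icc a b, ℝ)) (c : ℝ) (n : ℕ)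
    (h : ∀ x, |f x| ≤ c * ((x : ℝ) - a) ^ n / n.factorial) (x : Icc a b) :
    |gsJ hab f x| ≤ c * ((x : ℝ) - a) ^ (n + 1) / (n + 1).factorial := by
  rw [gsJ_apply]
  have h1 : ‖∫ s in a..(x : ℝ), f (projIcc a b hab s)‖
      ≤ ∫ s in a..(x : ℝ), c * (s - a) ^ n / n.factorial := by
    apply intervalIntegral.norm_integral_le_of_norm_le x.2.1
    · filter_upwards with s hs
      have := h (projIcc a b hab s)
      rw [projIcc_of_mem hab ⟨hs.1.le, hs.2.trans x.2.2⟩] at this ⊢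
      exact this
    · exact Continuous.intervalIntegrable (by fun_prop) _ _
  rw [Real.norm_eq_abs] at h1
  refine h1.trans (le_of_eq ?_)
  have : ∀ y ∈ uIcc a (x : ℝ), HasDerivAt
      (fun s => c * (s - a) ^ (n + 1) / (n + 1).factorial) (c * (y - a) ^ n / n.factorial) y := by
    intro y _
    have := (((hasDerivAt_id y).sub_const a).pow (n + 1)).const_mul c |>.div_const
      ((n + 1).factorial : ℝ)
    convert! this using 1
    rw [Nat.factorial_succ]
    have h0 : (n.factorial : ℝ) ≠ 0 := by positivity
    have h2 : ((n : ℝ) + 1) ≠ 0 := by positivity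
    push_cast
    simp only [id]
    field_simp
  rw [intervalIntegral.integral_eq_sub_of_hasDerivAt this
    (Continuous.intervalIntegrable (by fun_prop) _ _)]
  simp

/-- The operator `f ↦ ∫∫ q f`. -/
noncomputable def gsT (hab : a ≤ b) (q : C(Icc a b, ℝ)) : C(Icc a b, ℝ) →L[ℝ] C(Icc a b, ℝ) :=
  gsJ hab ∘L gsJ hab ∘L ContinuousLinearMap.mul ℝ (C(Icc a b, ℝ)) q

lemma gsT_apply (hab : a ≤ b) (q f : C(Icc a b, ℝ)) :
    gsT hab q f = gsJ hab (gsJ hab (q * f)) := rfl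

lemma gsT_pow_bound (hab : a ≤ b) (q f : C(Icc a b, ℝ)) (n : ℕ) (x : Icc a b) :
    |((gsT hab q) ^ n) f x| ≤ (‖q‖ ^ n * ‖f‖) * ((x : ℝ) - a) ^ (2 * n) / (2 * n).factorial := by
  induction n generalizing x with
  | zero => simpa using f.norm_coe_le_norm x
  | succ n ih =>
    rw [pow_succ', mul_apply_eq_comp, gsT_apply]
    refine gsJ_bound hab _ _ (2 * n + 1) (fun y => gsJ_bound hab _ _ (2 * n) (fun z => ?_) y) x
    rw [ContinuousMap.mul_apply, abs_mul, pow_succ']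
    calc _ ≤ ‖q‖ * ((‖q‖ ^ n * ‖f‖) * ((z : ℝ) - a) ^ (2 * n) / (2 * n).factorial) :=
          mul_le_mul (q.norm_coe_le_norm z) (ih z) (abs_nonneg _) (norm_nonneg _)
      _ = _ := by ring

lemma gsT_isUnit (hab : a ≤ b) (q : C(Icc a b, ℝ)) : IsUnit (1 - gsT hab q) := by
  have hlim := FloorSemiring.tendsto_pow_div_factorial_atTop ((‖q‖ + 1) * (b - a + 1))
  have hlim2 := hlim.comp (Filter.tendsto_id.const_mul_atTop' (r := 2) (by norm_num))
  obtain ⟨n, hn⟩ := (hlim2.eventually (gt_mem_nhds (show (0 : ℝ) < 1 / 2 by norm_num))).exists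
  have hba : 0 ≤ b - a := sub_nonneg.2 hab
  have hnorm : ‖(gsT hab q) ^ n‖ ≤ 1 / 2 := by
    apply ContinuousLinearMap.opNorm_le_bound _ (by norm_num)
    intro f
    rw [ContinuousMap.norm_le _ (by positivity)]
    intro x
    refine (gsT_pow_bound hab q f n x).trans ?_
    have hx0 : 0 ≤ (x : ℝ) - a := sub_nonneg.2 x.2.1
    have h1 : ((x : ℝ) - a) ^ (2 * n) ≤ (b - a + 1) ^ (2 * n) :=
      pow_le_pow_left₀ hx0 (by linarith [x.2.2]) _
    have h2 : ‖q‖ ^ n ≤ (‖q‖ + 1) ^ (2 * n) :=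
      (pow_le_pow_left₀ (norm_nonneg q) (by linarith) _).trans
        (pow_le_pow_right₀ (by linarith [norm_nonneg q]) (by omega))
    calc _ = ‖q‖ ^ n * ((x : ℝ) - a) ^ (2 * n) / (2 * n).factorial * ‖f‖ := by ring
      _ ≤ (‖q‖ + 1) ^ (2 * n) * (b - a + 1) ^ (2 * n) / (2 * n).factorial * ‖f‖ := by gcongr
      _ ≤ 1 / 2 * ‖f‖ := by
        apply mul_le_mul_of_nonneg_right _ (norm_nonneg _)
        have := hn.le
        simp only [Function.comp, id] at this
        rwa [mul_pow] at this
  have hu : IsUnit (1 - gsT hab q ^ n) := isUnit_one_sub_of_norm_lt_one (x := gsT hab q ^ n) (by linarith)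
  rw [← mul_neg_geom_sum] at hu
  refine ((Commute.isUnit_mul_iff ?_).1 hu).1
  rw [Commute, SemiconjBy, mul_neg_geom_sum, geom_sum_mul_neg]

lemma gsJ_deriv (hab : a ≤ b) (f : C(Icc a b, ℝ)) (x : ℝ) (hx : x ∈ Ioo a b) :
    HasDerivAt (fun x => gsJ hab f (projIcc a b hab x)) (f (projIcc a b hab x)) x := by
  have h := intervalIntegral.integral_hasDerivAt_right (a := a) (b := x)
    ((gs_cont_ext hab f).intervalIntegrable _ _)
    (gs_cont_ext hab f).stronglyMeasurable.stronglyMeasurableAtFilter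
    (gs_cont_ext hab f).continuousAt
  refine h.congr_of_eventuallyEq ?_
  filter_upwards [Ioo_mem_nhds hx.1 hx.2] with y hy
  rw [gsJ_apply, projIcc_of_mem hab ⟨hy.1.le, hy.2.le⟩]

lemma gsJ_left (hab : a ≤ b) (f : C(Icc a b, ℝ)) : gsJ hab f (projIcc a b hab a) = 0 := by
  rw [gsJ_apply, projIcc_left]; simp

lemma gs_joint (hab : a ≤ b) (F : ℝ → C(Icc a b, ℝ)) (hF : Continuous F) :
    Continuous (fun z : ℝ × ℝ => F z.2 (projIcc a b hab z.1)) := by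
  have : Continuous (fun z : ℝ × ℝ => (F z.2, projIcc a b hab z.1)) :=
    (hF.comp continuous_snd).prodMk (continuous_projIcc.comp continuous_fst)
  exact continuous_eval.comp this

lemma gs_mderiv (hab : a ≤ b) (F : ℝ → C(Icc a b, ℝ)) (F' : C(Icc a b, ℝ)) (μ x : ℝ)
    (hF : HasDerivAt F F' μ) :
    HasDerivAt (fun μ => F μ (projIcc a b hab x)) (F' (projIcc a b hab x)) μ :=
  (ContinuousMap.evalCLM ℝ (projIcc a b hab x) : C(Icc a b, ℝ) →L[ℝ] ℝ).hasFDerivAt.comp_hasDerivAt μ hF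

theorem gs_exists_sol (hab : a < b) (V : ℝ → ℝ) (hV : ContinuousOn V (Icc a b)) :
    Nonempty (SolData a b V) := by
  set J := gsJ hab.le with hJ
  let v : C(Icc a b, ℝ) := ⟨fun x => V x, hV.domRestrict⟩
  let R : ℝ → (C(Icc a b, ℝ) →L[ℝ] C(Icc a b, ℝ)) := fun μ => 1 - gsT hab.le (v - μ • 1)
  have hRunit : ∀ μ, IsUnit (R μ) := fun μ => gsT_isUnit hab.le _
  have hR : ContDiff ℝ 3 R := by
    have : R = fun μ : ℝ => (1 - gsT hab.le v) + μ • gsT hab.le 1 := by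
      funext μ
      ext1 f
      simp only [R, sub_apply, add_apply,
        smul_apply, gsT_apply, sub_mul, map_sub, smul_mul_assoc, map_smul]
      abel
    rw [this]
    have h1 : ContDiff ℝ 3 (ContinuousLinearMap.toSpanSingleton ℝ (gsT hab.le 1)) :=
      ContinuousLinearMap.contDiff _
    exact contDiff_const.add h1
  let U : ℝ → C(Icc a b, ℝ) := fun μ => Ring.inverse (R μ) (J 1)
  have hU : ContDiff ℝ 3 U := by
    have h1 : ContDiff ℝ 3 (fun μ => Ring.inverse (R μ)) := by
      rw [contDiff_iff_contDiffAt]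
      intro μ
      obtain ⟨w, hw⟩ := hRunit μ
      have := contDiffAt_ringInverse (R := C(Icc a b, ℝ) →L[ℝ] C(Icc a b, ℝ)) (n := 3) ℝ w
      rw [hw] at this
      exact this.comp μ hR.contDiffAt
    exact h1.clm_apply contDiff_const
  have hUeq : ∀ μ, U μ = J (1 + J ((v - μ • 1) * U μ)) := by
    intro μ
    have h1 : R μ (U μ) = J 1 := by
      change (R μ * Ring.inverse (R μ)) (J 1) = J 1
      rw [Ring.mul_inverse_cancel _ (hRunit μ)]; rfl
    simp only [R, sub_apply, one_apply_eq_self, gsT_apply] at h1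
    rw [map_add, ← h1]
    abel
  let Ud := deriv U
  have hUd : ContDiff ℝ 2 Ud := by
    have : ContDiff ℝ (2 + 1) U := by convert hU using 1; norm_num
    exact (contDiff_succ_iff_deriv.1 this).2.2
  let Udd := deriv Ud
  have hUdd : ContDiff ℝ 1 Udd := by
    have : ContDiff ℝ (1 + 1) Ud := by convert hUd using 1; norm_num
    exact (contDiff_succ_iff_deriv.1 this).2.2
  have dU : ∀ μ, HasDerivAt U (Ud μ) μ := fun μ => (hU.differentiable (by norm_num) μ).hasDerivAt
  have dUd : ∀ μ, HasDerivAt Ud (Udd μ) μ :=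
    fun μ => (hUd.differentiable (by norm_num) μ).hasDerivAt
  let P : ℝ → C(Icc a b, ℝ) := fun μ => 1 + J ((v - μ • 1) * U μ)
  let Pd : ℝ → C(Icc a b, ℝ) := fun μ => J ((v - μ • 1) * Ud μ - U μ)
  have dP : ∀ μ, HasDerivAt P (Pd μ) μ := by
    intro μ
    have h1 : HasDerivAt (fun μ : ℝ => v - μ • (1 : C(Icc a b, ℝ))) (-(1 : C(Icc a b, ℝ))) μ := by
      simpa using ((hasDerivAt_id μ).smul_const (1 : C(Icc a b, ℝ))).const_sub v
    have h2 := (J.hasFDerivAt.comp_hasDerivAt μ (h1.mul (dU μ))).const_add 1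
    convert! h2 using 1
    simp only [Pd]
    congr 1
    rw [neg_one_mul]; abel
  have hUP : ∀ μ, U μ = J (P μ) := hUeq
  have hUdPd : ∀ μ, Ud μ = J (Pd μ) := by
    intro μ
    have h2 := (J.hasFDerivAt.comp_hasDerivAt μ (dP μ))
    have : U = fun μ => J (P μ) := funext hUP
    exact (dU μ).unique (by rw [this]; exact h2)
  have cU := hU.continuous
  have cUd := hUd.continuous
  have cUdd := hUdd.continuous
  have cP : Continuous P := by
    simp only [P]
    fun_prop
  have cPd : Continuous Pd := by
    simp only [Pd]
    fun_prop
  have hvx : ∀ μ : ℝ, ∀ x ∈ Ioo a b, (v - μ • 1) (projIcc a b hab.le x) = V x - μ := by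
    intro μ x hx
    rw [projIcc_of_mem hab.le ⟨hx.1.le, hx.2.le⟩]
    simp only [v, ContinuousMap.sub_apply, ContinuousMap.smul_apply,
      ContinuousMap.one_apply, smul_eq_mul, mul_one]
    rfl
  refine ⟨{
    Y := fun x μ => U μ (projIcc a b hab.le x)
    P := fun x μ => P μ (projIcc a b hab.le x)
    Yd := fun x μ => Ud μ (projIcc a b hab.le x)
    Pd := fun x μ => Pd μ (projIcc a b hab.le x)
    Ydd := fun x μ => Udd μ (projIcc a b hab.le x)
    cY := gs_joint hab.le _ cU
    cP := gs_joint hab.le _ cP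
    cYd := gs_joint hab.le _ cUd
    cPd := gs_joint hab.le _ cPd
    cYdd := gs_joint hab.le _ cUdd
    Ya := ?_, Pa := ?_, Yda := ?_, dY := ?_, dP := ?_, dYd := ?_, dPd := ?_
    mY := fun x μ => gs_mderiv hab.le _ _ _ _ (dU μ)
    mP := fun x μ => gs_mderiv hab.le _ _ _ _ (dP μ)
    mYd := fun x μ => gs_mderiv hab.le _ _ _ _ (dUd μ) }⟩
  · intro μ
    rw [hUP]; exact gsJ_left _ _
  · intro μ
    simp only [P, ContinuousMap.add_apply, hJ, gsJ_left]
    simp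
  · intro μ
    rw [hUdPd]; exact gsJ_left _ _
  · intro μ x hx
    rw [hUP]; exact gsJ_deriv _ _ x hx
  · intro μ x hx
    have := (gsJ_deriv hab.le ((v - μ • 1) * U μ) x hx).const_add 1
    rw [ContinuousMap.mul_apply, hvx μ x hx] at this
    exact this
  · intro μ x hx
    rw [hUdPd]; exact gsJ_deriv _ _ x hx
  · intro μ x hx
    have := (gsJ_deriv hab.le ((v - μ • 1) * Ud μ - U μ) x hx)
    rw [ContinuousMap.sub_apply, ContinuousMap.mul_apply, hvx μ x hx] at this
    exact this

end Volterra

section Abstract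

open Filter Topology

variable {a b : ℝ} {V : ℝ → ℝ}

namespace SolData

variable (S : SolData a b V)

lemma cYx (μ : ℝ) : Continuous (fun x => S.Y x μ) :=
  S.cY.comp (continuous_id.prodMk continuous_const)
lemma cPx (μ : ℝ) : Continuous (fun x => S.P x μ) :=
  S.cP.comp (continuous_id.prodMk continuous_const)
lemma cYdx (μ : ℝ) : Continuous (fun x => S.Yd x μ) :=
  S.cYd.comp (continuous_id.prodMk continuous_const)
lemma cPdx (μ : ℝ) : Continuous (fun x => S.Pd x μ) :=
  S.cPd.comp (continuous_id.prodMk continuous_const)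
lemma cYm (x : ℝ) : Continuous (fun μ => S.Y x μ) :=
  S.cY.comp (continuous_const.prodMk continuous_id)

lemma wronsk (μ t : ℝ) (ht : t ∈ Ioo a b) :
    S.P t μ * S.Yd t μ - S.Y t μ * S.Pd t μ = ∫ x in a..t, (S.Y x μ) ^ 2 := by
  rw [intervalIntegral.integral_eq_sub_of_hasDerivAt_of_le ht.1.le
    (f := fun x => S.P x μ * S.Yd x μ - S.Y x μ * S.Pd x μ)]
  · simp [S.Ya, S.Yda]
  · exact (((S.cPx μ).mul (S.cYdx μ)).sub ((S.cYx μ).mul (S.cPdx μ))).continuousOn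
  · intro x hx
    have hx' : x ∈ Ioo a b := ⟨hx.1, hx.2.trans ht.2⟩
    have := ((S.dP μ x hx').mul (S.dYd μ x hx')).sub ((S.dY μ x hx').mul (S.dPd μ x hx'))
    convert! this using 1
    ring
  · exact ((S.cYx μ).pow 2).intervalIntegrable _ _

lemma near (hab : a < b) (μ₀ : ℝ) : ∃ δ > 0, a + δ < b ∧ ∀ μ, |μ - μ₀| < δ → ∀ x ∈ Ioo a (a + δ),
    S.P x μ < 2 ∧ (x - a) / 2 ≤ S.Y x μ := by
  have h := S.cP.continuousAt (x := (a, μ₀))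
  have h1 : ∀ᶠ z : ℝ × ℝ in 𝓝 (a, μ₀), S.P z.1 z.2 ∈ Ioo (1 / 2 : ℝ) 2 := by
    apply h
    simp only [S.Pa]
    exact Ioo_mem_nhds (by norm_num) (by norm_num)
  obtain ⟨ε, hε, h2⟩ := Metric.eventually_nhds_iff.1 h1
  refine ⟨min ε ((b - a) / 2), lt_min hε (by linarith), ?_, ?_⟩
  · have := min_le_right ε ((b - a) / 2); linarith
  · intro μ hμ x hx
    have hδ1 := min_le_left ε ((b - a) / 2)
    have hδ2 := min_le_right ε ((b - a) / 2)
    have key : ∀ y ∈ Ioo a (a + min ε ((b - a) / 2)), S.P y μ ∈ Ioo (1 / 2 : ℝ) 2 := by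
      intro y hy
      apply @h2 (y, μ)
      rw [Prod.dist_eq, Real.dist_eq, Real.dist_eq]
      apply max_lt
      · simp only; rw [abs_of_pos (by linarith [hy.1])]; linarith [hy.2]
      · exact hμ.trans_le hδ1
    refine ⟨(key x hx).2, ?_⟩
    obtain ⟨c, hc, hc2⟩ := exists_hasDerivAt_eq_slope (fun x => S.Y x μ) (fun x => S.P x μ) hx.1
      (S.cYx μ).continuousOn (fun y hy => S.dY μ y ⟨hy.1, by linarith [hy.2, hx.2]⟩)
    have h3 := (key c ⟨hc.1, hc.2.trans hx.2⟩).1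
    rw [hc2, S.Ya, sub_zero, lt_div_iff₀ (by linarith [hx.1])] at h3
    linarith

lemma intpos (hab : a < b) (μ t : ℝ) (ht : a < t) : 0 < ∫ x in a..t, (S.Y x μ) ^ 2 := by
  obtain ⟨δ, hδ, _, h⟩ := S.near hab μ
  apply intervalIntegral.integral_pos ht ((S.cYx μ).pow 2).continuousOn (fun _ _ => sq_nonneg _)
  have hm : 0 < min (δ / 2) (t - a) := lt_min (by linarith) (by linarith)
  have h1 := min_le_left (δ / 2) (t - a)
  have h2 := min_le_right (δ / 2) (t - a)
  refine ⟨a + min (δ / 2) (t - a), ⟨by linarith, by linarith⟩, ?_⟩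
  have := (h μ (by simpa using hδ) (a + min (δ / 2) (t - a)) ⟨by linarith, by linarith⟩).2
  have : 0 < S.Y (a + min (δ / 2) (t - a)) μ := by linarith
  exact pow_pos this 2

lemma nodouble (μ t : ℝ) (ht : t ∈ Ioo a b) (h0 : S.Y t μ = 0) :
    S.P t μ ≠ 0 ∧ S.Yd t μ ≠ 0 := by
  have h1 := S.wronsk μ t ht
  have h2 := S.intpos (ht.1.trans ht.2) μ t ht.1
  rw [← h1, h0, zero_mul, sub_zero] at h2
  exact ⟨left_ne_zero_of_mul h2.ne', right_ne_zero_of_mul h2.ne'⟩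

lemma pos_open (hab : a < b) (μ₀ c : ℝ) (h : ∀ x ∈ Ioc a c, 0 < S.Y x μ₀) :
    ∀ᶠ μ in 𝓝 μ₀, ∀ x ∈ Ioc a c, 0 < S.Y x μ := by
  obtain ⟨δ, hδ, _, hn⟩ := S.near hab μ₀
  have h1 : ∀ᶠ μ in 𝓝 μ₀, ∀ x ∈ Icc (a + δ / 2) c, 0 < S.Y x μ := by
    apply isCompact_Icc.eventually_forall_of_forall_eventually
    intro x hx
    have h2 : Continuous (fun z : ℝ × ℝ => S.Y z.2 z.1) := S.cY.comp continuous_swap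
    exact (h2.continuousAt (x := (μ₀, x))).eventually_const_lt
      (h x ⟨by linarith [hx.1], hx.2⟩)
  have h2 : ∀ᶠ μ in 𝓝 μ₀, |μ - μ₀| < δ := by
    have := Metric.ball_mem_nhds μ₀ hδ
    filter_upwards [this] with μ hμ
    simpa [Real.dist_eq] using hμ
  filter_upwards [h1, h2] with μ hμ1 hμ2 x hx
  by_cases hxc : x < a + δ
  · have := (hn μ hμ2 x ⟨hx.1, hxc⟩).2
    linarith [hx.1]
  · exact hμ1 x ⟨by linarith, hx.2⟩

lemma lower (hab : a < b) (hV : ContinuousOn V (Icc a b)) (μ t : ℝ) (ht : t ∈ Ioo a b)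
    (hpos : ∀ x ∈ Ioc a t, 0 < S.Y x μ) (u u' : ℝ → ℝ) (hu : MemH10 a t u u') :
    μ * (∫ x in a..t, (u x) ^ 2) ≤ ∫ x in a..t, ((u' x) ^ 2 + V x * (u x) ^ 2) := by
  obtain ⟨huc, hud, hui, hua, hut⟩ := hu
  have hat := ht.1.le
  have hVt : ContinuousOn V (Icc a t) := hV.mono (Icc_subset_Icc le_rfl ht.2.le)
  have i1 : IntervalIntegrable (fun x => u x ^ 2) volume a t :=
    ContinuousOn.intervalIntegrable_of_Icc hat (huc.pow 2)
  have i2 : IntervalIntegrable (fun x => V x * u x ^ 2) volume a t :=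
    ContinuousOn.intervalIntegrable_of_Icc hat (hVt.mul (huc.pow 2))
  have iF : IntervalIntegrable (fun x => u' x ^ 2 + V x * u x ^ 2 - μ * u x ^ 2) volume a t :=
    (hui.add i2).sub (i1.const_mul μ)
  rw [← sub_nonneg, ← intervalIntegral.integral_const_mul,
    ← intervalIntegral.integral_sub (hui.add i2) (i1.const_mul μ)]
  have iF' : IntegrableOn (fun x => u' x ^ 2 + V x * u x ^ 2 - μ * u x ^ 2) (Icc a t) :=
    (intervalIntegrable_iff_integrableOn_Icc_of_le hat).1 iF
  have iu' : IntegrableOn (fun x => u' x ^ 2) (Icc a t) :=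
    (intervalIntegrable_iff_integrableOn_Icc_of_le hat).1 hui
  obtain ⟨δ, hδ, _, hn⟩ := S.near hab μ
  have cont : ContinuousOn (fun α => (∫ x in α..t, (u' x ^ 2 + V x * u x ^ 2 - μ * u x ^ 2))
      + 4 * ∫ x in a..α, u' x ^ 2) (Icc a t) := by
    rw [← uIcc_of_le hat] at iF' iu' ⊢
    exact (intervalIntegral.continuousOn_primitive_interval_left iF').add
      ((intervalIntegral.continuousOn_primitive_interval iu').const_mul 4)
  have lim := ((cont a (left_mem_Icc.2 hat)).mono_of_mem_nhdsWithin
    (Icc_mem_nhdsGT ht.1)).tendsto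
  simp only [intervalIntegral.integral_same, mul_zero, add_zero] at lim
  refine ge_of_tendsto lim ?_
  filter_upwards [Ioo_mem_nhdsGT (show a < min t (a + δ) from lt_min ht.1 (by linarith))] with α hα
  have hαt : α < t := hα.2.trans_le (min_le_left _ _)
  have hαδ : α < a + δ := hα.2.trans_le (min_le_right _ _)
  have haα := hα.1
  obtain ⟨hP, hY⟩ := hn μ (by simpa using hδ) α ⟨haα, hαδ⟩
  -- bound of `u α ^ 2`
  have hA : u α ^ 2 ≤ (α - a) * ∫ x in a..α, u' x ^ 2 := by
    set k := u α / (α - a) with hk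
    have hsub : Icc a α ⊆ Icc a t := Icc_subset_Icc le_rfl hαt.le
    have h1 := intervalIntegral.sub_le_integral_of_hasDeriv_right_of_le haα.le
      (g := fun x => 2 * k * u x) (g' := fun x => 2 * k * u' x) (φ := fun x => u' x ^ 2 + k ^ 2)
      (continuousOn_const.mul (huc.mono hsub))
      (fun x hx => ((hud x ⟨hx.1, hx.2.trans hαt⟩).const_mul (2 * k)).hasDerivWithinAt)
      ((iu'.mono_set hsub).add (continuousOn_const.integrableOn_Icc))
      (fun x _ => by nlinarith [sq_nonneg (u' x - k)])
    rw [intervalIntegral.integral_add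
      ((intervalIntegrable_iff_integrableOn_Icc_of_le haα.le).2 (iu'.mono_set hsub)) (by simp),
      intervalIntegral.integral_const, hua, smul_eq_mul] at h1
    have hk2 : u α = k * (α - a) := by rw [hk]; field_simp [(sub_pos.2 haα).ne']
    have h3 : 0 < α - a := sub_pos.2 haα
    rw [hk2] at h1 ⊢
    have h4 : k ^ 2 * (α - a) ≤ ∫ x in a..α, u' x ^ 2 := by nlinarith
    nlinarith
  -- Picone
  have hB : - (u α ^ 2 * S.P α μ / S.Y α μ)
      ≤ ∫ x in α..t, (u' x ^ 2 + V x * u x ^ 2 - μ * u x ^ 2) := by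
    have hsub : Icc α t ⊆ Icc a t := Icc_subset_Icc haα.le le_rfl
    have h1 := intervalIntegral.sub_le_integral_of_hasDeriv_right_of_le hαt.le
      (g := fun x => u x ^ 2 * S.P x μ / S.Y x μ)
      (g' := fun x => ((((2 : ℕ) * u x ^ (2 - 1) * u' x) * S.P x μ
        + u x ^ 2 * ((V x - μ) * S.Y x μ)) * S.Y x μ - u x ^ 2 * S.P x μ * S.P x μ) / S.Y x μ ^ 2)
      (φ := fun x => u' x ^ 2 + V x * u x ^ 2 - μ * u x ^ 2)
      ((((huc.mono hsub).pow 2).mul (S.cPx μ).continuousOn).div (S.cYx μ).continuousOn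
        (fun x hx => (hpos x ⟨by linarith [hx.1], hx.2⟩).ne'))
      (fun x hx => by
        have hx1 : x ∈ Ioo a t := ⟨haα.trans hx.1, hx.2⟩
        have hx2 : x ∈ Ioo a b := ⟨hx1.1, hx.2.trans ht.2⟩
        exact ((((hud x hx1).pow 2).mul (S.dP μ x hx2)).div (S.dY μ x hx2)
          (hpos x ⟨hx1.1, hx.2.le⟩).ne').hasDerivWithinAt)
      (iF'.mono_set hsub)
      (fun x hx => by
        have hy : 0 < S.Y x μ := hpos x ⟨haα.trans hx.1, hx.2.le⟩
        have h2 : (u' x ^ 2 + V x * u x ^ 2 - μ * u x ^ 2) -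
          ((((2 : ℕ) * u x ^ (2 - 1) * u' x) * S.P x μ
          + u x ^ 2 * ((V x - μ) * S.Y x μ)) * S.Y x μ - u x ^ 2 * S.P x μ * S.P x μ) / S.Y x μ ^ 2
          = (u' x - u x * S.P x μ / S.Y x μ) ^ 2 := by
          push_cast
          field_simp
          ring
        have h3 := sq_nonneg (u' x - u x * S.P x μ / S.Y x μ)
        rw [← h2] at h3
        exact sub_nonneg.1 h3)
    simpa [hut] using h1
  have hC : u α ^ 2 * S.P α μ / S.Y α μ ≤ 4 * ∫ x in a..α, u' x ^ 2 := by
    have hy : 0 < S.Y α μ := hpos α ⟨haα, hαt.le⟩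
    rw [div_le_iff₀ hy]
    have hI : 0 ≤ ∫ x in a..α, u' x ^ 2 :=
      intervalIntegral.integral_nonneg haα.le (fun _ _ => sq_nonneg _)
    nlinarith [sq_nonneg (u α), mul_le_mul_of_nonneg_left hY hI]
  linarith

end SolData

/-- Normalisation of a test function. -/
lemma gs_normalise (t : ℝ) (w w' : ℝ → ℝ) (hw : MemH10 a t w w')
    (hN : 0 < ∫ x in a..t, (w x) ^ 2) :
    ∃ u u' : ℝ → ℝ, MemH10 a t u u' ∧ (∫ x in a..t, (u x) ^ 2) = 1 ∧
    (∫ x in a..t, ((w' x) ^ 2 + V x * (w x) ^ 2)) / (∫ x in a..t, (w x) ^ 2)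
      = ∫ x in a..t, ((u' x) ^ 2 + V x * (u x) ^ 2) := by
  set N := ∫ x in a..t, (w x) ^ 2 with hNd
  obtain ⟨h1, h2, h3, h4, h5⟩ := hw
  have hc : ((Real.sqrt N)⁻¹) ^ 2 = N⁻¹ := by rw [inv_pow, Real.sq_sqrt hN.le]
  set c := (Real.sqrt N)⁻¹ with hcd
  refine ⟨fun x => c * w x, fun x => c * w' x, ⟨continuousOn_const.mul h1,
    fun x hx => (h2 x hx).const_mul c, ?_, by simp [h4], by simp [h5]⟩, ?_, ?_⟩
  · simp only [mul_pow]
    exact h3.const_mul _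
  · simp only [mul_pow]
    rw [intervalIntegral.integral_const_mul, hc, ← hNd, inv_mul_cancel₀ hN.ne']
  · rw [div_eq_inv_mul, ← hc, ← intervalIntegral.integral_const_mul]
    congr 1
    ext x
    ring

lemma gs_test (t : ℝ) (ht : a < t) : ∃ u u' : ℝ → ℝ, MemH10 a t u u' ∧
    (∫ x in a..t, (u x) ^ 2) = 1 := by
  have hc : Continuous (fun x : ℝ => (x - a) * (t - x)) := by fun_prop
  have h : MemH10 a t (fun x => (x - a) * (t - x)) (fun x => 1 * (t - x) + (x - a) * (-1)) := by
    refine ⟨hc.continuousOn, fun x _ => ?_, ?_, by simp, by simp⟩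
    · exact ((hasDerivAt_id x).sub_const a).mul ((hasDerivAt_id x).const_sub t)
    · exact Continuous.intervalIntegrable (by fun_prop) _ _
  obtain ⟨u, u', h1, h2, _⟩ := gs_normalise (V := fun _ => 0) t _ _ h (by
    apply intervalIntegral.integral_pos ht (hc.pow 2).continuousOn (fun _ _ => sq_nonneg _)
    refine ⟨(a + t) / 2, ⟨by linarith, by linarith⟩, ?_⟩
    have : 0 < (((a + t) / 2) - a) * (t - (a + t) / 2) :=
      mul_pos (by linarith) (by linarith)
    exact pow_pos this 2)
  exact ⟨u, u', h1, h2⟩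

namespace SolData

variable (S : SolData a b V)

lemma upper (hV : ContinuousOn V (Icc a b)) (μ t : ℝ) (ht : t ∈ Ioo a b) (h0 : S.Y t μ = 0) :
    ∃ u u' : ℝ → ℝ, MemH10 a t u u' ∧ (∫ x in a..t, (u x) ^ 2) = 1 ∧
      μ = ∫ x in a..t, ((u' x) ^ 2 + V x * (u x) ^ 2) := by
  have hN := S.intpos (ht.1.trans ht.2) μ t ht.1
  obtain ⟨u, u', h1, h2, h3⟩ := gs_normalise (V := V) t (fun x => S.Y x μ) (fun x => S.P x μ)
    ⟨(S.cYx μ).continuousOn, fun x hx => S.dY μ x ⟨hx.1, hx.2.trans ht.2⟩,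
      ((S.cPx μ).pow 2).intervalIntegrable _ _, S.Ya μ, h0⟩ hN
  refine ⟨u, u', h1, h2, ?_⟩
  rw [← h3, eq_div_iff hN.ne']
  have hVt : ContinuousOn V (Icc a t) := hV.mono (Icc_subset_Icc le_rfl ht.2.le)
  have i1 : IntervalIntegrable (fun x => S.P x μ ^ 2 + V x * S.Y x μ ^ 2) volume a t :=
    ContinuousOn.intervalIntegrable_of_Icc ht.1.le
      (((S.cPx μ).pow 2).continuousOn.add (hVt.mul ((S.cYx μ).pow 2).continuousOn))
  have i2 : IntervalIntegrable (fun x => μ * S.Y x μ ^ 2) volume a t :=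
    (continuous_const.mul ((S.cYx μ).pow 2)).intervalIntegrable _ _
  rw [eq_comm, ← sub_eq_zero, ← intervalIntegral.integral_const_mul,
    ← intervalIntegral.integral_sub i1 i2]
  rw [intervalIntegral.integral_eq_sub_of_hasDerivAt_of_le ht.1.le
    (f := fun x => S.Y x μ * S.P x μ)]
  · simp [S.Ya, h0]
  · exact ((S.cYx μ).mul (S.cPx μ)).continuousOn
  · intro x hx
    have hx' : x ∈ Ioo a b := ⟨hx.1, hx.2.trans ht.2⟩
    convert! (S.dY μ x hx').mul (S.dP μ x hx') using 1
    ring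
  · exact i1.sub i2

lemma exists_pos (hV : ContinuousOn V (Icc a b)) (t : ℝ) (ht : t ∈ Ioo a b) :
    ∃ μ, ∀ x ∈ Ioc a t, 0 < S.Y x μ := by
  have hab := ht.1.trans ht.2
  obtain ⟨m, hm⟩ := (isCompact_Icc.bddBelow_image hV)
  have hm' : ∀ x ∈ Icc a b, m ≤ V x := fun x hx => hm (mem_image_of_mem _ hx)
  refine ⟨m, ?_⟩
  have mono1 : MonotoneOn (fun x => S.Y x m * S.P x m) (Icc a t) := by
    apply monotoneOn_of_hasDerivWithinAt_nonneg (convex_Icc a t)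
      ((S.cYx m).mul (S.cPx m)).continuousOn
      (f' := fun x => S.P x m * S.P x m + S.Y x m * ((V x - m) * S.Y x m))
    · intro x hx
      rw [interior_Icc] at hx
      have hx' : x ∈ Ioo a b := ⟨hx.1, hx.2.trans ht.2⟩
      exact ((S.dY m x hx').mul (S.dP m x hx')).hasDerivWithinAt
    · intro x hx
      rw [interior_Icc] at hx
      have := hm' x ⟨hx.1.le, hx.2.le.trans ht.2.le⟩
      nlinarith [mul_nonneg (sub_nonneg.2 this) (sq_nonneg (S.Y x m)), sq_nonneg (S.P x m)]
  have mono2 : MonotoneOn (fun x => S.Y x m * S.Y x m) (Icc a t) := by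
    apply monotoneOn_of_hasDerivWithinAt_nonneg (convex_Icc a t)
      ((S.cYx m).mul (S.cYx m)).continuousOn
      (f' := fun x => S.P x m * S.Y x m + S.Y x m * S.P x m)
    · intro x hx
      rw [interior_Icc] at hx
      have hx' : x ∈ Ioo a b := ⟨hx.1, hx.2.trans ht.2⟩
      exact ((S.dY m x hx').mul (S.dY m x hx')).hasDerivWithinAt
    · intro x hx
      rw [interior_Icc] at hx
      have := mono1 (left_mem_Icc.2 ht.1.le) ⟨hx.1.le, hx.2.le⟩ hx.1.le
      simp only [S.Ya, zero_mul] at this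
      linarith
  obtain ⟨δ, hδ, _, hn⟩ := S.near hab m
  have hnear : ∀ x ∈ Ioo a (a + δ), 0 < S.Y x m := by
    intro x hx
    have := (hn m (by simpa using hδ) x hx).2
    linarith [hx.1]
  have hne : ∀ x ∈ Ioc a t, S.Y x m ≠ 0 := by
    intro x hx h0
    have hmm : 0 < min (δ / 2) (x - a) := lt_min (by linarith) (by linarith [hx.1])
    have h1 := min_le_left (δ / 2) (x - a)
    have h2 := min_le_right (δ / 2) (x - a)
    have h3 := hnear (a + min (δ / 2) (x - a)) ⟨by linarith, by linarith⟩
    have h4 := mono2 (a := a + min (δ / 2) (x - a)) (b := x) ⟨by linarith, by linarith [hx.2]⟩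
      ⟨hx.1.le, hx.2⟩ (by linarith)
    simp only [h0, mul_zero] at h4
    nlinarith
  intro x hx
  by_contra hcon
  push Not at hcon
  have hmm : 0 < min (δ / 2) (x - a) := lt_min (by linarith) (by linarith [hx.1])
  have h1 := min_le_left (δ / 2) (x - a)
  have h2 := min_le_right (δ / 2) (x - a)
  have h3 := hnear (a + min (δ / 2) (x - a)) ⟨by linarith, by linarith⟩
  obtain ⟨y, hy, hy0⟩ := intermediate_value_Icc' (a := a + min (δ / 2) (x - a)) (b := x)
    (by linarith) (S.cYx m).continuousOn ⟨hcon, h3.le⟩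
  exact hne y ⟨by linarith [hy.1], hy.2.trans hx.2⟩ hy0

lemma eigen (hV : ContinuousOn V (Icc a b)) (t : ℝ) (ht : t ∈ Ioo a b) :
    S.Y t (groundStateEnergy a V t) = 0 ∧
      ∀ x ∈ Ioo a t, 0 < S.Y x (groundStateEnergy a V t) := by
  have hab := ht.1.trans ht.2
  set A : Set ℝ := {μ | ∀ x ∈ Ioc a t, 0 < S.Y x μ} with hA
  have hAne : A.Nonempty := S.exists_pos hV t ht
  have hle : ∀ u u' : ℝ → ℝ, MemH10 a t u u' → (∫ x in a..t, (u x) ^ 2) = 1 → ∀ μ ∈ A,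
      μ ≤ ∫ x in a..t, ((u' x) ^ 2 + V x * (u x) ^ 2) := by
    intro u u' hu h1 μ hμ
    have := S.lower hab hV μ t ht hμ u u' hu
    rwa [h1, mul_one] at this
  obtain ⟨u₀, u₀', hu₀, hu₁⟩ := gs_test t ht.1
  have hbdd : BddAbove A := ⟨_, hle u₀ u₀' hu₀ hu₁⟩
  set l := sSup A with hl
  have hlA : l ∉ A := by
    intro hmem
    have h1 := S.pos_open hab l t hmem
    obtain ⟨ε, hε, h2⟩ := Metric.eventually_nhds_iff.1 h1
    have h3 : l + ε / 2 ∈ A := h2 (by rw [Real.dist_eq, add_sub_cancel_left, abs_of_pos (by linarith)]; linarith)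
    have := le_csSup hbdd h3
    linarith
  have hnn : ∀ x ∈ Ioc a t, 0 ≤ S.Y x l := by
    intro x hx
    have h1 : IsClosed {μ | 0 ≤ S.Y x μ} := isClosed_le continuous_const (S.cYm x)
    have h2 : closure A ⊆ {μ | 0 ≤ S.Y x μ} :=
      h1.closure_subset_iff.2 (fun μ hμ => (hμ x hx).le)
    exact h2 (csSup_mem_closure hAne hbdd)
  have hpos : ∀ x ∈ Ioo a t, 0 < S.Y x l := by
    intro x hx
    refine lt_of_le_of_ne (hnn x ⟨hx.1, hx.2.le⟩) (fun h0 => ?_)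
    have hx' : x ∈ Ioo a b := ⟨hx.1, hx.2.trans ht.2⟩
    have hmin : IsLocalMin (fun x => S.Y x l) x := by
      filter_upwards [Ioo_mem_nhds hx.1 hx.2] with y hy
      rw [← h0]
      exact hnn y ⟨hy.1, hy.2.le⟩
    exact (S.nodouble l x hx' h0.symm).1 (hmin.hasDerivAt_eq_zero (S.dY l x hx'))
  have h0 : S.Y t l = 0 := by
    by_contra hne
    apply hlA
    intro x hx
    rcases hx.2.eq_or_lt with h | h
    · subst h
      exact lt_of_le_of_ne (hnn x hx) (Ne.symm hne)
    · exact hpos x ⟨hx.1, h⟩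
  have hg : groundStateEnergy a V t = l := by
    apply IsLeast.csInf_eq
    refine ⟨S.upper hV l t ht h0, ?_⟩
    rintro E ⟨u, u', hu, h1, rfl⟩
    exact csSup_le hAne (hle u u' hu h1)
  rw [hg]
  exact ⟨h0, hpos⟩

lemma unique (μ ν t : ℝ) (ht : t ∈ Ioo a b) (h1 : S.Y t μ = 0) (h2 : S.Y t ν = 0)
    (p1 : ∀ x ∈ Ioo a t, 0 < S.Y x μ) (p2 : ∀ x ∈ Ioo a t, 0 < S.Y x ν) : μ = ν := by
  have hint : ∫ x in a..t, (ν - μ) * (S.Y x μ * S.Y x ν) = 0 := by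
    rw [intervalIntegral.integral_eq_sub_of_hasDerivAt_of_le ht.1.le
      (f := fun x => S.P x μ * S.Y x ν - S.Y x μ * S.P x ν)]
    · simp [S.Ya, h1, h2]
    · exact (((S.cPx μ).mul (S.cYx ν)).sub ((S.cYx μ).mul (S.cPx ν))).continuousOn
    · intro x hx
      have hx' : x ∈ Ioo a b := ⟨hx.1, hx.2.trans ht.2⟩
      convert! ((S.dP μ x hx').mul (S.dY ν x hx')).sub
        ((S.dY μ x hx').mul (S.dP ν x hx')) using 1
      ring
    · exact (continuous_const.mul ((S.cYx μ).mul (S.cYx ν))).intervalIntegrable _ _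
  rw [intervalIntegral.integral_const_mul] at hint
  have hp : 0 < ∫ x in a..t, S.Y x μ * S.Y x ν := by
    apply intervalIntegral.integral_pos ht.1 ((S.cYx μ).mul (S.cYx ν)).continuousOn
    · intro x hx
      rcases hx.2.eq_or_lt with h | h
      · subst h; simp [h1]
      · exact (mul_pos (p1 x ⟨hx.1, h⟩) (p2 x ⟨hx.1, h⟩)).le
    · have hm : (a + t) / 2 ∈ Ioo a t := ⟨by linarith [ht.1], by linarith [ht.1]⟩
      exact ⟨(a + t) / 2, ⟨hm.1.le, hm.2.le⟩, mul_pos (p1 _ hm) (p2 _ hm)⟩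
  rcases mul_eq_zero.1 hint with h | h
  · linarith
  · exact absurd h hp.ne'

end SolData

/-- Joint strict differentiability from continuous partial derivatives. -/
lemma gs_strict (f f₁ f₂ : ℝ → ℝ → ℝ) (u : ℝ × ℝ)
    (d1 : ∀ᶠ v in 𝓝 u, HasDerivAt (fun x => f x v.2) (f₁ v.1 v.2) v.1)
    (d2 : ∀ᶠ v in 𝓝 u, HasDerivAt (fun m => f v.1 m) (f₂ v.1 v.2) v.2)
    (c1 : ContinuousAt (fun z : ℝ × ℝ => f₁ z.1 z.2) u)
    (c2 : ContinuousAt (fun z : ℝ × ℝ => f₂ z.1 z.2) u) :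
    HasStrictFDerivAt (fun z : ℝ × ℝ => f z.1 z.2)
      ((ContinuousLinearMap.toSpanSingleton ℝ (f₁ u.1 u.2)).coprod
        (ContinuousLinearMap.toSpanSingleton ℝ (f₂ u.1 u.2))) u := by
  have hc : Continuous (fun r : ℝ => ContinuousLinearMap.toSpanSingleton ℝ r) :=
    (ContinuousLinearMap.toSpanSingletonCLE (𝕜 := ℝ) (E := ℝ)).continuous
  exact hasStrictFDerivAt_uncurry_coprod (𝕜 := ℝ) (f := f)
    (f₁ := fun x m => ContinuousLinearMap.toSpanSingleton ℝ (f₁ x m))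
    (f₂ := fun x m => ContinuousLinearMap.toSpanSingleton ℝ (f₂ x m))
    (d1.mono fun v hv => hv.hasFDerivAt) (d2.mono fun v hv => hv.hasFDerivAt)
    (hc.continuousAt.comp c1) (hc.continuousAt.comp c2)

namespace SolData

variable (S : SolData a b V)

lemma ev_Ioo (t μ : ℝ) (ht : t ∈ Ioo a b) : ∀ᶠ v : ℝ × ℝ in 𝓝 (t, μ), v.1 ∈ Ioo a b :=
  continuous_fst.continuousAt.eventually_mem (Ioo_mem_nhds ht.1 ht.2)

lemma strictY (t μ : ℝ) (ht : t ∈ Ioo a b) :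
    HasStrictFDerivAt (fun z : ℝ × ℝ => S.Y z.1 z.2)
      ((ContinuousLinearMap.toSpanSingleton ℝ (S.P t μ)).coprod
        (ContinuousLinearMap.toSpanSingleton ℝ (S.Yd t μ))) (t, μ) :=
  gs_strict S.Y S.P S.Yd (t, μ) ((ev_Ioo t μ ht).mono fun v hv => S.dY v.2 v.1 hv)
    (Eventually.of_forall fun v => S.mY v.1 v.2) S.cP.continuousAt S.cYd.continuousAt

lemma diffP (hV : ContinuousOn V (Icc a b)) (t μ : ℝ) (ht : t ∈ Ioo a b) :
    DifferentiableAt ℝ (fun z : ℝ × ℝ => S.P z.1 z.2) (t, μ) := by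
  refine (gs_strict S.P (fun x m => (V x - m) * S.Y x m) S.Pd (t, μ)
    ((ev_Ioo t μ ht).mono fun v hv => S.dP v.2 v.1 hv)
    (Eventually.of_forall fun v => S.mP v.1 v.2) ?_
    S.cPd.continuousAt).hasFDerivAt.differentiableAt
  have hVt : ContinuousAt V t := hV.continuousAt (Icc_mem_nhds ht.1 ht.2)
  have h1 : ContinuousAt (fun z : ℝ × ℝ => V z.1) (t, μ) :=
    ContinuousAt.comp (f := Prod.fst) hVt continuous_fst.continuousAt
  exact (h1.sub continuous_snd.continuousAt).mul S.cY.continuousAt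

lemma diffYd (t μ : ℝ) (ht : t ∈ Ioo a b) :
    DifferentiableAt ℝ (fun z : ℝ × ℝ => S.Yd z.1 z.2) (t, μ) :=
  (gs_strict S.Yd S.Pd S.Ydd (t, μ) ((ev_Ioo t μ ht).mono fun v hv => S.dYd v.2 v.1 hv)
    (Eventually.of_forall fun v => S.mYd v.1 v.2) S.cPd.continuousAt
    S.cYdd.continuousAt).hasFDerivAt.differentiableAt

lemma pos_near (t μ : ℝ) (ht : t ∈ Ioo a b) (h0 : S.Y t μ = 0)
    (hp : ∀ x ∈ Ioo a t, 0 < S.Y x μ) :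
    ∀ᶠ v : ℝ × ℝ in 𝓝 (t, μ), S.Y v.1 v.2 = 0 → ∀ x ∈ Ioo a v.1, 0 < S.Y x v.2 := by
  have hab := ht.1.trans ht.2
  have hPneg : S.P t μ < 0 := by
    refine lt_of_le_of_ne ?_ (S.nodouble μ t ht h0).1
    by_contra hcon
    push Not at hcon
    have h1 : ∀ᶠ x in 𝓝 t, 0 < S.P x μ := (S.cPx μ).continuousAt.eventually_const_lt hcon
    obtain ⟨ε, hε, h2⟩ := Metric.eventually_nhds_iff.1 h1
    have hm : max (a + (t - a) / 2) (t - ε / 2) < t := max_lt (by linarith [ht.1]) (by linarith)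
    have hm1 := le_max_left (a + (t - a) / 2) (t - ε / 2)
    have hm2 := le_max_right (a + (t - a) / 2) (t - ε / 2)
    set y := max (a + (t - a) / 2) (t - ε / 2)
    have hay : a < y := by linarith [ht.1]
    obtain ⟨c, hc, hc2⟩ := exists_hasDerivAt_eq_slope (fun x => S.Y x μ) (fun x => S.P x μ) hm
      (S.cYx μ).continuousOn (fun z hz => S.dY μ z ⟨by linarith [hz.1], by linarith [hz.2, ht.2]⟩)
    have h3 : 0 < S.P c μ := h2 (by
      rw [Real.dist_eq, abs_lt]; constructor <;> linarith [hc.1, hc.2])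
    rw [hc2, h0, zero_sub] at h3
    have h4 := hp y ⟨hay, hm⟩
    have h5 : -S.Y y μ / (t - y) < 0 := div_neg_of_neg_of_pos (by linarith) (by linarith)
    linarith
  have h1 : ∀ᶠ v : ℝ × ℝ in 𝓝 (t, μ), S.P v.1 v.2 < 0 :=
    S.cP.continuousAt.eventually_lt_const hPneg
  obtain ⟨ε, hε, h2⟩ := Metric.eventually_nhds_iff.1 h1
  have hδ : 0 < min ε ((t - a)) := lt_min hε (by linarith [ht.1])
  have hδ1 := min_le_left ε (t - a)
  have hδ2 := min_le_right ε (t - a)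
  set δ := min ε (t - a)
  have h3 := S.pos_open hab μ (t - δ / 2) (fun x hx => hp x ⟨hx.1, by linarith [hx.2]⟩)
  have h3' : ∀ᶠ v : ℝ × ℝ in 𝓝 (t, μ), ∀ x ∈ Ioc a (t - δ / 2), 0 < S.Y x v.2 :=
    (continuous_snd.tendsto (t, μ)).eventually h3
  filter_upwards [h3', Metric.ball_mem_nhds (t, μ) hδ, ev_Ioo t μ ht] with v hv1 hv2 hv3 hv0 x hx
  by_cases hxc : x ≤ t - δ / 2
  · exact hv1 x ⟨hx.1, hxc⟩
  · push Not at hxc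
    rw [Metric.mem_ball, Prod.dist_eq, max_lt_iff, Real.dist_eq, Real.dist_eq, abs_lt] at hv2
    obtain ⟨c, hc, hc2⟩ := exists_hasDerivAt_eq_slope (fun x => S.Y x v.2) (fun x => S.P x v.2) hx.2
      (S.cYx v.2).continuousOn
      (fun z hz => S.dY v.2 z ⟨by linarith [hz.1, hx.1], by linarith [hz.2, hv3.2]⟩)
    have h4 : S.P c v.2 < 0 := by
      apply @h2 (c, v.2)
      rw [Prod.dist_eq, Real.dist_eq, Real.dist_eq]
      apply max_lt
      · rw [abs_lt]; constructor <;> simp only <;> linarith [hc.1, hc.2, hv2.1.2]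
      · exact hv2.2.trans_le hδ1
    rw [hc2, hv0, zero_sub, div_lt_iff₀ (by linarith [hx.2]), zero_mul] at h4
    linarith

lemma hasDeriv (hV : ContinuousOn V (Icc a b)) (t : ℝ) (ht : t ∈ Ioo a b) :
    HasDerivAt (groundStateEnergy a V)
      (-S.P t (groundStateEnergy a V t) / S.Yd t (groundStateEnergy a V t)) t := by
  obtain ⟨h0, hp⟩ := S.eigen hV t ht
  set μ := groundStateEnergy a V t
  have hYd := (S.nodouble μ t ht h0).2
  have hs := S.strictY t μ ht
  have hinv : (((ContinuousLinearMap.toSpanSingleton ℝ (S.P t μ)).coprod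
        (ContinuousLinearMap.toSpanSingleton ℝ (S.Yd t μ))) ∘L
          ContinuousLinearMap.inr ℝ ℝ ℝ).IsInvertible := by
    rw [ContinuousLinearMap.coprod_comp_inr]
    exact ⟨ContinuousLinearEquiv.unitsEquivAut ℝ (Units.mk0 _ hYd), by ext; simp⟩
  have hψt := hs.tendsto_implicitFunctionOfProdDomain hinv
  have hψ0 := hs.eventually_apply_implicitFunctionOfProdDomain hinv
  have hψd := (hs.hasStrictFDerivAt_implicitFunctionOfProdDomain hinv).hasFDerivAt.differentiableAt
  set ψ := hs.implicitFunctionOfProdDomain hinv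
  simp only at hψt hψ0 hψd
  have hpair : Tendsto (fun x => (x, ψ x)) (𝓝 t) (𝓝 (t, μ)) := by
    rw [nhds_prod_eq]; exact tendsto_id.prodMk hψt
  have heq : groundStateEnergy a V =ᶠ[𝓝 t] ψ := by
    filter_upwards [hψ0, hpair.eventually (S.pos_near t μ ht h0 hp), Ioo_mem_nhds ht.1 ht.2]
      with x hx1 hx2 hx3
    have hx0 : S.Y x (ψ x) = 0 := hx1.trans h0
    obtain ⟨e0, ep⟩ := S.eigen hV x hx3
    exact S.unique _ _ x hx3 e0 hx0 ep (hx2 hx0)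
  have hψμ : ψ t = μ := heq.self_of_nhds.symm
  have hd := hψd.hasDerivAt
  have hs' := hs.hasFDerivAt
  have hcomp : HasDerivAt (fun x => S.Y x (ψ x)) (S.P t μ + deriv ψ t * S.Yd t μ) t := by
    have h1 : HasDerivAt (fun x => (x, ψ x)) ((1 : ℝ), deriv ψ t) t :=
      (hasDerivAt_id t).prodMk hd
    rw [← hψμ] at hs'
    have := HasFDerivAt.comp_hasDerivAt t hs' h1
    convert! this using 1
    simp [hψμ]
  have hzero : HasDerivAt (fun x => S.Y x (ψ x)) 0 t := by
    refine (hasDerivAt_const t (0 : ℝ)).congr_of_eventuallyEq ?_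
    filter_upwards [hψ0] with x hx
    exact hx.trans h0
  have hrel := hcomp.unique hzero
  have : -S.P t μ / S.Yd t μ = deriv ψ t := by
    rw [div_eq_iff hYd]; linarith
  rw [this]
  exact hd.congr_of_eventuallyEq heq

end SolData

end Abstract

/-- if `V` is convex or concave on `[a,b]` then `λ` is twice
differentiable on `(a,b)`. -/
theorem ground_state_twice_differentiable (a b : ℝ) (hab : a < b)
    (V : ℝ → ℝ) (hV : ContinuousOn V (Set.Icc a b))
    (hcc : ConvexOn ℝ (Set.Icc a b) V ∨ ConcaveOn ℝ (Set.Icc a b) V) :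
    ∀ t ∈ Set.Ioo a b, DifferentiableAt ℝ (groundStateEnergy a V) t ∧
      DifferentiableAt ℝ (deriv (groundStateEnergy a V)) t := by
  obtain ⟨S⟩ := gs_exists_sol hab V hV
  intro t ht
  have hd := S.hasDeriv hV t ht
  refine ⟨hd.differentiableAt, ?_⟩
  have heq : deriv (groundStateEnergy a V) =ᶠ[nhds t] fun x =>
      -S.P x (groundStateEnergy a V x) / S.Yd x (groundStateEnergy a V x) := by
    filter_upwards [Ioo_mem_nhds ht.1 ht.2] with x hx
    exact (S.hasDeriv hV x hx).deriv
  refine DifferentiableAt.congr_of_eventuallyEq ?_ heq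
  have hpair : DifferentiableAt ℝ (fun x => (x, groundStateEnergy a V x)) t :=
    differentiableAt_id.prodMk hd.differentiableAt
  have h1 : DifferentiableAt ℝ (fun x => S.P x (groundStateEnergy a V x)) t :=
    DifferentiableAt.comp t (g := fun z : ℝ × ℝ => S.P z.1 z.2)
      (f := fun x => (x, groundStateEnergy a V x)) (S.diffP hV t _ ht) hpair
  have h2 : DifferentiableAt ℝ (fun x => S.Yd x (groundStateEnergy a V x)) t :=
    DifferentiableAt.comp t (g := fun z : ℝ × ℝ => S.Yd z.1 z.2)
      (f := fun x => (x, groundStateEnergy a V x)) (S.diffYd t _ ht) hpair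
  exact h1.neg.div h2 (S.nodouble _ t ht (S.eigen hV t ht).1).2
end
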